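/- Let A be a ring that is left and right noetherian and admits a dualizing complex. Then the following are equivalent: (1) FPD(A) < ∞; (2) every bounded below GP-acyclic cochain complex of Gorenstein-projective A-modules is contractible; (3) every bounded below acyclic cochain complex of projective A-modules is contractible. Moreover, for an arbitrary ring A the implications (1) ⟹ (2) ⟹ (3) hold. -/

import Mathlib

open CategoryTheory CategoryTheory.Limits

universe u

variable (A : Type u) [Ring A]

/-- The category of cochain complexes of left `A`-modules. -/
abbrev Cplx := CochainComplex (ModuleCat.{u} A) ℤ

/-- A cochain complex is acyclic (exact) if all its cohomology vanishes. -/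
def IsAcyclicComplex (X : Cplx A) : Prop := ∀ n : ℤ, X.ExactAt n

/-- The complex `Hom_A(G, X)` is acyclic. -/
def HomFromAcyclic (G : ModuleCat.{u} A) (X : Cplx A) : Prop :=
  ∀ (n : ℤ) (f : G ⟶ X.X n), f ≫ X.d n (n + 1) = 0 →
    ∃ g : G ⟶ X.X (n - 1), g ≫ X.d (n - 1) n = f

/-- The complex `Hom_A(X, J)` is acyclic. -/
def HomToAcyclic (X : Cplx A) (J : ModuleCat.{u} A) : Prop :=
  ∀ (n : ℤ) (f : X.X n ⟶ J), X.d (n - 1) n ≫ f = 0 →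
    ∃ g : X.X (n + 1) ⟶ J, X.d n (n + 1) ≫ g = f

/-- A Gorenstein-projective module. -/
def IsGorensteinProjective (G : ModuleCat.{u} A) : Prop :=
  ∃ P : Cplx A, IsAcyclicComplex A P ∧ (∀ n : ℤ, Module.Projective A (P.X n)) ∧
    (∀ Q : ModuleCat.{u} A, Module.Projective A Q → HomToAcyclic A P Q) ∧
    Nonempty (G ≅ kernel (P.d 0 1))

/-- A Gorenstein-injective module. -/
def IsGorensteinInjective (J : ModuleCat.{u} A) : Prop :=
  ∃ I : Cplx A, IsAcyclicComplex A I ∧ (∀ n : ℤ, Module.Injective A (I.X n)) ∧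
    (∀ E : ModuleCat.{u} A, Module.Injective A E → HomFromAcyclic A E I) ∧
    Nonempty (J ≅ kernel (I.d 0 1))

/-- A complex `X` is GP-acyclic if `Hom_A(G,X)` is acyclic for every
Gorenstein-projective module `G`. -/
def GPAcyclic (X : Cplx A) : Prop :=
  ∀ G : ModuleCat.{u} A, IsGorensteinProjective A G → HomFromAcyclic A G X

/-- A complex `X` is GI-acyclic if `Hom_A(X,J)` is acyclic for every
Gorenstein-injective module `J`. -/
def GIAcyclic (X : Cplx A) : Prop :=
  ∀ J : ModuleCat.{u} A, IsGorensteinInjective A J → HomToAcyclic A X J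

/-- A cochain complex is contractible if its identity is homotopic to zero. -/
def Contractible (X : Cplx A) : Prop := Nonempty (Homotopy (𝟙 X) 0)

/-- A cochain complex is bounded below if `Xⁿ = 0` for all sufficiently small `n`. -/
def BoundedBelow (X : Cplx A) : Prop := ∃ a : ℤ, ∀ n < a, IsZero (X.X n)

/-- A cochain complex is bounded if `Xⁿ = 0` for all but finitely many `n`. -/
def BoundedComplex (X : Cplx A) : Prop :=
  ∃ a b : ℤ, ∀ n : ℤ, (n < a ∨ b < n) → IsZero (X.X n)

/-- `ProjDimLE n M` means that `M` has projective dimension at most `n`. -/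
def ProjDimLE : ℕ → ModuleCat.{u} A → Prop
  | 0 => fun M => Module.Projective A M
  | n + 1 => fun M => ∃ (K P : ModuleCat.{u} A) (i : K ⟶ P) (p : P ⟶ M),
      Module.Projective A P ∧ Function.Injective i ∧ Function.Surjective p ∧
      Function.Exact i p ∧ ProjDimLE n K

/-- The big finitistic projective dimension of `A` is finite. -/
def FPDFinite : Prop :=
  ∃ s : ℕ, ∀ M : ModuleCat.{u} A, (∃ n : ℕ, ProjDimLE A n M) → ProjDimLE A s M

section DualizingComplex

open TensorProduct CochainComplex.HomComplex

/-- The enveloping ring `A ⊗[ℤ] Aᵐᵒᵖ`; modules over it are `(A,A)`-bimodules. -/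
abbrev Env := TensorProduct ℤ A Aᵐᵒᵖ

/-- The inclusion `A →+* A ⊗[ℤ] Aᵐᵒᵖ` of the left factor. -/
noncomputable abbrev inclL : A →+* Env A := Algebra.TensorProduct.includeLeftRingHom

/-- The inclusion `Aᵐᵒᵖ →+* A ⊗[ℤ] Aᵐᵒᵖ` of the right factor. -/
noncomputable abbrev inclR : Aᵐᵒᵖ →+* Env A := (Algebra.TensorProduct.includeRight).toRingHom

instance : (ModuleCat.restrictScalars.{u} (inclL A)).Additive :=
  { map_add := ModuleCat.hom_ext (LinearMap.ext fun _ => rfl) }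

instance : (ModuleCat.restrictScalars.{u} (inclR A)).Additive :=
  { map_add := ModuleCat.hom_ext (LinearMap.ext fun _ => rfl) }

/-- Restriction of scalars: a bimodule viewed as a left `A`-module. -/
noncomputable abbrev resL : ModuleCat.{u} (Env A) ⥤ ModuleCat.{u} A :=
  ModuleCat.restrictScalars (inclL A)

/-- Restriction of scalars: a bimodule viewed as a right `A`-module, i.e. a
left `Aᵐᵒᵖ`-module. -/
noncomputable abbrev resR : ModuleCat.{u} (Env A) ⥤ ModuleCat.{u} Aᵐᵒᵖ :=
  ModuleCat.restrictScalars (inclR A)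

/-- A complex of bimodules viewed as a complex of left `A`-modules. -/
noncomputable abbrev resLC :
    CochainComplex (ModuleCat.{u} (Env A)) ℤ ⥤ CochainComplex (ModuleCat.{u} A) ℤ :=
  (resL A).mapHomologicalComplex (ComplexShape.up ℤ)

/-- A complex of bimodules viewed as a complex of left `Aᵐᵒᵖ`-modules. -/
noncomputable abbrev resRC :
    CochainComplex (ModuleCat.{u} (Env A)) ℤ ⥤ CochainComplex (ModuleCat.{u} Aᵐᵒᵖ) ℤ :=
  (resR A).mapHomologicalComplex (ComplexShape.up ℤ)

/-- Right multiplication by `a : A` on a bimodule, as a left `A`-linear map. -/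
noncomputable def rmul (a : A) (M : ModuleCat.{u} (Env A)) :
    (resL A).obj M ⟶ (resL A).obj M :=
  ModuleCat.ofHom (X := (resL A).obj M) (Y := (resL A).obj M)
  { toFun := fun x => ((((1 : A) ⊗ₜ[ℤ] MulOpposite.op a : Env A)) • (id x : M) : M)
    map_add' := fun x y => smul_add _ _ _
    map_smul' := fun r x => by
      change (((1 : A) ⊗ₜ[ℤ] MulOpposite.op a : Env A)) • ((inclL A r : Env A) • (id x : M))
        = (inclL A r : Env A) • (((1 : A) ⊗ₜ[ℤ] MulOpposite.op a : Env A)) • (id x : M)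
      rw [smul_smul, smul_smul]
      congr 1
      show ((1 : A) ⊗ₜ[ℤ] MulOpposite.op a : Env A) * (r ⊗ₜ[ℤ] 1)
          = (r ⊗ₜ[ℤ] 1 : Env A) * ((1 : A) ⊗ₜ[ℤ] MulOpposite.op a)
      rw [Algebra.TensorProduct.tmul_mul_tmul, Algebra.TensorProduct.tmul_mul_tmul]
      rw [one_mul, mul_one, one_mul, mul_one] }

/-- Left multiplication by `a : A` on a bimodule, as a right `A`-linear map. -/
noncomputable def lmul (a : A) (M : ModuleCat.{u} (Env A)) :
    (resR A).obj M ⟶ (resR A).obj M :=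
  ModuleCat.ofHom (X := (resR A).obj M) (Y := (resR A).obj M)
  { toFun := fun x => (((a ⊗ₜ[ℤ] (1 : Aᵐᵒᵖ) : Env A)) • (id x : M) : M)
    map_add' := fun x y => smul_add _ _ _
    map_smul' := fun r x => by
      change ((a ⊗ₜ[ℤ] (1 : Aᵐᵒᵖ) : Env A)) • ((inclR A r : Env A) • (id x : M))
        = (inclR A r : Env A) • ((a ⊗ₜ[ℤ] (1 : Aᵐᵒᵖ) : Env A)) • (id x : M)
      rw [smul_smul, smul_smul]
      congr 1
      show (a ⊗ₜ[ℤ] (1 : Aᵐᵒᵖ) : Env A) * ((1 : A) ⊗ₜ[ℤ] r)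
          = ((1 : A) ⊗ₜ[ℤ] r : Env A) * (a ⊗ₜ[ℤ] (1 : Aᵐᵒᵖ))
      rw [Algebra.TensorProduct.tmul_mul_tmul, Algebra.TensorProduct.tmul_mul_tmul]
      rw [one_mul, mul_one, one_mul, mul_one] }

/-- Right multiplication by `a : A`, as an endomorphism of a complex of
bimodules viewed as a complex of left `A`-modules.  These are the images of the
natural map `A → Hom_A(R,R)`. -/
noncomputable def rmulChain (R : CochainComplex (ModuleCat.{u} (Env A)) ℤ) (a : A) :
    (resLC A).obj R ⟶ (resLC A).obj R where
  f n := rmul A a (R.X n)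
  comm' := by
    intro i j _
    apply ModuleCat.hom_ext
    apply LinearMap.ext
    intro x
    exact (map_smul (R.d i j).hom (((1 : A) ⊗ₜ[ℤ] MulOpposite.op a : Env A)) (id x : R.X i))

/-- Left multiplication by `a : A`, as an endomorphism of a complex of
bimodules viewed as a complex of right `A`-modules.  These are the images of the
natural map `A → Hom_{Aᵒᵖ}(R,R)`. -/
noncomputable def lmulChain (R : CochainComplex (ModuleCat.{u} (Env A)) ℤ) (a : A) :
    (resRC A).obj R ⟶ (resRC A).obj R where
  f n := lmul A a (R.X n)
  comm' := by
    intro i j _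
    apply ModuleCat.hom_ext
    apply LinearMap.ext
    intro x
    exact (map_smul (R.d i j).hom ((a ⊗ₜ[ℤ] (1 : Aᵐᵒᵖ) : Env A)) (id x : R.X i))

/-- The natural map `A → Hom_A(R,R)` is a quasi-isomorphism: the Hom-complex
`Hom_A(R,R)` is exact in nonzero degrees, and its degree-zero cohomology is `A`,
via the map sending `a` to right multiplication by `a`. -/
noncomputable def LeftHomQuasiIso (R : CochainComplex (ModuleCat.{u} (Env A)) ℤ) : Prop :=
  (∀ n : ℤ, n ≠ 0 → ∀ z : Cochain ((resLC A).obj R) ((resLC A).obj R) n,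
      δ n (n + 1) z = 0 →
      ∃ w : Cochain ((resLC A).obj R) ((resLC A).obj R) (n - 1), δ (n - 1) n w = z) ∧
  (∀ z : Cochain ((resLC A).obj R) ((resLC A).obj R) 0, δ 0 1 z = 0 →
      ∃ (a : A) (w : Cochain ((resLC A).obj R) ((resLC A).obj R) (-1)),
        z = Cochain.ofHom (rmulChain A R a) + δ (-1) 0 w) ∧
  (∀ a : A,
      (∃ w : Cochain ((resLC A).obj R) ((resLC A).obj R) (-1),
        Cochain.ofHom (rmulChain A R a) = δ (-1) 0 w) → a = 0)

/-- The natural map `A → Hom_{Aᵒᵖ}(R,R)` is a quasi-isomorphism. -/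
noncomputable def RightHomQuasiIso (R : CochainComplex (ModuleCat.{u} (Env A)) ℤ) : Prop :=
  (∀ n : ℤ, n ≠ 0 → ∀ z : Cochain ((resRC A).obj R) ((resRC A).obj R) n,
      δ n (n + 1) z = 0 →
      ∃ w : Cochain ((resRC A).obj R) ((resRC A).obj R) (n - 1), δ (n - 1) n w = z) ∧
  (∀ z : Cochain ((resRC A).obj R) ((resRC A).obj R) 0, δ 0 1 z = 0 →
      ∃ (a : A) (w : Cochain ((resRC A).obj R) ((resRC A).obj R) (-1)),
        z = Cochain.ofHom (lmulChain A R a) + δ (-1) 0 w) ∧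
  (∀ a : A,
      (∃ w : Cochain ((resRC A).obj R) ((resRC A).obj R) (-1),
        Cochain.ofHom (lmulChain A R a) = δ (-1) 0 w) → a = 0)

/-- `A` admits a dualizing complex: a bounded complex `R` of `(A,A)`-bimodules
which are injective both as left and as right `A`-modules, whose cohomology is
finitely generated both as a left and as a right `A`-module, and such that the
natural maps `A → Hom_A(R,R)` and `A → Hom_{Aᵒᵖ}(R,R)` are quasi-isomorphisms. -/
noncomputable def HasDualizingComplex : Prop :=
  ∃ R : CochainComplex (ModuleCat.{u} (Env A)) ℤ,
    (∃ a b : ℤ, ∀ n : ℤ, (n < a ∨ b < n) → Limits.IsZero (R.X n)) ∧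
    (∀ n : ℤ, Module.Injective A ((resL A).obj (R.X n))) ∧
    (∀ n : ℤ, Module.Injective Aᵐᵒᵖ ((resR A).obj (R.X n))) ∧
    (∀ n : ℤ, Module.Finite A (((resLC A).obj R).homology n)) ∧
    (∀ n : ℤ, Module.Finite Aᵐᵒᵖ (((resRC A).obj R).homology n)) ∧
    LeftHomQuasiIso A R ∧ RightHomQuasiIso A R

end DualizingComplex

namespace FPDaux
section P1
variable {A}

def SES (M P N : ModuleCat.{u} A) : Prop :=
  ∃ (i : M →ₗ[A] P) (p : P →ₗ[A] N),
    Function.Injective i ∧ Function.Surjective p ∧ Function.Exact i p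

def SESproj (M N : ModuleCat.{u} A) : Prop :=
  ∃ P : ModuleCat.{u} A, Module.Projective A P ∧ SES M P N

variable (A) in
def C3 : Prop := ∀ z : ℕ → ModuleCat.{u} A, Subsingleton (z 0) →
  (∀ k, SESproj (z k) (z (k+1))) → ∀ k, Module.Projective A (z k)

theorem SES.exists_short {M P N : ModuleCat.{u} A} (h : SES M P N) :
    ∃ (f : M ⟶ P) (g : P ⟶ N) (w : f ≫ g = 0), (ShortComplex.mk f g w).ShortExact := by
  obtain ⟨i, p, hi, hp, he⟩ := h
  have w : ModuleCat.ofHom i ≫ ModuleCat.ofHom p = 0 := by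
    ext x; exact he.apply_apply_eq_zero x
  refine ⟨ModuleCat.ofHom i, ModuleCat.ofHom p, w, ?_⟩
  exact { exact := (ShortComplex.ShortExact.moduleCat_exact_iff_function_exact _).2 he
          mono_f := (ModuleCat.mono_iff_injective _).2 hi
          epi_g := (ModuleCat.epi_iff_surjective _).2 hp }

abbrev PD (n : ℕ) (M : ModuleCat.{u} A) : Prop := HasProjectiveDimensionLT M (n+1)

theorem proj_iff_PD (M : ModuleCat.{u} A) : Module.Projective A M ↔ PD 0 M := by
  exact (IsProjective.iff_projective (R := A) M).trans projective_iff_hasProjectiveDimensionLT_one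

theorem SES.PD₃ {M P N : ModuleCat.{u} A} (h : SES M P N) {n : ℕ} (hP : PD (n+1) P) (hM : PD n M) :
    PD (n+1) N := by
  obtain ⟨f, g, w, hs⟩ := h.exists_short
  exact hs.hasProjectiveDimensionLT_X₃ (n+1) hM hP

theorem SES.PD₁ {M P N : ModuleCat.{u} A} (h : SES M P N) {n : ℕ} (hP : PD n P) (hN : PD (n+1) N) :
    PD n M := by
  obtain ⟨f, g, w, hs⟩ := h.exists_short
  exact hs.hasProjectiveDimensionLT_X₁ (n+1) hP hN

theorem SES.PD₂ {M P N : ModuleCat.{u} A} (h : SES M P N) {n : ℕ} (hM : PD n M) (hN : PD n N) :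
    PD n P := by
  obtain ⟨f, g, w, hs⟩ := h.exists_short
  exact hs.hasProjectiveDimensionLT_X₂ (n+1) hM hN

theorem PD.mono {M : ModuleCat.{u} A} {n m : ℕ} (h : PD n M) (hnm : n ≤ m) : PD m M := by
  have := h
  exact hasProjectiveDimensionLT_of_ge M (n+1) (m+1) (by omega)

theorem PD.of_proj {M : ModuleCat.{u} A} (h : Module.Projective A M) (n : ℕ) : PD n M :=
  ((proj_iff_PD M).1 h).mono (Nat.zero_le _)

theorem PD.of_subsingleton {M : ModuleCat.{u} A} (h : Subsingleton M) (n : ℕ) : PD n M := by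
  have : HasProjectiveDimensionLT M 0 :=
    (ModuleCat.isZero_of_subsingleton M).hasProjectiveDimensionLT_zero
  exact hasProjectiveDimensionLT_of_ge M 0 (n+1) (by omega)

/-- kernel of the canonical free cover -/
noncomputable def Om (M : ModuleCat.{u} A) : ModuleCat.{u} A :=
  ModuleCat.of A (LinearMap.ker (Finsupp.linearCombination A (id : M → M)))

noncomputable def Fr (M : ModuleCat.{u} A) : ModuleCat.{u} A := ModuleCat.of A (M →₀ A)

theorem SES_of_surj {P N : Type u} [AddCommGroup P] [Module A P] [AddCommGroup N] [Module A N]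
    (p : P →ₗ[A] N) (hp : Function.Surjective p) :
    SES (ModuleCat.of A (LinearMap.ker p)) (ModuleCat.of A P) (ModuleCat.of A N) :=
  ⟨(LinearMap.ker p).subtype, p, Subtype.val_injective, hp, LinearMap.exact_subtype_ker_map p⟩

theorem lc_surj (M : Type u) [AddCommGroup M] [Module A M] :
    Function.Surjective (Finsupp.linearCombination A (id : M → M)) :=
  Finsupp.linearCombination_id_surjective A M

theorem Om_SES (M : ModuleCat.{u} A) : SES (Om M) (Fr M) M := SES_of_surj _ (lc_surj M)

instance Fr_proj (M : ModuleCat.{u} A) : Module.Projective A (Fr M) :=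
  inferInstanceAs (Module.Projective A (M →₀ A))

theorem PD_Om {M : ModuleCat.{u} A} {n : ℕ} : PD (n+1) M ↔ PD n (Om M) :=
  ⟨fun h => (Om_SES M).PD₁ (PD.of_proj (Fr_proj M) _) h,
   fun h => (Om_SES M).PD₃ (PD.of_proj (Fr_proj M) _) h⟩

theorem ProjDimLE_iff {n : ℕ} : ∀ {M : ModuleCat.{u} A}, ProjDimLE A n M ↔ PD n M := by
  induction n with
  | zero => intro M; exact proj_iff_PD M
  | succ n ih =>
    intro M
    constructor
    · rintro ⟨K, P, i, p, hP, hi, hp, he, hK⟩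
      exact SES.PD₃ (M := K) (P := P) ⟨i.hom, p.hom, hi, hp, he⟩ (PD.of_proj hP _) (ih.1 hK)
    · intro h
      obtain ⟨i, p, hi, hp, he⟩ := Om_SES M
      exact ⟨Om M, Fr M, ModuleCat.ofHom i, ModuleCat.ofHom p, Fr_proj M, hi, hp, he,
        ih.2 (PD_Om.1 h)⟩

theorem FPD_to_C3 (h : FPDFinite A) : C3 A := by
  obtain ⟨s, hs⟩ := h
  intro z hz hS k
  have h1 : ∀ k, PD k (z k) := by
    intro k
    induction k with
    | zero => exact PD.of_subsingleton hz 0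
    | succ k ih =>
      obtain ⟨P, hP, hS⟩ := hS k
      exact hS.PD₃ (PD.of_proj hP _) ih
  have h2 : ∀ k, PD s (z k) := fun k => ProjDimLE_iff.1 (hs _ ⟨k, ProjDimLE_iff.2 (h1 k)⟩)
  have h3 : ∀ j, ∀ k, j ≤ s → PD (s - j) (z k) := by
    intro j
    induction j with
    | zero => intro k _; exact h2 k
    | succ j ih =>
      intro k hj
      obtain ⟨P, hP, hS⟩ := hS k
      refine hS.PD₁ (PD.of_proj hP _) ?_
      have := ih (k+1) (by omega)
      rwa [show s - j = s - (j+1) + 1 by omega] at this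
  have := h3 s k le_rfl
  rw [Nat.sub_self] at this
  exact (proj_iff_PD _).2 this

theorem exactAt_iff (X : Cplx A) (n : ℤ) : X.ExactAt n ↔
    ∀ x : X.X n, X.d n (n+1) x = 0 → ∃ y : X.X (n-1), X.d (n-1) n y = x := by
  rw [HomologicalComplex.exactAt_iff' X (n-1) n (n+1) (by simp) (by simp),
    ShortComplex.moduleCat_exact_iff]
  rfl

/-- splice of a ℤ-chain of short exact sequences -/
theorem splice (z P : ℤ → ModuleCat.{u} A) (i : ∀ k, z k →ₗ[A] P k) (p : ∀ k, P k →ₗ[A] z (k+1))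
    (hi : ∀ k, Function.Injective (i k)) (hp : ∀ k, Function.Surjective (p k))
    (he : ∀ k, Function.Exact (i k) (p k)) :
    ∃ X : Cplx A, (∀ k, X.X k = P k) ∧ IsAcyclicComplex A X ∧
      ∃ (I : ∀ k, z k →ₗ[A] X.X k) (J : ∀ k, X.X k →ₗ[A] z (k+1)),
      (∀ k, Function.Injective (I k)) ∧ (∀ k, Function.Surjective (J k)) ∧
      (∀ k, Function.Exact (I k) (J k)) ∧ ∀ k x, X.d k (k+1) x = I (k+1) (J k x) := by
  let X : Cplx A := CochainComplex.of P (fun k => ModuleCat.ofHom (p k) ≫ ModuleCat.ofHom (i (k+1)))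
    (by intro k; ext x; simp [(he (k+1)).apply_apply_eq_zero])
  have hd : ∀ k, X.d k (k+1) = ModuleCat.ofHom (p k) ≫ ModuleCat.ofHom (i (k+1)) :=
    fun k => CochainComplex.of_d P (fun k => ModuleCat.ofHom (p k) ≫ ModuleCat.ofHom (i (k+1))) k
  have key : ∀ k (x : X.X (k+1)), X.d (k+1) (k+1+1) x = 0 → ∃ y : X.X k, X.d k (k+1) y = x := by
    intro k x hx
    rw [hd] at hx
    have h1 : i (k+1+1) (p (k+1) x) = 0 := hx
    have h2 : p (k+1) x = 0 := hi _ (by rw [h1, map_zero])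
    obtain ⟨t, ht⟩ := (he (k+1) x).1 h2
    obtain ⟨y, rfl⟩ := hp k t
    refine ⟨y, ?_⟩
    rw [hd]; exact ht
  refine ⟨X, fun _ => rfl, ?_, i, p, hi, hp, he, ?_⟩
  · intro n
    rw [exactAt_iff]
    obtain ⟨k, rfl⟩ : ∃ k, n = k + 1 := ⟨n-1, by omega⟩
    have : k + 1 - 1 = k := by omega
    rw [this]
    exact key k
  · intro k x; rw [hd]; rfl

theorem c3_of_3 (h3 : ∀ X : Cplx A, BoundedBelow A X → IsAcyclicComplex A X →
          (∀ n : ℤ, Module.Projective A (X.X n)) → Contractible A X) : C3 A := by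
  intro z hz hS
  let Z : ℤ → ModuleCat.{u} A := fun k => if 0 ≤ k then z k.toNat else ModuleCat.of A PUnit
  have hZ : ∀ k : ℤ, ∃ P : ModuleCat.{u} A, Module.Projective A P ∧ SES (Z k) P (Z (k+1)) ∧
      (k < 0 → Subsingleton P) := by
    intro k
    by_cases hk : 0 ≤ k
    · have h1 : Z k = z k.toNat := if_pos hk
      have h2 : Z (k+1) = z (k.toNat+1) := by
        have : (k+1).toNat = k.toNat + 1 := by omega
        rw [← this]; exact if_pos (by omega)
      rw [h1, h2]
      obtain ⟨P, a, b⟩ := hS k.toNat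
      exact ⟨P, a, b, fun h => by omega⟩
    · have h1 : Z k = ModuleCat.of A PUnit := if_neg hk
      have h2 : Subsingleton (Z (k+1)) := by
        by_cases h : k + 1 = 0
        · rw [h]; exact hz
        · have : Z (k+1) = ModuleCat.of A PUnit := if_neg (by omega)
          rw [this]; exact inferInstanceAs (Subsingleton PUnit.{u+1})
      rw [h1]
      refine ⟨ModuleCat.of A PUnit, inferInstanceAs (Module.Projective A PUnit.{u+1}),
        ⟨LinearMap.id, 0, Function.injective_id, fun x => ⟨0, Subsingleton.elim _ _⟩, fun x => ?_⟩,
          fun _ => inferInstanceAs (Subsingleton PUnit.{u+1})⟩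
      simp
  choose P hP hs hneg using hZ
  choose i p hi hp he using hs
  obtain ⟨X, e, hX, I, J, hI, hJ, hIJ, hd⟩ := splice Z P i p hi hp he
  have hb : BoundedBelow A X := ⟨0, fun n hn => by
    rw [e n]; have := hneg n hn; exact ModuleCat.isZero_of_subsingleton _⟩
  obtain ⟨H⟩ := h3 X hb hX (fun n => by rw [e n]; exact hP n)
  have main : ∀ k : ℤ, Module.Projective A (Z (k+1)) := by
    intro k
    have hc := H.comm (k+1)
    rw [dNext_eq H.hom (show (ComplexShape.up ℤ).Rel (k+1) (k+1+1) by simp),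
      prevD_eq H.hom (show (ComplexShape.up ℤ).Rel k (k+1) by simp)] at hc
    have hs : J k ∘ₗ (H.hom (k+1) k).hom ∘ₗ I (k+1) = LinearMap.id := by
      ext x
      apply hI
      have h1 := LinearMap.congr_fun (congrArg ModuleCat.Hom.hom hc) (I (k+1) x)
      have h2 : X.d (k+1) (k+1+1) (I (k+1) x) = 0 := by
        rw [hd, (hIJ (k+1)).apply_apply_eq_zero, map_zero]
      have h3 : I (k+1) x = (H.hom (k+1+1) (k+1)) (X.d (k+1) (k+1+1) (I (k+1) x)) +
        X.d k (k+1) (H.hom (k+1) k (I (k+1) x)) + 0 := h1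
      rw [h2, map_zero, zero_add, add_zero, hd] at h3
      exact h3.symm
    have : Module.Projective A (X.X k) := by rw [e k]; exact hP k
    exact Module.Projective.of_split _ _ hs
  intro k
  have := main (k-1)
  have h1 : Z (k-1+1) = z k := by
    have : (k:ℤ)-1+1 = k := by omega
    rw [this]; exact if_pos (by omega)
  rwa [h1] at this

end P1
end FPDaux

namespace FPDaux
section P2
variable {A}
open CategoryTheory.Abelian

def EZ (n : ℕ) (M Q : ModuleCat.{u} A) : Prop := ∀ e : Ext.{u} M Q n, e = 0

theorem SES.short {M P N : ModuleCat.{u} A} {i : M →ₗ[A] P} {p : P →ₗ[A] N}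
    (hi : Function.Injective i) (hp : Function.Surjective p) (he : Function.Exact i p) :
    ∃ w : ModuleCat.ofHom i ≫ ModuleCat.ofHom p = 0,
      (ShortComplex.mk (ModuleCat.ofHom i) (ModuleCat.ofHom p) w).ShortExact := by
  have w : ModuleCat.ofHom i ≫ ModuleCat.ofHom p = 0 := by
    ext x; exact he.apply_apply_eq_zero x
  refine ⟨w, ?_⟩
  exact { exact := (ShortComplex.ShortExact.moduleCat_exact_iff_function_exact _).2 he
          mono_f := (ModuleCat.mono_iff_injective _).2 hi
          epi_g := (ModuleCat.epi_iff_surjective _).2 hp }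

theorem EZ_of_proj {M Q : ModuleCat.{u} A} (h : Module.Projective A M) (n : ℕ) : EZ (n+1) M Q := by
  have := (IsProjective.iff_projective (R := A) M).1 h
  intro e; exact Ext.eq_zero_of_projective e

theorem SES.E1 {M P N Q : ModuleCat.{u} A} (h : SES M P N) {n : ℕ} (h1 : EZ n M Q) (h3 : EZ n N Q) :
    EZ n P Q := by
  obtain ⟨f, g, w, hs⟩ := h.exists_short
  intro e
  obtain ⟨x, rfl⟩ := Ext.contravariant_sequence_exact₂ hs _ e (h1 _)
  rw [h3 x, Ext.comp_zero]

theorem SES.E2 {M P N Q : ModuleCat.{u} A} (h : SES M P N) {n : ℕ} (h2 : EZ n P Q)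
    (h3 : EZ (n+1) N Q) : EZ n M Q := by
  obtain ⟨f, g, w, hs⟩ := h.exists_short
  intro e
  obtain ⟨x, rfl⟩ := Ext.contravariant_sequence_exact₁ hs _ e (add_comm _ _) (h3 _)
  rw [h2 x, Ext.comp_zero]

theorem SES.E3 {M P N Q : ModuleCat.{u} A} (h : SES M P N) {n : ℕ} (h1 : EZ n M Q)
    (h2 : EZ (n+1) P Q) : EZ (n+1) N Q := by
  obtain ⟨f, g, w, hs⟩ := h.exists_short
  intro e
  obtain ⟨x, rfl⟩ := Ext.contravariant_sequence_exact₃ hs _ e (h2 _) (add_comm _ _)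
  rw [h1 x, Ext.comp_zero]

theorem ext_of_EZ {M P N Q : ModuleCat.{u} A} {i : M →ₗ[A] P} {p : P →ₗ[A] N}
    (hi : Function.Injective i) (hp : Function.Surjective p) (he : Function.Exact i p)
    (h : EZ 1 N Q) (f : M →ₗ[A] Q) : ∃ g : P →ₗ[A] Q, g ∘ₗ i = f := by
  obtain ⟨w, hs⟩ := SES.short hi hp he
  obtain ⟨x, hx⟩ := Ext.contravariant_sequence_exact₁ hs _ (Ext.mk₀ (ModuleCat.ofHom f))
    (add_comm _ _) (h _)
  obtain ⟨x, rfl⟩ := Ext.homEquiv₀.symm.surjective x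
  refine ⟨x.hom, ?_⟩
  have := Ext.homEquiv₀.symm.injective (a₁ := ModuleCat.ofHom i ≫ x) (a₂ := ModuleCat.ofHom f)
    (by simpa using hx)
  exact congrArg ModuleCat.Hom.hom this

theorem EZ_of_ext {M P N Q : ModuleCat.{u} A} {i : M →ₗ[A] P} {p : P →ₗ[A] N}
    (hi : Function.Injective i) (hp : Function.Surjective p) (he : Function.Exact i p)
    (h2 : EZ 1 P Q)
    (h : ∀ (f : M →ₗ[A] Q), ∃ g : P →ₗ[A] Q, g ∘ₗ i = f) : EZ 1 N Q := by
  obtain ⟨w, hs⟩ := SES.short hi hp he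
  intro e
  obtain ⟨x, rfl⟩ := Ext.contravariant_sequence_exact₃ hs _ e (h2 _) (add_comm _ _)
  obtain ⟨x, rfl⟩ := Ext.homEquiv₀.symm.surjective x
  obtain ⟨g, hg⟩ := h x.hom
  have : x = ModuleCat.ofHom i ≫ ModuleCat.ofHom g := by
    ext y; exact (LinearMap.congr_fun hg y).symm
  rw [this, Ext.homEquiv₀_symm_apply, ← Ext.mk₀_comp_mk₀]
  exact ShortComplex.ShortExact.extClass_comp_assoc hs _

theorem lift_of_EZ {M P N G : ModuleCat.{u} A} {i : M →ₗ[A] P} {p : P →ₗ[A] N}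
    (hi : Function.Injective i) (hp : Function.Surjective p) (he : Function.Exact i p)
    (h : EZ 1 G M) (f : G →ₗ[A] N) : ∃ g : G →ₗ[A] P, p ∘ₗ g = f := by
  obtain ⟨w, hs⟩ := SES.short hi hp he
  obtain ⟨x, hx⟩ := Ext.covariant_sequence_exact₃ _ hs (Ext.mk₀ (ModuleCat.ofHom f))
    (zero_add _) (h _)
  obtain ⟨x, rfl⟩ := Ext.homEquiv₀.symm.surjective x
  refine ⟨x.hom, ?_⟩
  have := Ext.homEquiv₀.symm.injective (a₁ := x ≫ ModuleCat.ofHom p) (a₂ := ModuleCat.ofHom f)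
    (by simpa using hx)
  exact congrArg ModuleCat.Hom.hom this

theorem SES.F3 {M P N G : ModuleCat.{u} A} (h : SES M P N) {n : ℕ} (h1 : EZ (n+1) G M)
    (h2 : EZ n G P) : EZ n G N := by
  obtain ⟨f, g, w, hs⟩ := h.exists_short
  intro e
  obtain ⟨x, rfl⟩ := Ext.covariant_sequence_exact₃ _ hs e rfl (h1 _)
  rw [h2 x, Ext.zero_comp]

theorem factor {P N Q : Type u} [AddCommGroup P] [Module A P] [AddCommGroup N] [Module A N]
    [AddCommGroup Q] [Module A Q] (p : P →ₗ[A] N) (hp : Function.Surjective p) (f : P →ₗ[A] Q)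
    (h : ∀ x, p x = 0 → f x = 0) : ∃ g : N →ₗ[A] Q, ∀ x, g (p x) = f x := by
  refine ⟨(LinearMap.ker p).liftQ f (fun x hx => h x hx) ∘ₗ
    (p.quotKerEquivOfSurjective hp).symm.toLinearMap, fun x => ?_⟩
  have : (p.quotKerEquivOfSurjective hp).symm (p x) = Submodule.Quotient.mk x := by
    rw [LinearEquiv.symm_apply_eq]; rfl
  rw [LinearMap.comp_apply, LinearEquiv.coe_coe, this]
  exact Submodule.liftQ_apply _ _ _

theorem factor_inj {P N Q : Type u} [AddCommGroup P] [Module A P] [AddCommGroup N] [Module A N]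
    [AddCommGroup Q] [Module A Q] (i : N →ₗ[A] P) (hi : Function.Injective i) (f : Q →ₗ[A] P)
    (h : ∀ x, ∃ y, i y = f x) : ∃ g : Q →ₗ[A] N, ∀ x, i (g x) = f x := by
  choose g hg using h
  refine ⟨⟨⟨g, fun x y => hi ?_⟩, fun r x => hi ?_⟩, hg⟩ <;> simp [hg]

/-- pushout -/
theorem pushout_SES {Z X Z' N G : ModuleCat.{u} A} (h1 : SES Z X Z') (h2 : SES Z N G) :
    ∃ Y, SES X Y G ∧ SES N Y Z' := by
  obtain ⟨i, p, hi, hp, he⟩ := h1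
  obtain ⟨j, q, hj, hq, he'⟩ := h2
  let r : Z →ₗ[A] X × N := i.prod (-j)
  let Y := (X × N) ⧸ LinearMap.range r
  have hr : ∀ x n, (Submodule.Quotient.mk (x, n) : Y) = 0 ↔ ∃ z, i z = x ∧ - j z = n := by
    intro x n
    rw [Submodule.Quotient.mk_eq_zero]
    simp [r]
  obtain ⟨a, ha⟩ := factor (LinearMap.range r).mkQ (Submodule.mkQ_surjective _)
    (q ∘ₗ LinearMap.snd A X N) (by
      rintro ⟨x, n⟩ h
      obtain ⟨z, rfl, rfl⟩ := (hr x n).1 h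
      simp [he'.apply_apply_eq_zero])
  obtain ⟨b, hb⟩ := factor (LinearMap.range r).mkQ (Submodule.mkQ_surjective _)
    (p ∘ₗ LinearMap.fst A X N) (by
      rintro ⟨x, n⟩ h
      obtain ⟨z, rfl, rfl⟩ := (hr x n).1 h
      simp [he.apply_apply_eq_zero])
  refine ⟨ModuleCat.of A Y, ⟨(LinearMap.range r).mkQ ∘ₗ LinearMap.inl A X N, a, ?_, ?_, ?_⟩,
    ⟨(LinearMap.range r).mkQ ∘ₗ LinearMap.inr A X N, b, ?_, ?_, ?_⟩⟩
  · rw [injective_iff_map_eq_zero]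
    intro x hx
    obtain ⟨z, rfl, h⟩ := (hr x 0).1 hx
    have : z = 0 := hj (by simpa using h)
    simp [this]
  · intro g
    obtain ⟨n, rfl⟩ := hq g
    exact ⟨_, ha (0, n)⟩
  · intro y
    obtain ⟨⟨x, n⟩, rfl⟩ := Submodule.mkQ_surjective _ y
    rw [ha]
    constructor
    · intro h
      obtain ⟨z, hz⟩ := (he' n).1 h
      refine ⟨x + i z, ?_⟩
      rw [← sub_eq_zero]
      refine (hr _ _).2 ⟨z, ?_, ?_⟩ <;> simp [hz]
    · rintro ⟨x', h⟩
      rw [← sub_eq_zero] at h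
      obtain ⟨z, h1, h2⟩ := (hr _ _).1 h
      simp at h2
      simp [← h2, he'.apply_apply_eq_zero]
  · rw [injective_iff_map_eq_zero]
    intro x hx
    obtain ⟨z, h, rfl⟩ := (hr 0 x).1 hx
    have : z = 0 := hi (by simpa using h)
    simp [this]
  · intro g
    obtain ⟨n, rfl⟩ := hp g
    exact ⟨_, hb (n, 0)⟩
  · intro y
    obtain ⟨⟨x, n⟩, rfl⟩ := Submodule.mkQ_surjective _ y
    rw [hb]
    constructor
    · intro h
      obtain ⟨z, hz⟩ := (he x).1 h
      refine ⟨n + j z, ?_⟩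
      rw [← sub_eq_zero]
      refine (hr _ _).2 ⟨-z, ?_, ?_⟩ <;> simp [hz]
    · rintro ⟨x', h⟩
      rw [← sub_eq_zero] at h
      obtain ⟨z, h1, h2⟩ := (hr _ _).1 h
      have h1 : i z = - x := by simpa using h1
      have : x = i (-z) := by simp [h1]
      simp [this, he.apply_apply_eq_zero]

theorem quot_SES {N Y Z P G : ModuleCat.{u} A} (h1 : SES N Y Z) (h2 : SES Y P G) :
    ∃ N', SES N P N' ∧ SES Z N' G := by
  obtain ⟨i, p, hi, hp, he⟩ := h1
  obtain ⟨j, q, hj, hq, he'⟩ := h2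
  let r : N →ₗ[A] P := j ∘ₗ i
  obtain ⟨a, ha⟩ := factor (LinearMap.range r).mkQ (Submodule.mkQ_surjective _) q (by
      intro x h
      rw [Submodule.mkQ_apply, Submodule.Quotient.mk_eq_zero] at h
      obtain ⟨n, rfl⟩ := h
      simp [r, he'.apply_apply_eq_zero])
  obtain ⟨b, hb⟩ := factor p hp ((LinearMap.range r).mkQ ∘ₗ j) (by
      intro x h
      obtain ⟨n, rfl⟩ := (he x).1 h
      simp [r])
  refine ⟨ModuleCat.of A (P ⧸ LinearMap.range r), ⟨r, (LinearMap.range r).mkQ, hj.comp hi,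
    Submodule.mkQ_surjective _, ?_⟩, ⟨b, a, ?_, ?_, ?_⟩⟩
  · intro x; simp
  · rw [injective_iff_map_eq_zero]
    intro z hz
    obtain ⟨y, rfl⟩ := hp z
    rw [hb] at hz
    obtain ⟨n, hn⟩ := (Submodule.Quotient.mk_eq_zero _).1 hz
    rw [← hj hn, he.apply_apply_eq_zero]
  · intro g
    obtain ⟨x, rfl⟩ := hq g
    exact ⟨_, ha x⟩
  · intro y
    obtain ⟨x, rfl⟩ := Submodule.mkQ_surjective _ y
    rw [ha]
    constructor
    · intro h
      obtain ⟨t, rfl⟩ := (he' x).1 h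
      exact ⟨p t, hb t⟩
    · rintro ⟨z, h⟩
      obtain ⟨y, rfl⟩ := hp z
      rw [hb] at h
      have h' := congrArg a h
      rw [ha] at h'
      have h2 : a ((LinearMap.range r).mkQ (j y)) = q (j y) := ha _
      rw [← h']
      exact h2.trans (he'.apply_apply_eq_zero y)

def ExtAll (M : ModuleCat.{u} A) : Prop :=
  ∀ Q : ModuleCat.{u} A, Module.Projective A Q → ∀ n, EZ (n+1) M Q

def GPc (M : ModuleCat.{u} A) : Prop :=
  ∃ z : ℕ → ModuleCat.{u} A, z 0 = M ∧ ∀ k, ExtAll (z k) ∧ SESproj (z k) (z (k+1))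

theorem GPc.unfold {M : ModuleCat.{u} A} (h : GPc M) : ExtAll M ∧ ∃ N, GPc N ∧ SESproj M N := by
  obtain ⟨z, rfl, h⟩ := h
  exact ⟨(h 0).1, z 1, ⟨fun k => z (k+1), rfl, fun k => h (k+1)⟩, (h 0).2⟩

theorem depChoice {St : ℕ → Type*} (s0 : St 0) (R : ∀ k, St k → St (k+1) → Prop)
    (h : ∀ k s, ∃ t, R k s t) : ∃ s : ∀ k, St k, s 0 = s0 ∧ ∀ k, R k (s k) (s (k+1)) := by
  choose f hf using h
  exact ⟨fun k => Nat.rec s0 f k, rfl, fun k => hf _ _⟩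

theorem GPc.coind (S : ModuleCat.{u} A → Prop)
    (hS : ∀ M, S M → ExtAll M ∧ ∃ N, S N ∧ SESproj M N) {M : ModuleCat.{u} A} (h : S M) : GPc M := by
  obtain ⟨z, h0, hz⟩ := depChoice (St := fun _ => {M : ModuleCat.{u} A // S M}) ⟨M, h⟩
    (fun k s t => SESproj s.1 t.1) (fun k s => by
      obtain ⟨N, hN, h⟩ := (hS s.1 s.2).2
      exact ⟨⟨N, hN⟩, h⟩)
  exact ⟨fun k => (z k).1, by simp [h0], fun k => ⟨(hS _ (z k).2).1, hz k⟩⟩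

theorem GPc_of_proj {M : ModuleCat.{u} A} (h : Module.Projective A M) : GPc M := by
  refine GPc.coind (fun M => Module.Projective A M) (fun M h => ⟨fun Q _ n => EZ_of_proj h n,
    ModuleCat.of A PUnit.{u+1}, inferInstanceAs (Module.Projective A PUnit.{u+1}), M, h,
    LinearMap.id, 0, Function.injective_id, fun x => ⟨0, Subsingleton.elim (α := PUnit) _ _⟩,
    fun x => ?_⟩) h
  simp

theorem GPc.ker {K N G : ModuleCat.{u} A} (h : SES K N G) (hN : Module.Projective A N)
    (hG : GPc G) : GPc K := by
  refine GPc.coind (fun M => GPc M ∨ (ExtAll M ∧ ∃ G, GPc G ∧ SESproj M G)) ?_ 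
    (Or.inr ⟨fun Q hQ n => h.E2 (EZ_of_proj hN n) (hG.unfold.1 Q hQ _), G, hG, N, hN, h⟩)
  rintro M (h | ⟨h, G, hG, hM⟩)
  · obtain ⟨h, N, hN, hM⟩ := h.unfold
    exact ⟨h, N, Or.inl hN, hM⟩
  · exact ⟨h, G, Or.inl hG, hM⟩

theorem GPc.extn {X Y G : ModuleCat.{u} A} (h : SES X Y G) (hX : GPc X) (hG : GPc G) : GPc Y := by
  refine GPc.coind (fun Y => ∃ X G, GPc X ∧ GPc G ∧ SES X Y G) ?_ ⟨X, G, hX, hG, h⟩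
  clear h hX hG X Y G
  rintro Y ⟨X, G, hX, hG, h⟩
  refine ⟨fun Q hQ n => h.E1 (hX.unfold.1 Q hQ n) (hG.unfold.1 Q hQ n), ?_⟩
  obtain ⟨hXe, X', hX', P1, hP1, hs1⟩ := hX.unfold
  obtain ⟨hGe, G', hG', P2, hP2, i2, p2, hi2, hp2, he2⟩ := hG.unfold
  obtain ⟨α, p1, hi1, hp1, he1⟩ := hs1
  obtain ⟨f, g, hf, hg, hfg⟩ := h
  obtain ⟨β, hβ⟩ := ext_of_EZ hf hg hfg (hGe P1 hP1 0) α
  have hβ' : ∀ x, β (f x) = α x := fun x => LinearMap.congr_fun hβ x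
  let r : Y →ₗ[A] P1 × P2 := β.prod (i2 ∘ₗ g)
  let C := (P1 × P2) ⧸ LinearMap.range r
  obtain ⟨a, ha⟩ := factor (LinearMap.range r).mkQ (Submodule.mkQ_surjective _)
    (p2 ∘ₗ LinearMap.snd A P1 P2) (by
      rintro ⟨x, n⟩ h
      rw [Submodule.mkQ_apply, Submodule.Quotient.mk_eq_zero] at h
      obtain ⟨y, hy⟩ := h
      have : i2 (g y) = n := congrArg Prod.snd hy
      simp [← this, he2.apply_apply_eq_zero])
  obtain ⟨b, hb⟩ := factor p1 hp1 ((LinearMap.range r).mkQ ∘ₗ LinearMap.inl A P1 P2) (by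
      intro x h
      obtain ⟨n, rfl⟩ := (he1 x).1 h
      refine (Submodule.Quotient.mk_eq_zero _).2 ⟨f n, ?_⟩
      simp [r, hβ', hfg.apply_apply_eq_zero])
  refine ⟨ModuleCat.of A C, ⟨X', G', hX', hG', b, a, ?_, ?_, ?_⟩, 
    ModuleCat.of A (P1 × P2), inferInstanceAs (Module.Projective A (P1 × P2)),
    r, (LinearMap.range r).mkQ, ?_, Submodule.mkQ_surjective _, ?_⟩
  · rw [injective_iff_map_eq_zero]
    intro z hz
    obtain ⟨y, rfl⟩ := hp1 z
    rw [hb] at hz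
    obtain ⟨n, hn⟩ := (Submodule.Quotient.mk_eq_zero _).1 hz
    have h1 : β n = y := congrArg Prod.fst hn
    have h2 : i2 (g n) = 0 := congrArg Prod.snd hn
    have h3 : g n = 0 := hi2 (by simpa using h2)
    obtain ⟨x, rfl⟩ := (hfg n).1 h3
    rw [← h1, hβ', he1.apply_apply_eq_zero]
  · intro g
    obtain ⟨x, rfl⟩ := hp2 g
    exact ⟨_, ha (0, x)⟩
  · intro y
    obtain ⟨⟨x, n⟩, rfl⟩ := Submodule.mkQ_surjective _ y
    rw [ha]
    constructor
    · intro h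
      obtain ⟨t, ht⟩ := (he2 n).1 h
      obtain ⟨y, rfl⟩ := hg t
      refine ⟨p1 (x - β y), ?_⟩
      rw [hb]
      refine ((Submodule.Quotient.eq _).2 ⟨-y, ?_⟩)
      simp [r, ht]
    · rintro ⟨z, h⟩
      obtain ⟨y, rfl⟩ := hp1 z
      rw [hb] at h
      have h' := congrArg a h
      rw [ha] at h'
      have h2 : a ((LinearMap.range r).mkQ (LinearMap.inl A P1 P2 y)) = _ := ha _
      rw [← h']
      exact h2.trans (by simp)
  · rw [injective_iff_map_eq_zero]
    intro y hy
    have h1 : β y = 0 := congrArg Prod.fst hy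
    have h2 : i2 (g y) = 0 := congrArg Prod.snd hy
    have h3 : g y = 0 := hi2 (by simpa using h2)
    obtain ⟨x, rfl⟩ := (hfg y).1 h3
    rw [hβ'] at h1
    rw [hi1 (h1.trans (map_zero α).symm), map_zero]
  · intro x; exact Submodule.Quotient.mk_eq_zero _

end P2
end FPDaux

namespace FPDaux
section P3
variable {A}
open CategoryTheory.Abelian

/-- cycles -/
noncomputable def Zc (X : Cplx A) (n : ℤ) : ModuleCat.{u} A :=
  ModuleCat.of A (LinearMap.ker (X.d n (n+1)).hom)

theorem Zc_SES' (X : Cplx A) (hX : IsAcyclicComplex A X) (m n : ℤ) (h : m + 1 = n) :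
    ∃ p : X.X m →ₗ[A] Zc X n, Function.Surjective p ∧ (∀ x, (p x).1 = X.d m n x) ∧
      Function.Exact (LinearMap.ker (X.d m (m+1)).hom).subtype p := by
  subst h
  have h0 : ∀ x : X.X m, X.d (m+1) (m+1+1) (X.d m (m+1) x) = 0 := by
    intro x
    exact LinearMap.congr_fun (congrArg ModuleCat.Hom.hom (X.d_comp_d m (m+1) (m+1+1))) x
  refine ⟨(X.d m (m+1)).hom.codRestrict _ h0, ?_, fun x => rfl, ?_⟩
  · rintro ⟨x, hx⟩
    have := (exactAt_iff X (m+1)).1 (hX (m+1)) x hx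
    have e : m + 1 - 1 = m := by omega
    rw [e] at this
    obtain ⟨y, hy⟩ := this
    exact ⟨y, Subtype.ext hy⟩
  · intro x
    constructor
    · intro hx
      exact ⟨⟨x, congrArg Subtype.val hx⟩, rfl⟩
    · rintro ⟨y, rfl⟩
      exact Subtype.ext y.2

theorem Zc_SES (X : Cplx A) (hX : IsAcyclicComplex A X) (m n : ℤ) (h : m + 1 = n) :
    SES (Zc X m) (X.X m) (Zc X n) := by
  obtain ⟨p, h1, -, h3⟩ := Zc_SES' X hX m n h
  exact ⟨(LinearMap.ker (X.d m (m+1)).hom).subtype, p, Subtype.val_injective, h1, h3⟩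

theorem HomTo_iff {X : Cplx A} {J : ModuleCat.{u} A} : HomToAcyclic A X J ↔
    ∀ (m n k : ℤ), m + 1 = n → n + 1 = k → ∀ f : X.X n →ₗ[A] J, (∀ x, f (X.d m n x) = 0) →
      ∃ g : X.X k →ₗ[A] J, ∀ x, g (X.d n k x) = f x := by
  constructor
  · rintro h m n k h1 rfl f hf
    obtain rfl : m = n - 1 := by omega
    obtain ⟨g, hg⟩ := h n (ModuleCat.ofHom f) (by ext x; exact hf x)
    exact ⟨g.hom, fun x => LinearMap.congr_fun (congrArg ModuleCat.Hom.hom hg) x⟩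
  · intro h n f hf
    obtain ⟨g, hg⟩ := h (n-1) n (n+1) (by omega) rfl f.hom
      (fun x => LinearMap.congr_fun (congrArg ModuleCat.Hom.hom hf) x)
    exact ⟨ModuleCat.ofHom g, by ext x; exact hg x⟩

theorem HomFrom_iff {X : Cplx A} {G : ModuleCat.{u} A} : HomFromAcyclic A G X ↔
    ∀ (m n k : ℤ), m + 1 = n → n + 1 = k → ∀ f : G →ₗ[A] X.X n, (∀ x, X.d n k (f x) = 0) →
      ∃ g : G →ₗ[A] X.X m, ∀ x, X.d m n (g x) = f x := by
  constructor
  · rintro h m n k h1 rfl f hf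
    obtain rfl : m = n - 1 := by omega
    obtain ⟨g, hg⟩ := h n (ModuleCat.ofHom f) (by ext x; exact hf x)
    exact ⟨g.hom, fun x => LinearMap.congr_fun (congrArg ModuleCat.Hom.hom hg) x⟩
  · intro h n f hf
    obtain ⟨g, hg⟩ := h (n-1) n (n+1) (by omega) rfl f.hom
      (fun x => LinearMap.congr_fun (congrArg ModuleCat.Hom.hom hf) x)
    exact ⟨ModuleCat.ofHom g, by ext x; exact hg x⟩

theorem ExtAll_Zc (P : Cplx A) (hP : IsAcyclicComplex A P)
    (hp : ∀ n : ℤ, Module.Projective A (P.X n))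
    (hH : ∀ Q : ModuleCat.{u} A, Module.Projective A Q → HomToAcyclic A P Q) (k : ℤ) :
    ExtAll (Zc P k) := by
  intro Q hQ n
  induction n generalizing k with
  | zero =>
    obtain ⟨p, h1, h2, h3⟩ := Zc_SES' P hP (k-1) k (by omega)
    refine EZ_of_ext (M := Zc P (k-1)) (P := P.X (k-1))
      (i := (LinearMap.ker (P.d (k-1) (k-1+1)).hom).subtype) Subtype.val_injective h1 h3
      (EZ_of_proj (hp _) _) ?_
    intro f
    obtain ⟨p', h1', h2', h3'⟩ := Zc_SES' P hP (k-1-1) (k-1) (by omega)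
    obtain ⟨g, hg⟩ := HomTo_iff.1 (hH Q hQ) (k-1-1-1) (k-1-1) (k-1) (by omega) (by omega) (f ∘ₗ p')
      (fun x => by
        have : p' (P.d (k-1-1-1) (k-1-1) x) = 0 := by
          apply Subtype.ext
          rw [h2']
          exact LinearMap.congr_fun (congrArg ModuleCat.Hom.hom (P.d_comp_d _ _ _)) x
        rw [LinearMap.comp_apply, this, map_zero])
    refine ⟨g, ?_⟩
    ext y
    obtain ⟨x, rfl⟩ := h1' y
    refine Eq.trans ?_ (hg x)
    exact congrArg g (h2' x)
  | succ n ih =>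
    exact (Zc_SES P hP (k-1) k (by omega)).E3 (ih _) (EZ_of_proj (hp _) _)

theorem ExtAll.iso {M N : ModuleCat.{u} A} (e : M ≅ N) (h : ExtAll M) : ExtAll N := by
  intro Q hQ n x
  have h2 := h Q hQ n ((Ext.mk₀ e.hom).comp x (zero_add _))
  have : x = (Ext.mk₀ e.inv).comp ((Ext.mk₀ e.hom).comp x (zero_add _)) (zero_add _) := by
    simp
  rw [this, h2, Ext.comp_zero]

theorem GPc.iso {M N : ModuleCat.{u} A} (e : M ≅ N) (h : GPc M) : GPc N := by
  refine GPc.coind (fun M => GPc M ∨ (ExtAll M ∧ ∃ G, GPc G ∧ SESproj M G)) ?_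
    (Or.inr ⟨h.unfold.1.iso e, ?_⟩)
  · rintro M (h | ⟨h, G, hG, hM⟩)
    · obtain ⟨h, N, hN, hM⟩ := h.unfold
      exact ⟨h, N, Or.inl hN, hM⟩
    · exact ⟨h, G, Or.inl hG, hM⟩
  · obtain ⟨G, hG, P, hP, i, p, hi, hp, he⟩ := h.unfold.2
    refine ⟨G, hG, P, hP, i ∘ₗ e.inv.hom, p, hi.comp (ModuleCat.mono_iff_injective e.inv |>.1 inferInstance), hp, fun x => ?_⟩
    rw [he x]
    constructor
    · rintro ⟨y, rfl⟩
      exact ⟨e.hom y, by simp⟩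
    · rintro ⟨y, rfl⟩
      exact ⟨_, rfl⟩

theorem GPc_of_IsGP {G : ModuleCat.{u} A} (h : IsGorensteinProjective A G) : GPc G := by
  obtain ⟨P, hP, hp, hH, ⟨e⟩⟩ := h
  refine GPc.iso (M := Zc P 0) ((ModuleCat.kernelIsoKer (P.d 0 1)).symm ≪≫ e.symm) ?_
  refine ⟨fun k => Zc P k, rfl, fun k => ⟨ExtAll_Zc P hP hp hH _, P.X k, hp _, ?_⟩⟩
  exact Zc_SES P hP _ _ (by simp)

theorem GP_chain {M : ModuleCat.{u} A} (h : GPc M) : ∃ z : ℤ → ModuleCat.{u} A, z 0 = M ∧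
    (∀ k, ExtAll (z k)) ∧ ∀ k, SESproj (z k) (z (k+1)) := by
  obtain ⟨w, h0, hw⟩ := h
  have hOm : ∀ j : ℕ, ExtAll (Om^[j] M) := by
    intro j
    induction j with
    | zero => rw [← h0]; exact (hw 0).1
    | succ j ih =>
      rw [Function.iterate_succ_apply']
      exact fun Q hQ n => (Om_SES _).E2 (EZ_of_proj (Fr_proj _) _) (ih Q hQ _)
  refine ⟨fun k => if 0 ≤ k then w k.toNat else Om^[(-k).toNat] M, by simpa using h0, ?_, ?_⟩
  · intro k
    dsimp only
    split_ifs with h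
    · exact (hw _).1
    · exact hOm _
  · intro k
    dsimp only
    by_cases hk : 0 ≤ k
    · rw [if_pos hk, if_pos (by omega), show (k+1).toNat = k.toNat + 1 by omega]
      exact (hw _).2
    · rw [if_neg hk]
      have : (if 0 ≤ k + 1 then w (k+1).toNat else Om^[(-(k+1)).toNat] M)
          = Om^[(-(k+1)).toNat] M := by
        split_ifs with h
        · have : k = -1 := by omega
          subst this
          exact h0
        · rfl
      rw [this, show (-k).toNat = (-(k+1)).toNat + 1 by omega, Function.iterate_succ_apply']
      exact ⟨Fr _, Fr_proj _, Om_SES _⟩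

theorem IsGP_of_GPc {M : ModuleCat.{u} A} (h : GPc M) : IsGorensteinProjective A M := by
  obtain ⟨z, h0, hE, hz⟩ := GP_chain h
  choose P hP hs using hz
  choose i p hi hp he using hs
  obtain ⟨X, e, hX, I, J, hI, hJ, hIJ, hd⟩ := splice z P i p hi hp he
  refine ⟨X, hX, fun n => by rw [e n]; exact hP n, ?_, ?_⟩
  · intro Q hQ
    rw [HomTo_iff]
    rintro m n k rfl rfl f hf
    obtain ⟨f', hf'⟩ := factor (J (m+1)) (hJ _) f (by
      intro x hx
      obtain ⟨y, rfl⟩ := (hIJ _ x).1 hx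
      obtain ⟨t, rfl⟩ := hJ _ y
      rw [← hd]; exact hf t)
    obtain ⟨g, hg⟩ := ext_of_EZ (hI (m+1+1)) (hJ _) (hIJ _) (hE _ Q hQ 0) f'
    refine ⟨g, fun x => ?_⟩
    rw [hd, ← hf']
    exact LinearMap.congr_fun hg _
  · subst h0
    have h0 : ∀ x, X.d 0 1 (I 0 x) = 0 := by
      intro x
      have := hd 0 (I 0 x)
      rw [(hIJ 0).apply_apply_eq_zero, map_zero] at this
      exact this
    refine ⟨LinearEquiv.toModuleIso (X₁ := z 0) (LinearEquiv.ofBijective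
      ((I 0).codRestrict (LinearMap.ker (X.d 0 1).hom) h0) ⟨?_, ?_⟩) ≪≫
      (ModuleCat.kernelIsoKer (X.d 0 1)).symm⟩
    · intro x y hxy
      exact hI 0 (congrArg Subtype.val hxy)
    · rintro ⟨x, hx⟩
      have h2 : J 0 x = 0 := by
        apply hI
        have := hd 0 x
        rw [map_zero, ← this]; exact hx
      obtain ⟨y, rfl⟩ := (hIJ 0 x).1 h2
      exact ⟨y, rfl⟩

theorem three_of_two (h2 : ∀ X : Cplx A, BoundedBelow A X → GPAcyclic A X →
          (∀ n : ℤ, IsGorensteinProjective A (X.X n)) → Contractible A X) :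
    ∀ X : Cplx A, BoundedBelow A X → IsAcyclicComplex A X →
          (∀ n : ℤ, Module.Projective A (X.X n)) → Contractible A X := by
  intro X hb hX hp
  refine h2 X hb ?_ (fun n => IsGP_of_GPc (GPc_of_proj (hp n)))
  intro G hG
  obtain ⟨a, ha⟩ := hb
  have hGE := (GPc_of_IsGP hG).unfold.1
  have key : ∀ k : ℕ, ∀ n, EZ (n+1) G (Zc X (a-1+k)) := by
    intro k
    induction k with
    | zero =>
      intro n
      have h0 : Subsingleton (X.X (a-1+(0:ℕ))) := 
        ModuleCat.subsingleton_of_isZero (ha _ (by simp))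
      have : Subsingleton (Zc X (a-1+(0:ℕ))) := by
        unfold Zc; exact inferInstanceAs (Subsingleton (LinearMap.ker _))
      exact hGE _ ((proj_iff_PD _).2 (PD.of_subsingleton this 0)) n
    | succ k ih =>
      intro n
      exact (Zc_SES X hX (a-1+k) _ (by push_cast; ring)).F3 (ih _) (hGE _ (hp _) n)
  have key2 : ∀ m, EZ 1 G (Zc X m) := by
    intro m
    by_cases hm : m < a
    · have h0 : Subsingleton (X.X m) := ModuleCat.subsingleton_of_isZero (ha _ hm)
      have : Subsingleton (Zc X m) := by
        unfold Zc; exact inferInstanceAs (Subsingleton (LinearMap.ker _))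
      exact hGE _ ((proj_iff_PD _).2 (PD.of_subsingleton this 0)) 0
    · have := key (m - (a-1)).toNat 0
      rwa [show a - 1 + ((m - (a-1)).toNat : ℤ) = m by omega] at this
  rw [HomFrom_iff]
  rintro m n k rfl rfl f hf
  obtain ⟨p, h1, h2, h3⟩ := Zc_SES' X hX m _ rfl
  obtain ⟨g, hg⟩ := lift_of_EZ (M := Zc X m) (i := (LinearMap.ker (X.d m (m+1)).hom).subtype)
    Subtype.val_injective h1 h3 (key2 m) (f.codRestrict _ hf)
  refine ⟨g, fun x => ?_⟩
  rw [← h2]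
  exact congrArg Subtype.val (LinearMap.congr_fun hg x)

theorem acyclic_of_GPAcyclic {X : Cplx A} (h : GPAcyclic A X) : IsAcyclicComplex A X := by
  intro n
  have := HomFrom_iff.1 (h (ModuleCat.of A A) (IsGP_of_GPc (GPc_of_proj
    (inferInstanceAs (Module.Projective A A))))) (n-1) n (n+1) (by omega) rfl
  rw [exactAt_iff]
  intro x hx
  obtain ⟨g, hg⟩ := this (LinearMap.toSpanSingleton A _ x) (fun a => by simp [hx])
  exact ⟨g (1 : A), by rw [hg]; simp⟩

theorem contractible_of_sections (X : Cplx A)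
    (h : ∀ m n, m + 1 = n → ∃ s : Zc X n →ₗ[A] X.X m, ∀ x, X.d m n (s x) = x.1) :
    Contractible A X := by
  choose s hs using h
  have hdd : ∀ n (x : X.X n), X.d (n+1) (n+1+1) (X.d n (n+1) x) = 0 := fun n x =>
    LinearMap.congr_fun (congrArg ModuleCat.Hom.hom (X.d_comp_d n (n+1) (n+1+1))) x
  let D : ∀ n, X.X n →ₗ[A] Zc X (n+1) := fun n => (X.d n (n+1)).hom.codRestrict _ (hdd n)
  have hr : ∀ n (x : X.X n), X.d n (n+1) (x - s n (n+1) rfl (D n x)) = 0 := by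
    intro n x
    rw [map_sub, hs]; exact sub_self _
  let r : ∀ n, X.X n →ₗ[A] Zc X n := fun n =>
    (LinearMap.id - s n (n+1) rfl ∘ₗ D n).codRestrict _ (hr n)
  refine ⟨{ hom := fun i j => if h : j + 1 = i then ModuleCat.ofHom (s j i h ∘ₗ r i) else 0
            zero := fun i j h => dif_neg h
            comm := ?_ }⟩
  intro i
  obtain ⟨k, rfl⟩ : ∃ k, i = k + 1 := ⟨i-1, by omega⟩
  rw [dNext_eq _ (show (ComplexShape.up ℤ).Rel (k+1) (k+1+1) by simp),
      prevD_eq _ (show (ComplexShape.up ℤ).Rel k (k+1) by simp), dif_pos rfl, dif_pos rfl]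
  ext x
  have h1 : r (k+1+1) (X.d (k+1) (k+1+1) x) = D (k+1) x := by
    apply Subtype.ext
    have h0 : D (k+1+1) (X.d (k+1) (k+1+1) x) = 0 := Subtype.ext (hdd _ x)
    change X.d (k+1) (k+1+1) x - s _ _ rfl (D (k+1+1) (X.d (k+1) (k+1+1) x)) = _
    rw [h0, map_zero, sub_zero]; rfl
  change x = s (k+1) (k+1+1) rfl (r (k+1+1) (X.d (k+1) (k+1+1) x)) +
    X.d k (k+1) (s k (k+1) rfl (r (k+1) x)) + 0
  rw [h1, hs]
  change x = _ + (x - s (k+1) (k+1+1) rfl (D (k+1) x)) + 0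
  abel

theorem two_of_C3 (h3 : C3 A) : ∀ X : Cplx A, BoundedBelow A X → GPAcyclic A X →
          (∀ n : ℤ, IsGorensteinProjective A (X.X n)) → Contractible A X := by
  intro X hb hX hG
  have hac := acyclic_of_GPAcyclic hX
  obtain ⟨a, ha⟩ := hb
  have hZ0 : ∀ n < a, Subsingleton (Zc X n) := by
    intro n hn
    have h0 : Subsingleton (X.X n) := ModuleCat.subsingleton_of_isZero (ha _ hn)
    unfold Zc; exact inferInstanceAs (Subsingleton (LinearMap.ker _))
  have hU : Subsingleton (ModuleCat.of A PUnit.{u+1}) := inferInstanceAs (Subsingleton PUnit.{u+1})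
  have hUp : Module.Projective A (ModuleCat.of A PUnit.{u+1}) :=
    inferInstanceAs (Module.Projective A PUnit.{u+1})
  have hGZ : ∀ k : ℕ, GPc (Zc X (a-1+k)) := by
    let St : ℕ → Type _ := fun k =>
      {p : ModuleCat.{u} A × ModuleCat.{u} A // SES (Zc X (a-1+k)) p.1 p.2 ∧ GPc p.2}
    let s0 : St 0 := ⟨(ModuleCat.of A PUnit.{u+1}, ModuleCat.of A PUnit.{u+1}), by
      have := hZ0 (a-1+(0:ℕ)) (by simp)
      refine ⟨⟨0, 0, fun x y _ => Subsingleton.elim _ _, fun x => ⟨0, Subsingleton.elim _ _⟩, 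
        fun x => ⟨fun _ => ⟨0, Subsingleton.elim _ _⟩, fun _ => Subsingleton.elim _ _⟩⟩,
        GPc_of_proj hUp⟩⟩
    obtain ⟨s, hs0, hs⟩ := depChoice (St := St) s0 (fun k s t => SESproj s.1.1 t.1.1) (by
      rintro k ⟨⟨N, G⟩, h1, h2⟩
      obtain ⟨Y, hY1, hY2⟩ := pushout_SES
        (Zc_SES X hac (a-1+k) (a-1+(k+1:ℕ)) (by push_cast; ring)) h1
      have hY := GPc.extn hY1 (GPc_of_IsGP (hG _)) h2
      obtain ⟨-, G', hG', P, hP, hS⟩ := hY.unfold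
      obtain ⟨N', h3, h4⟩ := quot_SES hY2 hS
      exact ⟨⟨(N', G'), h4, hG'⟩, P, hP, h3⟩)
    have := h3 (fun k => (s k).1.1) (by rw [hs0]; exact hU) hs
    intro k
    exact GPc.ker (s k).2.1 (this k) (s k).2.2
  have hGZ' : ∀ n, GPc (Zc X n) := by
    intro n
    by_cases hn : n < a
    · have := hZ0 n hn
      exact GPc_of_proj ((proj_iff_PD _).2 (PD.of_subsingleton this 0))
    · have := hGZ (n - (a-1)).toNat
      rwa [show a - 1 + ((n - (a-1)).toNat : ℤ) = n by omega] at this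
  apply contractible_of_sections
  intro m n hmn
  obtain ⟨g, hg⟩ := HomFrom_iff.1 (hX _ (IsGP_of_GPc (hGZ' n))) m n (n+1) hmn rfl
    (LinearMap.ker (X.d n (n+1)).hom).subtype (fun x => x.2)
  exact ⟨g, hg⟩

end P3
end FPDaux

namespace FPDaux
section P4
variable {A}

section act
variable {M N : Type*} [AddCommGroup M] [Module A M] [AddCommGroup N] [Module A N]

def act {l m : ℕ} (B : Matrix (Fin l) (Fin m) A) : (Fin m → M) →+ (Fin l → M) where
  toFun x i := ∑ j, B i j • x j
  map_zero' := by ext; simp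
  map_add' x y := by ext; simp [Finset.sum_add_distrib]

theorem act_apply {l m : ℕ} (B : Matrix (Fin l) (Fin m) A) (x : Fin m → M) (i : Fin l) :
    act B x i = ∑ j, B i j • x j := rfl

theorem act_mul {l m k : ℕ} (B : Matrix (Fin l) (Fin m) A) (C : Matrix (Fin m) (Fin k) A)
    (x : Fin k → M) : act (B * C) x = act B (act C x) := by
  ext i
  simp only [act_apply, Matrix.mul_apply, Finset.sum_smul, Finset.smul_sum, smul_smul]
  exact Finset.sum_comm

theorem act_map {l m : ℕ} (B : Matrix (Fin l) (Fin m) A) (x : Fin m → M) (f : M →ₗ[A] N) :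
    act B (fun j => f (x j)) = fun i => f (act B x i) := by
  ext i
  simp [act_apply]

theorem act_zero_mat {l m : ℕ} (x : Fin m → M) : act (0 : Matrix (Fin l) (Fin m) A) x = 0 := by
  ext; simp [act_apply]

theorem mul_zero_act {l m k : ℕ} {B : Matrix (Fin l) (Fin m) A} {C : Matrix (Fin m) (Fin k) A}
    (h : B * C = 0) (x : Fin k → M) : act B (act C x) = 0 := by
  rw [← act_mul, h, act_zero_mat]

end act

def V0 {l m : ℕ} (B : Matrix (Fin l) (Fin m) A) (M : Type*) [AddCommGroup M] [Module A M] : Prop :=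
  ∀ x : Fin m → M, act B x = 0 →
    ∃ (k : ℕ) (C : Matrix (Fin m) (Fin k) A) (z : Fin k → M), B * C = 0 ∧ x = act C z

variable (A) in
def FlatM (M : Type*) [AddCommGroup M] [Module A M] : Prop :=
  ∀ (l m : ℕ) (B : Matrix (Fin l) (Fin m) A), V0 B M

def ExM {l m k : ℕ} (C : Matrix (Fin m) (Fin k) A) (B : Matrix (Fin l) (Fin m) A) : Prop :=
  B * C = 0 ∧ ∀ y : Fin m → A, act B y = 0 → ∃ t : Fin k → A, y = act C t

variable (A) in
theorem noeth_op (h : IsNoetherianRing Aᵐᵒᵖ) : IsNoetherian Aᵐᵒᵖ A := by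
  let e : Aᵐᵒᵖ ≃ₗ[Aᵐᵒᵖ] A :=
    { toFun := MulOpposite.unop
      invFun := MulOpposite.op
      map_add' := fun _ _ => rfl
      map_smul' := fun _ _ => rfl
      left_inv := fun _ => rfl
      right_inv := fun _ => rfl }
  have : IsNoetherian Aᵐᵒᵖ Aᵐᵒᵖ := h
  exact isNoetherian_of_linearEquiv e

theorem span_fin_op {m : ℕ} (h : IsNoetherianRing Aᵐᵒᵖ) (S : Submodule Aᵐᵒᵖ (Fin m → A)) :
    ∃ (k : ℕ) (C : Matrix (Fin m) (Fin k) A), (∀ c, (fun j => C j c) ∈ S) ∧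
      ∀ y ∈ S, ∃ t : Fin k → A, y = act C t := by
  have := noeth_op A h
  obtain ⟨k, s, hs⟩ := Submodule.fg_iff_exists_fin_generating_family.1
    (IsNoetherian.noetherian S)
  refine ⟨k, fun j c => s c j, fun c => ?_, fun y hy => ?_⟩
  · rw [← hs]; exact Submodule.subset_span ⟨c, rfl⟩
  · rw [← hs, Submodule.mem_span_range_iff_exists_fun] at hy
    obtain ⟨t, rfl⟩ := hy
    refine ⟨fun c => (t c).unop, ?_⟩
    ext j
    simp only [Finset.sum_apply, Pi.smul_apply]
    rfl

theorem exists_ExM (h : IsNoetherianRing Aᵐᵒᵖ) {l m : ℕ} (B : Matrix (Fin l) (Fin m) A) :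
    ∃ (k : ℕ) (C : Matrix (Fin m) (Fin k) A), ExM C B := by
  let S : Submodule Aᵐᵒᵖ (Fin m → A) :=
    { carrier := {y | act B y = 0}
      add_mem' := fun {a b} ha hb => by
        simp only [Set.mem_ofPred_eq] at *
        rw [map_add, ha, hb, add_zero]
      zero_mem' := by simp
      smul_mem' := fun c x hx => by
        simp only [Set.mem_ofPred_eq] at *
        ext i
        have := congrFun hx i
        simp only [act_apply, Pi.smul_apply, smul_eq_mul, Pi.zero_apply] at *
        have h2 : ∀ j, B i j * c • x j = c • (B i j * x j) := fun j => by
          simp [MulOpposite.smul_eq_mul_unop, mul_assoc]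
        simp only [h2]
        rw [← Finset.smul_sum, this, smul_zero] }
  obtain ⟨k, C, h1, h2⟩ := span_fin_op h S
  refine ⟨k, C, ?_, h2⟩
  ext i c
  have := congrFun (h1 c : act B (fun j => C j c) = 0) i
  simpa [act_apply, Matrix.mul_apply] using this

theorem ExM.factor {l m k r : ℕ} {C : Matrix (Fin m) (Fin k) A} {B : Matrix (Fin l) (Fin m) A}
    (h : ExM C B) {D : Matrix (Fin m) (Fin r) A} (hD : B * D = 0) : ∃ T, D = C * T := by
  have : ∀ c, ∃ t : Fin k → A, (fun j => D j c) = act C t := by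
    intro c
    apply h.2
    ext i
    have := congrFun (congrFun hD i) c
    simpa [act_apply, Matrix.mul_apply] using this
  choose t ht using this
  refine ⟨Matrix.of fun a c => t c a, ?_⟩
  ext j c
  have := congrFun (ht c) j
  refine Eq.trans ?_ (Matrix.mul_apply (M := C) (N := Matrix.of fun a c => t c a)).symm
  exact this

theorem V0_iff {l m k : ℕ} {C : Matrix (Fin m) (Fin k) A} {B : Matrix (Fin l) (Fin m) A}
    (h : ExM C B) (M : Type*) [AddCommGroup M] [Module A M] :
    V0 B M ↔ ∀ x : Fin m → M, act B x = 0 → ∃ z : Fin k → M, x = act C z := by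
  constructor
  · intro hV x hx
    obtain ⟨r, D, z, hD, rfl⟩ := hV x hx
    obtain ⟨T, rfl⟩ := h.factor hD
    exact ⟨act T z, act_mul _ _ _⟩
  · intro hV x hx
    obtain ⟨z, hz⟩ := hV x hx
    exact ⟨k, C, z, h.1, hz⟩

section ses
variable {K P M : Type*} [AddCommGroup K] [Module A K] [AddCommGroup P] [Module A P]
  [AddCommGroup M] [Module A M]

theorem V0_of_V0_quot {i : K →ₗ[A] P} {p : P →ₗ[A] M} (hi : Function.Injective i)
    (hp : Function.Surjective p) (he : Function.Exact i p) {l m k : ℕ}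
    {C : Matrix (Fin m) (Fin k) A} {B : Matrix (Fin l) (Fin m) A}
    (h : ExM C B) (hP : V0 B P) (hM : V0 C M) : V0 B K := by
  intro x hx
  obtain ⟨y, hy⟩ := (V0_iff h P).1 hP (fun j => i (x j)) (by
    rw [act_map, hx]; ext; simp)
  obtain ⟨r, D, z, hD, hz⟩ := hM (fun j => p (y j)) (by
    rw [act_map, ← hy]; ext; simp [he.apply_apply_eq_zero])
  choose w hw using fun c => hp (z c)
  have : ∀ c, ∃ u, i u = y c - act D w c := by
    intro c
    refine (he _).1 ?_
    rw [map_sub, ← congrFun (act_map D w p) c, sub_eq_zero]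
    simp only [hw]
    exact congrFun hz c
  choose u hu using this
  refine ⟨k, C, u, h.1, ?_⟩
  ext j
  apply hi
  have h1 : act C (fun c => i (u c)) = act C y := by
    have : (fun c => i (u c)) = y - act D w := by ext c; exact hu c
    rw [this, map_sub, mul_zero_act hD, sub_zero]
  rw [act_map, ← hy] at h1
  exact (congrFun h1 j).symm

theorem V0_quot {i : K →ₗ[A] P} {p : P →ₗ[A] M} (hi : Function.Injective i)
    (hp : Function.Surjective p) (he : Function.Exact i p) {l m k : ℕ}
    {C : Matrix (Fin m) (Fin k) A} {B : Matrix (Fin l) (Fin m) A}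
    (h : ExM C B) (hP : V0 C P) (hK : V0 B K) : V0 C M := by
  intro y hy
  choose w hw using fun c => hp (y c)
  have : ∀ c, ∃ u, i u = act C w c := by
    intro c
    refine (he _).1 ?_
    rw [← congrFun (act_map C w p) c]
    simp only [hw]
    exact congrFun hy c
  choose x hx using this
  obtain ⟨z, hz⟩ := (V0_iff h K).1 hK x (by
    ext t
    apply hi
    rw [← congrFun (act_map B x i) t]
    simp only [hx]
    simp [congrFun (mul_zero_act h.1 w) t])
  obtain ⟨r, D, v, hD, hv⟩ := hP (w - fun c => i (z c)) (by
    rw [map_sub, act_map, ← hz]; ext c; simp [hx])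
  refine ⟨r, D, fun c => p (v c), hD, ?_⟩
  rw [act_map, ← hv]
  ext c
  simp [hw, he.apply_apply_eq_zero]

end ses

theorem V0_retract {M N : Type*} [AddCommGroup M] [Module A M] [AddCommGroup N] [Module A N]
    (i : M →ₗ[A] N) (p : N →ₗ[A] M) (h : ∀ x, p (i x) = x) {l m : ℕ}
    {B : Matrix (Fin l) (Fin m) A} (hN : V0 B N) : V0 B M := by
  intro x hx
  obtain ⟨k, C, z, hC, hz⟩ := hN (fun j => i (x j)) (by rw [act_map, hx]; ext; simp)
  refine ⟨k, C, fun c => p (z c), hC, ?_⟩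
  rw [act_map, ← hz]
  ext; simp [h]

theorem Flat_free (hA : IsNoetherianRing Aᵐᵒᵖ) (J : Type*) : FlatM A (J →₀ A) := by
  classical
  intro l m B
  obtain ⟨k, C, h⟩ := exists_ExM hA B
  rw [V0_iff h]
  intro x hx
  have : ∀ j, ∃ t : Fin k → A, (fun a => x a j) = act C t ∧ ((∀ a, x a j = 0) → t = 0) := by
    intro j
    by_cases h0 : ∀ a, x a j = 0
    · exact ⟨0, by rw [map_zero]; ext; simp [h0], fun _ => rfl⟩
    · obtain ⟨t, ht⟩ := h.2 (fun a => x a j) (by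
        have := act_map B x (Finsupp.lapply j : (J →₀ A) →ₗ[A] A)
        rw [hx] at this
        simp at this
        rw [this]; rfl)
      exact ⟨t, ht, fun h => absurd h h0⟩
  choose t ht ht0 using this
  let S : Finset J := Finset.univ.biUnion fun a => (x a).support
  have hS : ∀ j, j ∉ S → t j = 0 := by
    intro j hj
    apply ht0
    intro a
    by_contra hne
    exact hj (Finset.mem_biUnion.2 ⟨a, Finset.mem_univ _, Finsupp.mem_support_iff.2 hne⟩)
  refine ⟨fun c => Finsupp.onFinset S (fun j => t j c) (fun j hj => by
    by_contra hne; exact hj (by simp [hS j hne])), ?_⟩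
  ext a j
  have := congrFun (ht j) a
  simp only [act_apply] at this ⊢
  simpa [Finsupp.finsetSum_apply] using this

theorem Flat_proj (hA : IsNoetherianRing Aᵐᵒᵖ) {M : Type*} [AddCommGroup M] [Module A M]
    (h : Module.Projective A M) : FlatM A M := by
  obtain ⟨s, hs⟩ := h
  exact fun l m B => V0_retract s (Finsupp.linearCombination A id) hs (Flat_free hA M l m B)

theorem Flat_Om (hA : IsNoetherianRing Aᵐᵒᵖ) {M : ModuleCat.{u} A} (h : FlatM A M) :
    FlatM A (Om M) := by
  intro l m B
  obtain ⟨k, C, hC⟩ := exists_ExM hA B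
  obtain ⟨i, p, hi, hp, he⟩ := Om_SES M
  exact V0_of_V0_quot hi hp he hC (Flat_proj hA (Fr_proj M) _ _ _) (h _ _ _)

/-- local retracts of free modules -/
def LR {J : Type u} (G : Submodule A (J →₀ A)) : Prop :=
  ∀ Γ : Finset (J →₀ A), (∀ γ ∈ Γ, γ ∈ G) → ∃ (T : Finset J) (τ : (J →₀ A) →ₗ[A] (J →₀ A)),
    (∀ x, τ x ∈ G) ∧ (∀ γ ∈ Γ, τ γ = γ) ∧ ∀ j ∉ T, τ (Finsupp.single j 1) = 0

theorem LR_top (J : Type u) : LR (⊤ : Submodule A (J →₀ A)) := by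
  classical
  intro Γ _
  let T : Finset J := Γ.biUnion fun γ => γ.support
  refine ⟨T, Finsupp.linearCombination A
    (fun j => if j ∈ T then Finsupp.single j (1:A) else 0), fun _ => trivial, ?_, ?_⟩
  · intro γ hγ
    rw [Finsupp.linearCombination_apply]
    conv_rhs => rw [← Finsupp.sum_single γ]
    refine Finset.sum_congr rfl fun j hj => ?_
    have : j ∈ T := Finset.mem_biUnion.2 ⟨γ, hγ, hj⟩
    simp [this]
  · intro j hj
    simp [hj]

theorem LR_of_flat {M : Type u} [AddCommGroup M] [Module A M] (h : FlatM A M) :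
    LR (LinearMap.ker (Finsupp.linearCombination A (id : M → M))) := by
  classical
  intro Γ hΓ
  let T : Finset M := Γ.biUnion fun γ => γ.support
  let eT := T.equivFin
  let eΓ := Γ.equivFin
  let B : Matrix (Fin Γ.card) (Fin T.card) A := fun i j => (eΓ.symm i).1 (eT.symm j).1
  have hB : ∀ γ ∈ Γ, ∀ {N : Type u} [AddCommGroup N] [Module A N] (v : M → N),
      Finsupp.linearCombination A v γ = ∑ t ∈ T, γ t • v t := by
    intro γ hγ N _ _ v
    rw [Finsupp.linearCombination_apply]
    exact Finsupp.sum_of_support_subset _ (Finset.subset_biUnion_of_mem _ hγ) _ (by simp)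
  have hB' : ∀ γ (hγ : γ ∈ Γ), ∀ {N : Type u} [AddCommGroup N] [Module A N] (v : M → N),
      Finsupp.linearCombination A v γ = act B (fun j => v (eT.symm j).1) (eΓ ⟨γ, hγ⟩) := by
    intro γ hγ N _ _ v
    rw [hB γ hγ v, act_apply, ← Finset.sum_coe_sort T]
    rw [← eT.symm.sum_comp]
    simp [B]
  obtain ⟨k, C, z, hC, hz⟩ := h _ _ B (fun j => (eT.symm j).1) (by
    ext i
    obtain ⟨⟨γ, hγ⟩, rfl⟩ := eΓ.surjective i
    rw [← hB' γ hγ (fun m => m)]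
    exact hΓ γ hγ)
  let v : M → (M →₀ A) := fun t => if ht : t ∈ T then
    Finsupp.single t 1 - act C (fun c => Finsupp.single (z c) 1) (eT ⟨t, ht⟩) else 0
  refine ⟨T, Finsupp.linearCombination A v, ?_, ?_, ?_⟩
  · intro x
    have : Finsupp.linearCombination A (id : M → M) ∘ₗ Finsupp.linearCombination A v = 0 := by
      ext t
      simp only [LinearMap.comp_apply, Finsupp.lsingle_apply, Finsupp.linearCombination_single,
        one_smul, LinearMap.zero_apply, v]
      split_ifs with ht
      · rw [map_sub, ← congrFun (act_map C _ _) (eT ⟨t, ht⟩)]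
        have := congrFun hz (eT ⟨t, ht⟩)
        simp at this
        simp [← this]
      · simp
    exact LinearMap.congr_fun this x
  · intro γ hγ
    rw [hB' γ hγ]
    have : (fun j => v (eT.symm j).1) = (fun j => Finsupp.single (eT.symm j).1 1) -
        act C (fun c => Finsupp.single (z c) 1) := by
      ext1 j
      simp [v]
    rw [this, map_sub, mul_zero_act hC, sub_zero, ← hB' γ hγ (fun t => Finsupp.single t (1 : A))]
    simp [Finsupp.linearCombination_apply]
  · intro j hj
    simp [v, hj]

end P4
end FPDaux

namespace FPDaux
section P5
variable {A}
open Filter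

def EvZ (W : ℕ → ModuleCat.{u} A) : Submodule A (∀ n, W n) where
  carrier := {x | ∀ᶠ n in atTop, x n = 0}
  add_mem' := fun {a b} ha hb => by
    filter_upwards [ha, hb] with n h1 h2
    simp [h1, h2]
  zero_mem' := by simp
  smul_mem' := fun c x hx => by
    filter_upwards [hx] with n h1
    simp [h1]

theorem mem_EvZ {W : ℕ → ModuleCat.{u} A} {x : ∀ n, W n} :
    x ∈ EvZ W ↔ ∀ᶠ n in atTop, x n = 0 := Iff.rfl

abbrev RedT (W : ℕ → ModuleCat.{u} A) : Type u := (∀ n, W n) ⧸ EvZ W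

def Red (W : ℕ → ModuleCat.{u} A) : ModuleCat.{u} A := ModuleCat.of A (RedT W)

theorem Red_mk_eq {W : ℕ → ModuleCat.{u} A} {x y : ∀ n, W n} :
    (EvZ W).mkQ x = (EvZ W).mkQ y ↔ ∀ᶠ n in atTop, x n = y n := by
  rw [Submodule.mkQ_apply, Submodule.mkQ_apply, Submodule.Quotient.eq, mem_EvZ]
  simp [sub_eq_zero]

theorem Red_mk_zero {W : ℕ → ModuleCat.{u} A} {x : ∀ n, W n} :
    (EvZ W).mkQ x = 0 ↔ ∀ᶠ n in atTop, x n = 0 := by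
  rw [← map_zero (EvZ W).mkQ, Red_mk_eq]; rfl

theorem act_pi {W : ℕ → ModuleCat.{u} A} {l m : ℕ} (B : Matrix (Fin l) (Fin m) A)
    (x : Fin m → ∀ n, W n) (i : Fin l) (n : ℕ) : act B x i n = act B (fun j => x j n) i := by
  simp [act_apply]

theorem V0_Red {l m k : ℕ} {C : Matrix (Fin m) (Fin k) A} {B : Matrix (Fin l) (Fin m) A}
    (h : ExM C B) {W : ℕ → ModuleCat.{u} A} (hW : ∀ᶠ n in atTop, V0 B (W n)) :
    V0 B (RedT W) := by
  rw [V0_iff h]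
  intro x hx
  choose x' hx' using fun j => (EvZ W).mkQ_surjective (x j)
  obtain rfl : x = fun j => (EvZ W).mkQ (x' j) := by ext1 j; exact (hx' j).symm
  rw [act_map] at hx
  have h1 : ∀ i, ∀ᶠ n in atTop, act B x' i n = 0 := fun i => Red_mk_zero.1 (congrFun hx i)
  have h2 := eventually_all.2 h1
  have h3 : ∀ n, ∃ z : Fin k → W n, V0 B (W n) → (∀ i, act B x' i n = 0) →
      (fun j => x' j n) = act C z := by
    intro n
    by_cases hn : V0 B (W n) ∧ (∀ i, act B x' i n = 0)
    · obtain ⟨z, hz⟩ := (V0_iff h _).1 hn.1 (fun j => x' j n) (by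
        ext i; rw [← act_pi]; exact hn.2 i)
      exact ⟨z, fun _ _ => hz⟩
    · exact ⟨0, fun a b => absurd ⟨a, b⟩ hn⟩
  choose z hz using h3
  refine ⟨fun c => (EvZ W).mkQ (fun n => z n c), ?_⟩
  rw [act_map]
  ext1 j
  rw [Red_mk_eq]
  filter_upwards [hW, h2] with n a b
  rw [act_pi]
  exact congrFun (hz n a b) j

theorem V0_of_Red {l m k : ℕ} {C : Matrix (Fin m) (Fin k) A} {B : Matrix (Fin l) (Fin m) A}
    (h : ExM C B) {W : ℕ → ModuleCat.{u} A} (hW : V0 B (RedT W)) :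
    ∀ᶠ n in atTop, V0 B (W n) := by
  have h3 : ∀ n, ∃ x : Fin m → W n, act B x = 0 ∧ ((∃ z : Fin k → W n, x = act C z) → V0 B (W n)) := by
    intro n
    by_contra hc
    push Not at hc
    have : V0 B (W n) := (V0_iff h _).2 fun x hx => (hc x hx).1
    exact (hc 0 (map_zero _)).2 this
  choose x hx hx' using h3
  obtain ⟨z, hz⟩ := (V0_iff h _).1 hW (fun j => (EvZ W).mkQ (fun n => x n j)) (by
    rw [act_map]
    ext1 i
    rw [Pi.zero_apply, Red_mk_zero]
    refine Eventually.of_forall fun n => ?_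
    rw [act_pi]
    exact congrFun (hx n) i)
  choose z' hz' using fun j => (EvZ W).mkQ_surjective (z j)
  obtain rfl : z = fun j => (EvZ W).mkQ (z' j) := by ext1 j; exact (hz' j).symm
  rw [act_map] at hz
  have h1 : ∀ j, ∀ᶠ n in atTop, x n j = act C z' j n := fun j => Red_mk_eq.1 (congrFun hz j)
  filter_upwards [eventually_all.2 h1] with n hn
  refine hx' n ⟨fun j => z' j n, ?_⟩
  ext j
  rw [← act_pi]
  exact hn j

def RedMap {W V : ℕ → ModuleCat.{u} A} (f : ∀ n, W n →ₗ[A] V n) : RedT W →ₗ[A] RedT V :=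
  (EvZ W).mapQ (EvZ V) (LinearMap.pi fun n => f n ∘ₗ LinearMap.proj n) (by
    intro x hx
    rw [Submodule.mem_comap, mem_EvZ]
    filter_upwards [hx] with n hn
    simp [hn])

theorem RedMap_mk {W V : ℕ → ModuleCat.{u} A} (f : ∀ n, W n →ₗ[A] V n) (x : ∀ n, W n) :
    RedMap f ((EvZ W).mkQ x) = (EvZ V).mkQ (fun n => f n (x n)) := rfl

theorem Red_SES (hA : IsNoetherianRing Aᵐᵒᵖ) {W V : ℕ → ModuleCat.{u} A}
    (h : ∀ᶠ n in atTop, SESproj (W n) (V n)) :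
    ∃ F : ModuleCat.{u} A, FlatM A F ∧ SES (Red W) F (Red V) := by
  have : ∀ n, ∃ (P : ModuleCat.{u} A) (i : W n →ₗ[A] P) (p : P →ₗ[A] V n),
      Module.Projective A P ∧ (SESproj (W n) (V n) →
        Function.Injective i ∧ Function.Surjective p ∧ Function.Exact i p) := by
    intro n
    by_cases hn : SESproj (W n) (V n)
    · obtain ⟨P, hP, i, p, hh⟩ := hn
      exact ⟨P, i, p, hP, fun _ => hh⟩
    · exact ⟨ModuleCat.of A PUnit.{u+1}, 0, 0,
        inferInstanceAs (Module.Projective A PUnit.{u+1}), fun h => absurd h hn⟩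
  choose P i p hP hh using this
  have hfl : FlatM A (RedT P) := fun l m B => by
    obtain ⟨k, C, hC⟩ := exists_ExM hA B
    exact V0_Red hC (Eventually.of_forall fun n => Flat_proj hA (hP n) _ _ _)
  suffices hsuff : Function.Injective (RedMap i) ∧ Function.Surjective (RedMap p) ∧
      Function.Exact (RedMap i) (RedMap p) from
    ⟨Red P, hfl, RedMap i, RedMap p, hsuff⟩
  refine ⟨?_, ?_, ?_⟩
  · rw [← LinearMap.ker_eq_bot, LinearMap.ker_eq_bot']
    intro x hx
    obtain ⟨x, rfl⟩ := (EvZ W).mkQ_surjective x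
    rw [RedMap_mk, Red_mk_zero] at hx
    rw [Red_mk_zero]
    filter_upwards [h, hx] with n h1 h2
    exact (hh n h1).1 (by rw [h2, map_zero])
  · intro y
    obtain ⟨y, rfl⟩ := (EvZ V).mkQ_surjective y
    have : ∀ n, ∃ x, SESproj (W n) (V n) → p n x = y n := by
      intro n
      by_cases hn : SESproj (W n) (V n)
      · obtain ⟨x, hx⟩ := (hh n hn).2.1 (y n)
        exact ⟨x, fun _ => hx⟩
      · exact ⟨0, fun h => absurd h hn⟩
    choose x hx using this
    refine ⟨(EvZ P).mkQ x, ?_⟩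
    rw [RedMap_mk, Red_mk_eq]
    filter_upwards [h] with n h1 using hx n h1
  · intro y
    obtain ⟨y, rfl⟩ := (EvZ P).mkQ_surjective y
    constructor
    · intro hy
      rw [RedMap_mk, Red_mk_zero] at hy
      have : ∀ n, ∃ x, SESproj (W n) (V n) → p n (y n) = 0 → i n x = y n := by
        intro n
        by_cases hn : SESproj (W n) (V n) ∧ p n (y n) = 0
        · obtain ⟨x, hx⟩ := ((hh n hn.1).2.2 (y n)).1 hn.2
          exact ⟨x, fun _ _ => hx⟩
        · exact ⟨0, fun h h' => absurd ⟨h, h'⟩ hn⟩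
      choose x hx using this
      refine ⟨(EvZ W).mkQ x, ?_⟩
      rw [RedMap_mk, Red_mk_eq]
      filter_upwards [h, hy] with n h1 h2 using hx n h1 h2
    · rintro ⟨x, hx⟩
      obtain ⟨x, rfl⟩ := (EvZ W).mkQ_surjective x
      rw [RedMap_mk, Red_mk_eq] at hx
      rw [RedMap_mk, Red_mk_zero]
      filter_upwards [h, hx] with n h1 h2
      rw [← h2]
      exact (hh n h1).2.2.apply_apply_eq_zero _

theorem horseshoe {K F N : ModuleCat.{u} A} (h : SES K F N) :
    ∃ F' Q : ModuleCat.{u} A, Module.Projective A Q ∧ SES F' Q F ∧ SES (Om K) F' (Om N) := by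
  obtain ⟨i, p, hi, hp, he⟩ := h
  choose s hs using hp
  let lK := Finsupp.linearCombination A (id : K → K)
  let lN := Finsupp.linearCombination A (id : N → N)
  let q : ((K →₀ A) × (N →₀ A)) →ₗ[A] F :=
    (i ∘ₗ lK).coprod (Finsupp.linearCombination A s)
  have hpi : ∀ k, p (i k) = 0 := he.apply_apply_eq_zero
  have hps : ∀ b, p (Finsupp.linearCombination A s b) = lN b := by
    intro b
    have : p ∘ₗ Finsupp.linearCombination A s = lN := by
      ext n; simp [lN, hs]
    exact LinearMap.congr_fun this b
  have hq : Function.Surjective q := by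
    intro x
    have : p (x - s (p x)) = 0 := by simp [hs]
    obtain ⟨k, hk⟩ := (he _).1 this
    refine ⟨(Finsupp.single k 1, Finsupp.single (p x) 1), ?_⟩
    simp [q, lK, hk]
  refine ⟨ModuleCat.of A (LinearMap.ker q), ModuleCat.of A ((K →₀ A) × (N →₀ A)),
    inferInstanceAs (Module.Projective A ((K →₀ A) × (N →₀ A))), SES_of_surj q hq, ?_⟩
  refine ⟨LinearMap.codRestrict (LinearMap.ker q)
      (LinearMap.inl A (K →₀ A) (N →₀ A) ∘ₗ (LinearMap.ker lK).subtype) ?_,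
    LinearMap.codRestrict (LinearMap.ker lN)
      (LinearMap.snd A (K →₀ A) (N →₀ A) ∘ₗ (LinearMap.ker q).subtype) ?_, ?_, ?_, ?_⟩
  · rintro ⟨a, ha⟩
    change i (lK a) + Finsupp.linearCombination A s 0 = 0
    rw [LinearMap.mem_ker.1 ha]; simp
  · rintro ⟨⟨a, b⟩, hab⟩
    have hab : i (lK a) + Finsupp.linearCombination A s b = 0 := hab
    change lN b = 0
    have := congrArg p hab
    rwa [map_add, hpi, zero_add, hps, map_zero] at this
  · intro x y hxy
    have := congrArg (fun z => z.1.1) hxy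
    exact Subtype.ext this
  · rintro ⟨b, hb⟩
    have hb' : p (Finsupp.linearCombination A s b) = 0 := by rw [hps]; exact hb
    obtain ⟨k, hk⟩ := (he _).1 hb'
    refine ⟨⟨(-Finsupp.single k 1, b), ?_⟩, rfl⟩
    change i (lK (-Finsupp.single k 1)) + Finsupp.linearCombination A s b = 0
    simp [lK, hk]
  · rintro ⟨⟨a, b⟩, hab⟩
    have hab' : i (lK a) + Finsupp.linearCombination A s b = 0 := hab
    constructor
    · intro h
      obtain rfl : b = 0 := congrArg Subtype.val h
      refine ⟨⟨a, ?_⟩, rfl⟩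
      rw [map_zero, add_zero] at hab'
      exact hi (by rw [hab', map_zero])
    · rintro ⟨⟨c, hc⟩, hx⟩
      exact Subtype.ext (congrArg (fun z => z.1.2) hx).symm

theorem SES_zero_left {Z M : ModuleCat.{u} A} (h : Subsingleton Z) : SES Z M M := by
  refine ⟨0, LinearMap.id, fun _ _ _ => Subsingleton.elim _ _, Function.surjective_id, fun x => ?_⟩
  constructor
  · intro hx; exact ⟨0, hx.symm⟩
  · rintro ⟨y, rfl⟩; rfl

theorem chain_PD (h3 : C3 A) : ∀ (d : ℕ) (z : ℕ → ModuleCat.{u} A), Subsingleton (z 0) →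
    (∀ k, ∃ F, PD d F ∧ SES (z k) F (z (k+1))) → ∀ k, PD d (z k)
  | 0, z, h0, hz, k => (proj_iff_PD _).1 (h3 z h0 (fun k => by
      obtain ⟨F, hF, h⟩ := hz k
      exact ⟨F, (proj_iff_PD _).2 hF, h⟩) k)
  | d+1, z, h0, hz, k => by
    let z' : ℕ → ModuleCat.{u} A := fun k => Nat.casesOn k (ModuleCat.of A PUnit.{u+1})
      (fun k => Om (z k))
    have := chain_PD h3 d z' (inferInstanceAs (Subsingleton PUnit.{u+1})) (by
      rintro (_ | k)
      · exact ⟨Om (z 0), PD_Om.1 (PD.of_subsingleton h0 _),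
          SES_zero_left (inferInstanceAs (Subsingleton PUnit.{u+1}))⟩
      · obtain ⟨F, hF, h⟩ := hz k
        obtain ⟨F', Q, hQ, h1, h2⟩ := horseshoe h
        exact ⟨F', h1.PD₁ (PD.of_proj hQ _) hF, h2⟩) (k+1)
    exact PD_Om.2 this

def Syz : ℕ → ∀ {l m : ℕ}, Matrix (Fin l) (Fin m) A → Prop
  | 0, _, _, _ => True
  | d+1, l, _, C => ∃ (r : ℕ) (B : Matrix (Fin r) (Fin l) A), ExM C B ∧ Syz d B

theorem V0_Syz (hA : IsNoetherianRing Aᵐᵒᵖ) : ∀ (d : ℕ) (M : ModuleCat.{u} A), PD d M →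
    ∀ {l m : ℕ} (B : Matrix (Fin l) (Fin m) A), Syz d B → V0 B M
  | 0, M, hM, l, m, B, _ => Flat_proj hA ((proj_iff_PD _).2 hM) _ _ _
  | d+1, M, hM, l, m, B, ⟨r, C, hC, h⟩ => by
    obtain ⟨i, p, hi, hp, he⟩ := Om_SES M
    exact V0_quot hi hp he hC (Flat_proj hA (Fr_proj M) _ _ _) (V0_Syz hA d _ (PD_Om.1 hM) C h)

theorem chain_flat (hA : IsNoetherianRing Aᵐᵒᵖ) (d : ℕ) (z : ℕ → ModuleCat.{u} A)
    (hz : ∀ k, PD d (z k)) (hs : ∀ k, ∃ F : ModuleCat.{u} A, FlatM A F ∧ SES (z k) F (z (k+1))) :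
    ∀ k, FlatM A (z k) := by
  have : ∀ e j, j + e = d → ∀ k, ∀ {l m : ℕ} (B : Matrix (Fin l) (Fin m) A), Syz j B →
      V0 B (z k) := by
    intro e
    induction e with
    | zero =>
      rintro j rfl k l m B hB
      exact V0_Syz hA _ _ (hz k) B hB
    | succ e ih =>
      intro j hj k l m B hB
      obtain ⟨r, C, hC⟩ := exists_ExM hA B
      obtain ⟨F, hF, i, p, hi, hp, he⟩ := hs k
      exact V0_of_V0_quot hi hp he hC (hF _ _ _)
        (ih (j+1) (by omega) (k+1) C ⟨_, B, hC, hB⟩)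
  exact fun k l m B => this d 0 (by omega) k B trivial

theorem PD_Om_iter {n : ℕ} : ∀ (j : ℕ) {M : ModuleCat.{u} A}, PD (n+j) M ↔ PD n (Om^[j] M)
  | 0, M => Iff.rfl
  | j+1, M => by
    rw [Function.iterate_succ_apply, ← PD_Om_iter j]
    exact PD_Om

noncomputable def Wc (M : ℕ → ModuleCat.{u} A) : ℕ → ℕ → ModuleCat.{u} A
  | 0, _ => ModuleCat.of A PUnit.{u+1}
  | k+1, n => Om^[n+1-k] (M n)

theorem FPD_of_apps (hA : IsNoetherianRing Aᵐᵒᵖ) (h3 : C3 A) (d : ℕ)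
    (happ1 : ∀ F : ModuleCat.{u} A, FlatM A F → PD d F) (K : ℕ) {ι : Type} [Finite ι]
    (l m : ι → ℕ) (B : ∀ i, Matrix (Fin (l i)) (Fin (m i)) A)
    (happ2 : ∀ M : ModuleCat.{u} A, (∀ i j, V0 (B i) (Om^[j] M)) →
      Module.Projective A (Om^[K+1] M) → Module.Projective A (Om^[K] M)) : FPDFinite A := by
  classical
  by_contra hcon
  have h1 : ∀ n, ∃ M : ModuleCat.{u} A, PD (n+1) M ∧ ¬ PD n M := by
    intro n
    by_contra hn
    push Not at hn
    apply hcon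
    refine ⟨n, fun M hM => ?_⟩
    obtain ⟨N, hN⟩ := hM
    rw [ProjDimLE_iff] at *
    induction N with
    | zero => exact hN.mono (Nat.zero_le _)
    | succ N ih =>
      by_cases hNn : N < n
      · exact hN.mono hNn
      · apply ih
        obtain ⟨j, rfl⟩ := Nat.exists_eq_add_of_le (not_lt.1 hNn)
        rw [PD_Om_iter]
        apply hn
        rw [← PD_Om_iter]
        exact hN.mono (by omega)
  choose M hM hM' using h1
  let W : ℕ → ℕ → ModuleCat.{u} A := Wc M
  have hW1 : ∀ n, Module.Projective A (W 1 n) := by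
    intro n
    rw [proj_iff_PD]
    change PD 0 (Om^[n+1] (M n))
    rw [← PD_Om_iter]
    exact (hM n).mono (by omega)
  let z : ℕ → ModuleCat.{u} A := fun k => Red (W k)
  have hs : ∀ k, ∃ F : ModuleCat.{u} A, FlatM A F ∧ SES (z k) F (z (k+1)) := by
    intro k
    apply Red_SES hA
    cases k with
    | zero =>
      exact Eventually.of_forall fun n => ⟨W 1 n, hW1 n,
        SES_zero_left (inferInstanceAs (Subsingleton PUnit.{u+1}))⟩
    | succ k =>
      filter_upwards [eventually_ge_atTop k] with n hn
      refine ⟨_, Fr_proj (W (k+2) n), ?_⟩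
      have : W (k+1) n = Om (W (k+2) n) := by
        change Om^[n+1-k] (M n) = Om (Om^[n+1-(k+1)] (M n))
        rw [← Function.iterate_succ_apply' Om]
        congr 1
        congr 1
        omega
      rw [this]
      exact Om_SES _
  have hz0 : Subsingleton (z 0) := by
    refine ⟨fun x y => ?_⟩
    obtain ⟨x, rfl⟩ := (EvZ (W 0)).mkQ_surjective x
    obtain ⟨y, rfl⟩ := (EvZ (W 0)).mkQ_surjective y
    congr 1
    ext1 n
    exact Subsingleton.elim (α := PUnit.{u+1}) _ _
  have hPD := chain_PD h3 d z hz0 (fun k => by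
    obtain ⟨F, hF, h⟩ := hs k
    exact ⟨F, happ1 F hF, h⟩)
  have hfl := chain_flat hA d z hPD hs
  have hev : ∀ i, ∀ k : Fin (K+2), ∀ᶠ n in atTop, V0 (B i) (W (k+1) n) := by
    intro i k
    obtain ⟨r, C, hC⟩ := exists_ExM hA (B i)
    exact V0_of_Red hC (hfl (k+1) _ _ _)
  have hev2 := eventually_all.2 fun i => eventually_all.2 (hev i)
  obtain ⟨n, hn, hnK⟩ := (hev2.and (eventually_ge_atTop (K+1))).exists
  apply hM' n
  have hpr := happ2 (Om^[n-K] (M n)) (by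
    intro i j
    by_cases hj : j < K+2
    · have := hn i ⟨K+1-j, by omega⟩
      change V0 (B i) (Om^[n+1-(K+1-j)] (M n)) at this
      rw [← Function.iterate_add_apply]
      have e : j + (n-K) = n+1-(K+1-j) := by omega
      rw [e]
      exact this
    · refine Flat_proj hA ?_ _ _ _
      rw [← Function.iterate_add_apply, proj_iff_PD, ← PD_Om_iter]
      exact (hM n).mono (by omega)) (by
    rw [← Function.iterate_add_apply, proj_iff_PD, ← PD_Om_iter]
    exact (hM n).mono (by omega))
  rw [← Function.iterate_add_apply, proj_iff_PD, ← PD_Om_iter] at hpr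
  exact hpr.mono (by omega)

end P5
end FPDaux

namespace FPDaux
section P6
variable {A}
open CochainComplex.HomComplex

theorem inj_extend {M N Q : Type u} [AddCommGroup M] [Module A M] [AddCommGroup N] [Module A N]
    [AddCommGroup Q] [Module A Q] (hQ : Module.Injective A Q) (d : M →ₗ[A] N) (f : M →ₗ[A] Q)
    (h : ∀ x, d x = 0 → f x = 0) : ∃ g : N →ₗ[A] Q, ∀ x, g (d x) = f x := by
  obtain ⟨g, hg⟩ := factor d.rangeRestrict d.surjective_rangeRestrict f (fun x hx => h x (by
    exact congrArg Subtype.val hx))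
  obtain ⟨e, he⟩ := hQ.out (LinearMap.range d).subtype Subtype.val_injective g
  exact ⟨e, fun x => by
    rw [← hg x, ← he]; rfl⟩

theorem homotopy_lemma {X Y : Cplx A} {n : ℤ} (b : ℤ)
    (hY : ∀ k, Module.Injective A (Y.X k)) (hb : ∀ k, b < k → Subsingleton (Y.X k))
    (a : ℤ) (ha : ∀ k, k < a → Subsingleton (Y.X k))
    (hX : ∀ q, q + n ≤ b → ∀ x : X.X q, X.d q (q+1) x = 0 → ∃ y : X.X (q-1), X.d (q-1) q y = x)
    (z : Cochain X Y n) (hz : δ n (n+1) z = 0) :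
    ∃ w : Cochain X Y (n-1), δ (n-1) n w = z := by
  have key : ∀ N : ℕ, ∀ z : Cochain X Y n, δ n (n+1) z = 0 →
      (∀ p q h, p + N < b - n + 1 → z.v p q h = 0) → ∃ w : Cochain X Y (n-1), δ (n-1) n w = z := by
    intro N
    induction N with
    | zero =>
      intro z hz h0
      refine ⟨0, ?_⟩
      rw [δ_zero]
      ext1 p q h
      by_cases hp : p < b - n + 1
      · rw [h0 p q h (by simpa using hp)]; rfl
      · have := hb q (by omega)
        ext x
        exact Subsingleton.elim _ _
    | succ N ih =>
      intro z hz h0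
      obtain ⟨P, hP⟩ : ∃ P, P = b - n + 1 - (N+1) := ⟨_, rfl⟩
      have hcoc : X.d (P-1) P ≫ z.v P (P+n) rfl = 0 := by
        have h1 := Cochain.congr_v hz (P-1) (P+n) (by ring)
        rw [δ_v n (n+1) rfl z (P-1) (P+n) _ (P+n-1) P rfl (by ring),
          h0 (P-1) (P+n-1) (by ring) (by push_cast; omega)] at h1
        rw [zero_comp, zero_add] at h1
        have h2 := congrArg (fun t => (n+1).negOnePow • t) h1
        simpa [smul_smul] using h2
      obtain ⟨g, hg⟩ := inj_extend (hY (P+n)) (X.d P (P+1)).hom (z.v P (P+n) rfl).hom (by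
        intro x hx
        obtain ⟨y, rfl⟩ := hX P (by omega) x hx
        exact LinearMap.congr_fun (congrArg ModuleCat.Hom.hom hcoc) y)
      have hg' : X.d P (P+1) ≫ ModuleCat.ofHom g = z.v P (P+n) rfl := by
        ext x; exact hg x
      let w0 : Cochain X Y (n-1) := Cochain.single (n.negOnePow • ModuleCat.ofHom g : X.X (P+1) ⟶ Y.X (P+n)) (n-1)
      have hδ : ∀ p q h, p < P + 1 → (δ (n-1) n w0).v p q h = z.v p q h := by
        intro p q h hp
        rw [δ_v (n-1) n (by ring) w0 p q h (q-1) (p+1) rfl rfl,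
          Cochain.single_v_eq_zero _ _ p (q-1) _ (by omega), zero_comp, zero_add]
        by_cases hpP : p = P
        · subst hpP
          obtain rfl : q = p + n := h.symm
          rw [Cochain.single_v, ← hg']
          simp [smul_smul]
        · rw [Cochain.single_v_eq_zero _ _ (p+1) q _ (by omega), comp_zero, smul_zero,
            h0 p q h (by push_cast; omega)]
      obtain ⟨w, hw⟩ := ih (z - δ (n-1) n w0) (by rw [δ_sub, hz, δ_δ, sub_zero]) (by
        intro p q h hp
        rw [Cochain.sub_v, hδ p q h (by omega), sub_self])
      exact ⟨w + w0, by rw [δ_add, hw]; abel⟩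
  refine key (b - a + 1).toNat z hz (fun p q h hp => ?_)
  have := ha q (by omega)
  ext x
  exact Subsingleton.elim _ _

end P6
end FPDaux

namespace FPDaux
section P7
open CochainComplex.HomComplex

/-- A complex with a right action. -/
structure XD where
  X : Cplx A
  rho : A → (X ⟶ X)
  rho_add : ∀ a b, rho (a + b) = rho a + rho b
  rho_mul : ∀ a b, rho (a * b) = rho a ≫ rho b
  rho_one : rho 1 = 𝟙 X

variable {A}
namespace XD
variable (D : XD A)

abbrev C (i : ℤ) : Type u := D.X.X i

def r (a : A) {i : ℤ} : D.C i →ₗ[A] D.C i := ((D.rho a).f i).hom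

def dd (i j : ℤ) : D.C i →ₗ[A] D.C j := (D.X.d i j).hom

theorem r_add (a b : A) {i : ℤ} (x : D.C i) : D.r (a + b) x = D.r a x + D.r b x := by
  simp only [r, D.rho_add]; rfl

theorem r_mul (a b : A) {i : ℤ} (x : D.C i) : D.r (a * b) x = D.r b (D.r a x) := by
  simp only [r, D.rho_mul]; rfl

theorem r_one {i : ℤ} (x : D.C i) : D.r 1 x = x := by
  simp only [r, D.rho_one]; rfl

theorem r_zero {i : ℤ} (x : D.C i) : D.r 0 x = 0 := by
  have := D.r_add 0 0 x
  simpa using this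

theorem r_d (a : A) {i j : ℤ} (x : D.C i) : D.r a (D.dd i j x) = D.dd i j (D.r a x) := by
  exact (LinearMap.congr_fun (congrArg ModuleCat.Hom.hom ((D.rho a).comm i j)) x).symm

theorem dd_dd {i j k : ℤ} (x : D.C i) : D.dd j k (D.dd i j x) = 0 :=
  LinearMap.congr_fun (congrArg ModuleCat.Hom.hom (D.X.d_comp_d i j k)) x

theorem dd_shape {i j : ℤ} (h : i + 1 ≠ j) : D.dd i j = 0 := by
  have := D.X.shape i j (by simpa using h)
  simp only [dd, this]; rfl

variable {J J' J'' : Type u}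

noncomputable def mu (p : J →₀ A) {i : ℤ} : D.C i →ₗ[A] (J →₀ D.C i) where
  toFun x := p.mapRange (fun c => D.r c x) (D.r_zero x)
  map_add' x y := by ext j; simp
  map_smul' c x := by ext j; simp

theorem mu_apply (p : J →₀ A) {i : ℤ} (x : D.C i) (j : J) : D.mu p x j = D.r (p j) x := rfl

theorem mu_add (p q : J →₀ A) {i : ℤ} (x : D.C i) : D.mu (p + q) x = D.mu p x + D.mu q x := by
  ext j; simp [mu_apply, r_add]

theorem mu_zero {i : ℤ} (x : D.C i) : D.mu (0 : J →₀ A) x = 0 := by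
  ext j; simp [mu_apply, r_zero]

theorem mu_smul (a : A) (p : J →₀ A) {i : ℤ} (x : D.C i) : D.mu (a • p) x = D.mu p (D.r a x) := by
  ext j; simp [mu_apply, r_mul]

theorem mu_single (j : J) (c : A) {i : ℤ} (x : D.C i) :
    D.mu (Finsupp.single j c) x = Finsupp.single j (D.r c x) := by
  classical
  ext k
  rw [mu_apply, Finsupp.single_apply, Finsupp.single_apply]
  split_ifs <;> simp [r_zero]

noncomputable def ex (φ : (J →₀ A) →ₗ[A] (J' →₀ A)) {i : ℤ} : (J →₀ D.C i) →ₗ[A] (J' →₀ D.C i) :=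
  Finsupp.lsum ℕ fun j => D.mu (φ (Finsupp.single j 1))

theorem ex_single (φ : (J →₀ A) →ₗ[A] (J' →₀ A)) {i : ℤ} (j : J) (x : D.C i) :
    D.ex φ (Finsupp.single j x) = D.mu (φ (Finsupp.single j 1)) x := by
  simp [ex]

theorem ex_mu (φ : (J →₀ A) →ₗ[A] (J' →₀ A)) {i : ℤ} (p : J →₀ A) (x : D.C i) :
    D.ex φ (D.mu p x) = D.mu (φ p) x := by
  induction p using Finsupp.induction_linear with
  | zero => simp [mu_zero]
  | add p q hp hq => rw [mu_add, map_add, hp, hq, map_add, mu_add]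
  | single j c =>
    rw [mu_single, ex_single, ← mu_smul, ← map_smul, Finsupp.smul_single, smul_eq_mul, mul_one]

theorem ex_ex (φ : (J' →₀ A) →ₗ[A] (J'' →₀ A)) (ψ : (J →₀ A) →ₗ[A] (J' →₀ A)) {i : ℤ}
    (y : J →₀ D.C i) : D.ex φ (D.ex ψ y) = D.ex (φ ∘ₗ ψ) y := by
  induction y using Finsupp.induction_linear with
  | zero => simp
  | add p q hp hq => simp only [map_add, hp, hq]
  | single j c => rw [ex_single, ex_single, ex_mu]; rfl

theorem ex_zero {i : ℤ} (y : J →₀ D.C i) : D.ex (0 : (J →₀ A) →ₗ[A] (J' →₀ A)) y = 0 := by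
  induction y using Finsupp.induction_linear with
  | zero => simp
  | add p q hp hq => simp only [map_add, hp, hq, add_zero]
  | single j c => rw [ex_single]; simp [mu_zero]

noncomputable def md (i j : ℤ) : (J →₀ D.C i) →ₗ[A] (J →₀ D.C j) :=
  Finsupp.mapRange.linearMap (D.dd i j)

theorem md_apply (i j : ℤ) (y : J →₀ D.C i) (t : J) : D.md i j y t = D.dd i j (y t) := rfl

theorem md_single (i j : ℤ) (t : J) (x : D.C i) :
    D.md i j (Finsupp.single t x) = Finsupp.single t (D.dd i j x) := by
  simp [md]

theorem md_mu {i j : ℤ} (p : J →₀ A) (x : D.C i) : D.md i j (D.mu p x) = D.mu p (D.dd i j x) := by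
  ext t; rw [md_apply, mu_apply, mu_apply, r_d]

theorem md_md {i j k : ℤ} (y : J →₀ D.C i) : D.md j k (D.md i j y) = 0 := by
  ext t; simp [md_apply, dd_dd]

theorem md_ex {i j : ℤ} (φ : (J →₀ A) →ₗ[A] (J' →₀ A)) (y : J →₀ D.C i) :
    D.md i j (D.ex φ y) = D.ex φ (D.md i j y) := by
  induction y using Finsupp.induction_linear with
  | zero => simp
  | add p q hp hq => simp only [map_add, hp, hq]
  | single t c => rw [ex_single, md_mu, md_single, ex_single]

theorem ex_eq_sum {T : Finset J} {τ : (J →₀ A) →ₗ[A] (J' →₀ A)}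
    (hT : ∀ j ∉ T, τ (Finsupp.single j 1) = 0) {i : ℤ} (y : J →₀ D.C i) :
    D.ex τ y = ∑ t ∈ T, D.mu (τ (Finsupp.single t 1)) (y t) := by
  classical
  induction y using Finsupp.induction_linear with
  | zero => simp
  | add p q hp hq => simp only [map_add, hp, hq, Finsupp.add_apply, Finset.sum_add_distrib]
  | single j c =>
    rw [ex_single]
    by_cases hj : j ∈ T
    · rw [Finset.sum_eq_single_of_mem j hj]
      · simp
      · intro b _ hb
        rw [Finsupp.single_eq_of_ne (by exact hb), map_zero]
    · rw [hT j hj, mu_zero, Finset.sum_eq_zero]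
      intro t ht
      rw [Finsupp.single_eq_of_ne (by rintro rfl; exact hj ht), map_zero]

variable (G : Submodule A (J →₀ A))

noncomputable def Ysub (i : ℤ) : Submodule A (J →₀ D.C i) :=
  Submodule.span A {y | ∃ g ∈ G, ∃ x : D.C i, y = D.mu g x}

theorem mu_mem {g : J →₀ A} (hg : g ∈ G) {i : ℤ} (x : D.C i) : D.mu g x ∈ D.Ysub G i :=
  Submodule.subset_span ⟨g, hg, x, rfl⟩

theorem md_mem {i j : ℤ} {y : J →₀ D.C i} (hy : y ∈ D.Ysub G i) : D.md i j y ∈ D.Ysub G j := by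
  induction hy using Submodule.span_induction with
  | mem y hy =>
    obtain ⟨g, hg, x, rfl⟩ := hy
    rw [md_mu]; exact D.mu_mem G hg _
  | zero => simp
  | add x y _ _ hx hy => rw [map_add]; exact add_mem hx hy
  | smul a x _ hx => rw [map_smul]; exact Submodule.smul_mem _ _ hx

theorem ex_mem {τ : (J' →₀ A) →ₗ[A] (J →₀ A)} (hτ : ∀ x, τ x ∈ G) {i : ℤ} (y : J' →₀ D.C i) :
    D.ex τ y ∈ D.Ysub G i := by
  induction y using Finsupp.induction_linear with
  | zero => simp
  | add p q hp hq => rw [map_add]; exact add_mem hp hq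
  | single j c => rw [ex_single]; exact D.mu_mem G (hτ _) _

theorem Y_loc {i : ℤ} {y : J →₀ D.C i} (hy : y ∈ D.Ysub G i) :
    ∃ Γ : Finset (J →₀ A), (∀ γ ∈ Γ, γ ∈ G) ∧ ∀ τ : (J →₀ A) →ₗ[A] (J →₀ A),
      (∀ γ ∈ Γ, τ γ = γ) → D.ex τ y = y := by
  classical
  induction hy using Submodule.span_induction with
  | mem y hy =>
    obtain ⟨g, hg, x, rfl⟩ := hy
    exact ⟨{g}, by simpa using hg, fun τ h => by rw [ex_mu, h g (by simp)]⟩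
  | zero => exact ⟨∅, by simp, by simp⟩
  | add x y _ _ hx hy =>
    obtain ⟨Γ, h1, h2⟩ := hx
    obtain ⟨Γ', h1', h2'⟩ := hy
    refine ⟨Γ ∪ Γ', fun γ hγ => ?_, fun τ h => ?_⟩
    · rcases Finset.mem_union.1 hγ with h | h
      exacts [h1 _ h, h1' _ h]
    · rw [map_add, h2 τ fun γ hγ => h γ (Finset.mem_union_left _ hγ),
        h2' τ fun γ hγ => h γ (Finset.mem_union_right _ hγ)]
  | smul a x _ hx =>
    obtain ⟨Γ, h1, h2⟩ := hx
    exact ⟨Γ, h1, fun τ h => by rw [map_smul, h2 τ h]⟩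

theorem Y_loc_fg {i : ℤ} {M : Type*} [AddCommGroup M] [Module A M] {L : Submodule A M} (hL : L.FG)
    (φ : L →ₗ[A] D.Ysub G i) :
    ∃ Γ : Finset (J →₀ A), (∀ γ ∈ Γ, γ ∈ G) ∧ ∀ τ : (J →₀ A) →ₗ[A] (J →₀ A),
      (∀ γ ∈ Γ, τ γ = γ) → ∀ l, D.ex τ (φ l).1 = (φ l).1 := by
  classical
  obtain ⟨k, s, hs⟩ := Submodule.fg_iff_exists_fin_generating_family.1
    ((Submodule.fg_top L).2 hL)
  choose Γ h1 h2 using fun c => D.Y_loc G (φ (s c)).2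
  refine ⟨Finset.univ.biUnion Γ, ?_, ?_⟩
  · intro γ hγ
    obtain ⟨c, _, hc⟩ := Finset.mem_biUnion.1 hγ
    exact h1 c γ hc
  · intro τ hτ l
    have hl : l ∈ Submodule.span A (Set.range s) := by rw [hs]; trivial
    induction hl using Submodule.span_induction with
    | mem y hy =>
      obtain ⟨c, rfl⟩ := hy
      exact h2 c τ fun γ hγ => hτ γ (Finset.mem_biUnion.2 ⟨c, Finset.mem_univ _, hγ⟩)
    | zero => simp
    | add x y _ _ hx hy => simp [hx, hy]
    | smul a x _ hx => simp [hx]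

theorem Y_inj [IsNoetherianRing A] (hG : LR G) {i : ℤ} (hX : Module.Injective A (D.C i)) :
    Module.Injective A (D.Ysub G i) := by
  apply Module.Baer.injective
  intro I φ
  obtain ⟨Γ, h1, h2⟩ := D.Y_loc_fg G (IsNoetherian.noetherian I) φ
  obtain ⟨T, τ, h3, h4, h5⟩ := hG Γ h1
  have hB := Module.Baer.of_injective hX
  choose ψ hψ using fun t : J => hB I (Finsupp.lapply t ∘ₗ (D.Ysub G i).subtype ∘ₗ φ)
  refine ⟨∑ t ∈ T, LinearMap.codRestrict (D.Ysub G i) (D.mu (τ (Finsupp.single t 1)) ∘ₗ ψ t)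
    (fun a => D.mu_mem G (h3 _) _), fun x hx => ?_⟩
  apply Subtype.ext
  rw [← h2 τ h4, D.ex_eq_sum h5]
  rw [LinearMap.sum_apply, AddSubmonoidClass.coe_finsetSum]
  refine Finset.sum_congr rfl fun t _ => ?_
  change D.mu _ (ψ t x) = _
  rw [hψ t x hx]
  rfl

/-- The complex `Y`. -/
noncomputable def Y : Cplx A where
  X i := ModuleCat.of A (D.Ysub G i)
  d i j := ModuleCat.ofHom ((D.md i j).restrict fun _ h => D.md_mem G h)
  shape i j h := by
    refine ModuleCat.hom_ext (LinearMap.ext fun y => Subtype.ext ?_)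
    change D.md i j _ = 0
    ext t
    rw [md_apply, D.dd_shape (by simpa using h)]
    rfl
  d_comp_d' i j k _ _ := by
    refine ModuleCat.hom_ext (LinearMap.ext fun y => Subtype.ext ?_)
    exact D.md_md _

noncomputable def muY {g : J →₀ A} (hg : g ∈ G) : D.X ⟶ D.Y G where
  f i := ModuleCat.ofHom ((D.mu g).codRestrict (D.Ysub G i) (fun x => D.mu_mem G hg x))
  comm' i j _ := by
    refine ModuleCat.hom_ext (LinearMap.ext fun x => Subtype.ext ?_)
    exact D.md_mu g x

noncomputable def coY (t : J) : D.Y G ⟶ D.X where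
  f i := ModuleCat.ofHom (Finsupp.lapply t ∘ₗ (D.Ysub G i).subtype)
  comm' i j _ := by
    ext x
    rfl

theorem muY_coY {g : J →₀ A} (hg : g ∈ G) (t : J) : D.muY G hg ≫ D.coY G t = D.rho (g t) := by
  ext i x
  rfl

theorem rho_muY {g : J →₀ A} (hg : g ∈ G) (a : A) :
    D.rho a ≫ D.muY G hg = D.muY G (G.smul_mem a hg) := by
  refine HomologicalComplex.hom_ext _ _ fun i => ModuleCat.hom_ext (LinearMap.ext fun x => Subtype.ext ?_)
  exact (D.mu_smul a g x).symm

end XD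
end P7
end FPDaux

namespace FPDaux
section P8
open CochainComplex.HomComplex
variable {A}

/-- Properties of a dualizing complex that we use. -/
structure IsDz (D : XD A) (a b : ℤ) : Prop where
  lo : ∀ k, k < a → Subsingleton (D.C k)
  hi : ∀ k, b < k → Subsingleton (D.C k)
  inj : ∀ k, Module.Injective A (D.C k)
  finL : ∀ i, ∃ (k : ℕ) (h : Fin k → D.C i), (∀ l, D.dd i (i+1) (h l) = 0) ∧
    ∀ x, D.dd i (i+1) x = 0 → ∃ (c : Fin k → A) (y : D.C (i-1)),
      x = ∑ l, c l • h l + D.dd (i-1) i y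
  finR : ∀ i, ∃ (k : ℕ) (h : Fin k → D.C i), (∀ l, D.dd i (i+1) (h l) = 0) ∧
    ∀ x, D.dd i (i+1) x = 0 → ∃ (c : Fin k → A) (y : D.C (i-1)),
      x = ∑ l, D.r (c l) (h l) + D.dd (i-1) i y
  q1 : ∀ n : ℤ, n ≠ 0 → ∀ z : Cochain D.X D.X n, δ n (n + 1) z = 0 →
      ∃ w : Cochain D.X D.X (n - 1), δ (n - 1) n w = z
  q2 : ∀ z : Cochain D.X D.X 0, δ 0 1 z = 0 →
      ∃ (a : A) (w : Cochain D.X D.X (-1)), z = Cochain.ofHom (D.rho a) + δ (-1) 0 w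
  q3 : ∀ a : A, (∃ w : Cochain D.X D.X (-1), Cochain.ofHom (D.rho a) = δ (-1) 0 w) → a = 0

namespace XD
variable {D : XD A} {a b : ℤ}

theorem L_step [IsNoetherianRing A] (hD : IsDz D a b) (i : ℤ) (L' : Submodule A (D.C (i+1)))
    (hL' : L'.FG) : ∃ L : Submodule A (D.C i), L.FG ∧ (∀ x ∈ L, D.dd i (i+1) x ∈ L') ∧
      ∀ x, D.dd i (i+1) x ∈ L' → ∃ y : D.C (i-1), x - D.dd (i-1) i y ∈ L := by
  classical
  have hN : IsNoetherian A L' := isNoetherian_of_fg_of_noetherian L' hL'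
  have hfg : (L' ⊓ LinearMap.range (D.dd i (i+1))).FG := by
    exact (isNoetherian_submodule.1 hN) _ inf_le_left
  obtain ⟨k, s, hs⟩ := Submodule.fg_iff_exists_fin_generating_family.1 hfg
  have hs' : ∀ c, s c ∈ L' ⊓ LinearMap.range (D.dd i (i+1)) := fun c => by
    rw [← hs]; exact Submodule.subset_span ⟨c, rfl⟩
  choose t ht using fun c => (hs' c).2
  obtain ⟨m, h, h1, h2⟩ := hD.finL i
  refine ⟨Submodule.span A (Set.range h) ⊔ Submodule.span A (Set.range t), ?_, ?_, ?_⟩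
  · exact (Submodule.fg_span (Set.finite_range h)).sup (Submodule.fg_span (Set.finite_range t))
  · have : Submodule.span A (Set.range h) ⊔ Submodule.span A (Set.range t) ≤
        L'.comap (D.dd i (i+1)) := by
      refine sup_le (Submodule.span_le.2 ?_) (Submodule.span_le.2 ?_)
      · rintro _ ⟨l, rfl⟩
        change D.dd i (i+1) (h l) ∈ L'
        rw [h1]; exact zero_mem _
      · rintro _ ⟨l, rfl⟩
        change D.dd i (i+1) (t l) ∈ L'
        rw [ht]; exact (hs' l).1
    exact fun x hx => this hx
  · intro x hx
    have h3 : D.dd i (i+1) x ∈ Submodule.span A (Set.range s) := by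
      rw [hs]; exact ⟨hx, x, rfl⟩
    have h4 : Set.range s = D.dd i (i+1) '' Set.range t := by
      rw [← Set.range_comp]; congr 1; ext c; exact (ht c).symm
    rw [h4, Submodule.span_image] at h3
    obtain ⟨n, hn, hnx⟩ := h3
    obtain ⟨c, y, hy⟩ := h2 (x - n) (by rw [map_sub, hnx, sub_self])
    refine ⟨y, ?_⟩
    have : x - D.dd (i-1) i y = ∑ l, c l • h l + n := by
      rw [sub_eq_iff_eq_add] at hy ⊢
      rw [hy]; abel
    rw [this]
    exact add_mem (Submodule.mem_sup_left (Submodule.sum_mem _ fun l _ =>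
      Submodule.smul_mem _ _ (Submodule.subset_span ⟨l, rfl⟩))) (Submodule.mem_sup_right hn)

theorem exists_L [IsNoetherianRing A] (hD : IsDz D a b) :
    ∃ L : ∀ i, Submodule A (D.C i), (∀ i, (L i).FG) ∧ (∀ i j, ∀ x ∈ L i, D.dd i j x ∈ L j) ∧
      ∀ i x, D.dd i (i+1) x ∈ L (i+1) → ∃ y : D.C (i-1), x - D.dd (i-1) i y ∈ L i := by
  classical
  have key : ∀ N : ℕ, ∃ L : ∀ i, Submodule A (D.C i), (∀ i, (L i).FG) ∧
      (∀ i, ∀ x ∈ L i, D.dd i (i+1) x ∈ L (i+1)) ∧ (∀ i, i + N ≤ b → L i = ⊥) ∧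
      ∀ i, b < i + N → ∀ x, D.dd i (i+1) x ∈ L (i+1) →
        ∃ y : D.C (i-1), x - D.dd (i-1) i y ∈ L i := by
    intro N
    induction N with
    | zero =>
      refine ⟨fun i => ⊥, fun i => Submodule.fg_bot, ?_, fun _ _ => rfl, ?_⟩
      · intro i x hx
        rw [Submodule.mem_bot] at hx ⊢
        rw [hx, map_zero]
      · intro i hi x _
        have := hD.hi i (by simpa using hi)
        exact ⟨0, by rw [Subsingleton.elim x 0]; simp⟩
    | succ N ih =>
      obtain ⟨L, h1, h2, h3, h4⟩ := ih
      obtain ⟨L0, g1, g2, g3⟩ := L_step hD (b - N) (L (b - N + 1)) (h1 _)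
      have hne : ∀ i, i ≠ b - N → Function.update L (b - N) L0 i = L i := fun i hi =>
        Function.update_of_ne hi _ _
      have heq : Function.update L (b - N) L0 (b - N) = L0 := Function.update_self _ _ _
      refine ⟨Function.update L (b - N) L0, ?_, ?_, ?_, ?_⟩
      · intro i
        by_cases hi : i = b - N
        · subst hi; rw [heq]; exact g1
        · rw [hne i hi]; exact h1 i
      · intro i x hx
        by_cases hi : i = b - N
        · subst hi
          rw [heq] at hx
          rw [hne _ (by omega)]
          exact g2 x hx
        · rw [hne i hi] at hx
          by_cases hi2 : i + N ≤ b
          · rw [h3 i hi2, Submodule.mem_bot] at hx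
            rw [hx, map_zero]; exact zero_mem _
          · rw [hne _ (by omega)]
            exact h2 i x hx
      · intro i hi
        push_cast at hi
        rw [hne i (by omega)]
        exact h3 i (by omega)
      · intro i hi x hx
        push_cast at hi
        by_cases hi' : i = b - N
        · subst hi'
          rw [hne _ (by omega)] at hx
          rw [heq]
          exact g3 x hx
        · rw [hne i hi']
          rw [hne _ (by omega)] at hx
          exact h4 i (by omega) x hx
  obtain ⟨L, h1, h2, h3, h4⟩ := key (b - a + 1).toNat
  refine ⟨L, h1, ?_, ?_⟩
  · intro i j x hx
    by_cases h : i + 1 = j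
    · subst h; exact h2 i x hx
    · rw [D.dd_shape h]; exact zero_mem _
  · intro i x hx
    by_cases hi : i < a
    · have := hD.lo i hi
      exact ⟨0, by rw [Subsingleton.elim x 0]; simp⟩
    · exact h4 i (by omega) x hx

variable (D) in
/-- quotient complex -/
noncomputable def QC (L : ∀ i, Submodule A (D.C i)) (hL : ∀ i j, ∀ x ∈ L i, D.dd i j x ∈ L j) :
    Cplx A where
  X i := ModuleCat.of A (D.C i ⧸ L i)
  d i j := ModuleCat.ofHom ((L i).mapQ (L j) (D.dd i j) (hL i j))
  shape i j h := by
    refine ModuleCat.hom_ext (LinearMap.ext fun y => ?_)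
    obtain ⟨y, rfl⟩ := Submodule.Quotient.mk_surjective _ y
    change Submodule.Quotient.mk (D.dd i j y) = _
    rw [D.dd_shape (by simpa using h)]
    rfl
  d_comp_d' i j k _ _ := by
    refine ModuleCat.hom_ext (LinearMap.ext fun y => ?_)
    obtain ⟨y, rfl⟩ := Submodule.Quotient.mk_surjective _ y
    change Submodule.Quotient.mk (D.dd j k (D.dd i j y)) = _
    rw [dd_dd]
    rfl

variable (D) in
noncomputable def QCpi (L : ∀ i, Submodule A (D.C i))
    (hL : ∀ i j, ∀ x ∈ L i, D.dd i j x ∈ L j) : D.X ⟶ D.QC L hL where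
  f i := ModuleCat.ofHom (L i).mkQ
  comm' _ _ _ := rfl

/-- A cocycle vanishing on `L` is a coboundary. -/
theorem vanish_L {L : ∀ i, Submodule A (D.C i)} (hL : ∀ i j, ∀ x ∈ L i, D.dd i j x ∈ L j)
    (hL2 : ∀ i x, D.dd i (i+1) x ∈ L (i+1) → ∃ y : D.C (i-1), x - D.dd (i-1) i y ∈ L i)
    {Y : Cplx A} (hY : ∀ k, Module.Injective A (Y.X k)) (hb : ∀ k, b < k → Subsingleton (Y.X k))
    (ha : ∀ k, k < a → Subsingleton (Y.X k)) {n : ℤ} (z : Cochain D.X Y n)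
    (hz : δ n (n+1) z = 0) (hzL : ∀ p q h, ∀ x ∈ L p, z.v p q h x = 0) :
    ∃ w : Cochain D.X Y (n-1), δ (n-1) n w = z := by
  let z' : Cochain (D.QC L hL) Y n := Cochain.mk fun p q h =>
    ModuleCat.ofHom ((L p).liftQ (z.v p q h).hom (fun x hx => hzL p q h x hx))
  have hz' : (Cochain.ofHom (D.QCpi L hL)).comp z' (zero_add n) = z := by
    ext1 p q h
    rw [Cochain.zero_cochain_comp_v, Cochain.ofHom_v]
    rfl
  have hδ : δ n (n+1) z' = 0 := by
    ext1 p q h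
    refine ModuleCat.hom_ext (LinearMap.ext fun y => ?_)
    obtain ⟨y, rfl⟩ := Submodule.Quotient.mk_surjective _ y
    have h1 : (Cochain.ofHom (D.QCpi L hL)).comp (δ n (n+1) z') (zero_add _) = 0 := by
      rw [← δ_ofHom_comp, hz', hz]
    have h2 := Cochain.congr_v h1 p q h
    rw [Cochain.zero_cochain_comp_v, Cochain.ofHom_v] at h2
    exact LinearMap.congr_fun (congrArg ModuleCat.Hom.hom h2) y
  obtain ⟨w, hw⟩ := homotopy_lemma b hY hb a ha (fun q _ x hx => by
    obtain ⟨x, rfl⟩ := Submodule.Quotient.mk_surjective _ x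
    obtain ⟨y, hy⟩ := hL2 q x ((Submodule.Quotient.mk_eq_zero _).1 hx)
    refine ⟨Submodule.Quotient.mk y, ?_⟩
    exact ((Submodule.Quotient.eq _).2 hy).symm) z' hδ
  refine ⟨(Cochain.ofHom (D.QCpi L hL)).comp w (zero_add _), ?_⟩
  rw [δ_ofHom_comp, hw, hz']

variable {J : Type u} {G : Submodule A (J →₀ A)}

theorem Y_inj' [IsNoetherianRing A] (hD : IsDz D a b) (hG : LR G) (k : ℤ) :
    Module.Injective A ((D.Y G).X k) := D.Y_inj G hG (hD.inj k)

theorem Ysub_ss {k : ℤ} (h : Subsingleton (D.C k)) : Subsingleton ((D.Y G).X k) := by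
  refine ⟨fun x y => Subtype.ext (Finsupp.ext fun t => Subsingleton.elim _ _)⟩

theorem K2gen [IsNoetherianRing A] (hD : IsDz D a b) (hG : LR G) {n : ℤ}
    (z : Cochain D.X (D.Y G) n) (hz : δ n (n+1) z = 0) :
    ∃ (T : Finset J) (g : J → (J →₀ A)) (hg : ∀ t, g t ∈ G) (w : Cochain D.X (D.Y G) (n-1)),
      z = ∑ t ∈ T, (z.comp (Cochain.ofHom (D.coY G t)) (add_zero n)).comp
        (Cochain.ofHom (D.muY G (hg t))) (add_zero n) + δ (n-1) n w := by
  classical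
  obtain ⟨L, hL0, hL, hL2⟩ := exists_L hD
  choose Γ h1 h2 using fun p : ℤ => D.Y_loc_fg G (i := p + n) (hL0 p)
    ((z.v p (p+n) rfl).hom ∘ₗ (L p).subtype)
  obtain ⟨T, τ, h3, h4, h5⟩ := hG ((Finset.Icc a b).biUnion Γ) (by
    intro γ hγ
    obtain ⟨c, _, hc⟩ := Finset.mem_biUnion.1 hγ
    exact h1 c γ hc)
  let S : Cochain D.X (D.Y G) n := ∑ t ∈ T, (z.comp (Cochain.ofHom (D.coY G t)) (add_zero n)).comp
        (Cochain.ofHom (D.muY G (h3 (Finsupp.single t 1)))) (add_zero n)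
  have hS : ∀ p q h x, (S.v p q h x).1 = D.ex τ (z.v p q h x).1 := by
    intro p q h x
    rw [D.ex_eq_sum h5]
    have : S.v p q h = ∑ t ∈ T, ((z.comp (Cochain.ofHom (D.coY G t)) (add_zero n)).comp
        (Cochain.ofHom (D.muY G (h3 (Finsupp.single t 1)))) (add_zero n)).v p q h := by
      exact map_sum (AddMonoidHom.mk' (fun z : Cochain D.X (D.Y G) n => z.v p q h)
        (fun z w => Cochain.add_v z w p q h)) _ _
    rw [this]
    have e : ∀ (f : J → (D.X.X p ⟶ (D.Y G).X q)), ((∑ t ∈ T, f t) x : D.Ysub G q).1 =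
        ∑ t ∈ T, (f t x : D.Ysub G q).1 := fun f =>
      map_sum (AddMonoidHom.mk' (fun f : D.X.X p ⟶ (D.Y G).X q => (f x : D.Ysub G q).1)
        (fun _ _ => rfl)) _ _
    refine (e _).trans (Finset.sum_congr rfl fun t _ => ?_)
    rw [Cochain.comp_zero_cochain_v, Cochain.comp_zero_cochain_v, Cochain.ofHom_v, Cochain.ofHom_v]
    rfl
  have hδS : δ n (n+1) S = 0 := by
    have : δ n (n+1) S = ∑ t ∈ T, δ n (n+1) ((z.comp (Cochain.ofHom (D.coY G t)) (add_zero n)).comp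
        (Cochain.ofHom (D.muY G (h3 (Finsupp.single t 1)))) (add_zero n)) :=
      map_sum (AddMonoidHom.mk' (fun z : Cochain D.X (D.Y G) n => δ n (n+1) z)
        (fun z w => δ_add _ _ z w)) _ _
    rw [this]
    refine Finset.sum_eq_zero fun t _ => ?_
    rw [δ_comp_ofHom, δ_comp_ofHom, hz]
    simp
  obtain ⟨w, hw⟩ := vanish_L hL hL2 (Y_inj' hD hG) (fun k hk => Ysub_ss (hD.hi k hk))
    (fun k hk => Ysub_ss (hD.lo k hk)) (z - S) (by rw [δ_sub, hz, hδS, sub_zero]) (by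
      intro p q h x hx
      subst h
      rw [Cochain.sub_v]
      by_cases hp : p ∈ Finset.Icc a b
      · have := h2 p τ (fun γ hγ => h4 γ (Finset.mem_biUnion.2 ⟨p, hp, hγ⟩)) ⟨x, hx⟩
        refine sub_eq_zero.2 (Subtype.ext ?_)
        exact this.symm.trans (hS p _ rfl x).symm
      · have : Subsingleton (D.C p) := by
          rw [Finset.mem_Icc] at hp
          by_cases hpa : p < a
          · exact hD.lo p hpa
          · exact hD.hi p (by omega)
        rw [Subsingleton.elim x 0]
        exact map_zero _)
  exact ⟨T, fun t => τ (Finsupp.single t 1), fun t => h3 _, w, by rw [hw]; abel⟩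

theorem K2ne [IsNoetherianRing A] (hD : IsDz D a b) (hG : LR G) {n : ℤ} (hn : n ≠ 0)
    (z : Cochain D.X (D.Y G) n) (hz : δ n (n+1) z = 0) :
    ∃ w : Cochain D.X (D.Y G) (n-1), δ (n-1) n w = z := by
  obtain ⟨T, g, hg, w, hw⟩ := K2gen hD hG z hz
  rw [hw]
  have main : ∃ w : Cochain D.X (D.Y G) (n-1), δ (n-1) n w =
      ∑ t ∈ T, (z.comp (Cochain.ofHom (D.coY G t)) (add_zero n)).comp
        (Cochain.ofHom (D.muY G (hg t))) (add_zero n) := by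
    refine Finset.sum_induction _ (fun z => ∃ w : Cochain D.X (D.Y G) (n-1), δ (n-1) n w = z)
      ?_ ⟨0, δ_zero _ _⟩ ?_
    · rintro _ _ ⟨w, rfl⟩ ⟨w', rfl⟩
      exact ⟨w + w', δ_add _ _ _ _⟩
    · intro t _
      obtain ⟨w, hw⟩ := hD.q1 n hn (z.comp (Cochain.ofHom (D.coY G t)) (add_zero n)) (by
        rw [δ_comp_ofHom, hz]; simp)
      refine ⟨w.comp (Cochain.ofHom (D.muY G (hg t))) (add_zero _), ?_⟩
      rw [δ_comp_ofHom, hw]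
  obtain ⟨w', hw'⟩ := main
  exact ⟨w' + w, by rw [δ_add, hw']⟩

theorem muY_add {g g' : J →₀ A} (hg : g ∈ G) (hg' : g' ∈ G) :
    D.muY G (add_mem hg hg') = D.muY G hg + D.muY G hg' := by
  refine HomologicalComplex.hom_ext _ _ fun i =>
    ModuleCat.hom_ext (LinearMap.ext fun x => Subtype.ext ?_)
  exact D.mu_add g g' x

theorem K2zero [IsNoetherianRing A] (hD : IsDz D a b) (hG : LR G)
    (z : Cochain D.X (D.Y G) 0) (hz : δ 0 1 z = 0) :
    ∃ (g : J →₀ A) (hg : g ∈ G) (w : Cochain D.X (D.Y G) (-1)),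
      z = Cochain.ofHom (D.muY G hg) + δ (-1) 0 w := by
  obtain ⟨T, g, hg, w, hw⟩ := K2gen hD hG z hz
  rw [hw]
  have hz0 : Cochain.ofHom (D.muY G (zero_mem G)) = 0 := by
    have : D.muY G (zero_mem G) = 0 := by
      refine HomologicalComplex.hom_ext _ _ fun i =>
        ModuleCat.hom_ext (LinearMap.ext fun x => Subtype.ext ?_)
      exact D.mu_zero x
    rw [this, Cochain.ofHom_zero]
  have hadd : ∀ {z z' : Cochain D.X (D.Y G) 0}, (∃ (g : J →₀ A) (hg : g ∈ G)
      (w : Cochain D.X (D.Y G) (-1)), z = Cochain.ofHom (D.muY G hg) + δ (-1) 0 w) →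
      (∃ (g : J →₀ A) (hg : g ∈ G)
      (w : Cochain D.X (D.Y G) (-1)), z' = Cochain.ofHom (D.muY G hg) + δ (-1) 0 w) →
      (∃ (g : J →₀ A) (hg : g ∈ G)
      (w : Cochain D.X (D.Y G) (-1)), z + z' = Cochain.ofHom (D.muY G hg) + δ (-1) 0 w) := by
    rintro _ _ ⟨g, hg, w, rfl⟩ ⟨g', hg', w', rfl⟩
    refine ⟨g + g', add_mem hg hg', w + w', ?_⟩
    rw [muY_add hg hg', Cochain.ofHom_add, δ_add]
    abel
  refine hadd ?_ ⟨0, zero_mem _, w, by rw [hz0, zero_add]; rfl⟩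
  refine Finset.sum_induction _ (fun z => ∃ (g : J →₀ A) (hg : g ∈ G)
      (w : Cochain D.X (D.Y G) (-1)), z = Cochain.ofHom (D.muY G hg) + δ (-1) 0 w)
      (fun _ _ => hadd) ⟨0, zero_mem _, 0, by rw [hz0, δ_zero, zero_add]⟩ ?_
  intro t _
  obtain ⟨c, w, hw⟩ := hD.q2 (z.comp (Cochain.ofHom (D.coY G t)) (add_zero 0)) (by
    rw [δ_comp_ofHom, hz]; simp)
  refine ⟨c • g t, G.smul_mem c (hg t), w.comp (Cochain.ofHom (D.muY G (hg t))) (add_zero _), ?_⟩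
  rw [hw, Cochain.add_comp, ← Cochain.ofHom_comp, rho_muY, δ_comp_ofHom]

theorem K2inj (hD : IsDz D a b) {g : J →₀ A} (hg : g ∈ G)
    (h : ∃ w : Cochain D.X (D.Y G) (-1), Cochain.ofHom (D.muY G hg) = δ (-1) 0 w) : g = 0 := by
  obtain ⟨w, hw⟩ := h
  ext t
  refine hD.q3 (g t) ⟨w.comp (Cochain.ofHom (D.coY G t)) (add_zero _), ?_⟩
  rw [δ_comp_ofHom, ← hw, ← Cochain.ofHom_comp, muY_coY]

end XD
end P8
end FPDaux

namespace FPDaux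
section P9
open CochainComplex.HomComplex

/-- A free resolution. -/
structure Res where
  J : ℕ → Type u
  W : ℕ → ModuleCat.{u} A
  e : ∀ m, (J m →₀ A) →ₗ[A] W m
  k : ∀ m, W (m+1) →ₗ[A] (J m →₀ A)
  e_surj : ∀ m, Function.Surjective (e m)
  k_inj : ∀ m, Function.Injective (k m)
  ek : ∀ m, Function.Exact (k m) (e m)

variable {A}

namespace Res
variable (F : Res A)

noncomputable def dl (m : ℕ) : (F.J (m+1) →₀ A) →ₗ[A] (F.J m →₀ A) := F.k m ∘ₗ F.e (m+1)

theorem e_dl (m : ℕ) (x) : F.e m (F.dl m x) = 0 := (F.ek m _).2 ⟨_, rfl⟩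

theorem dl_dl (m : ℕ) (x) : F.dl m (F.dl (m+1) x) = 0 := by
  change F.k m (F.e (m+1) (F.dl (m+1) x)) = 0
  rw [e_dl, map_zero]

theorem exists_of_e {m : ℕ} {x} (h : F.e m x = 0) : ∃ y, F.dl m y = x := by
  obtain ⟨w, rfl⟩ := (F.ek m _).1 h
  obtain ⟨y, rfl⟩ := F.e_surj (m+1) w
  exact ⟨y, rfl⟩

theorem exists_of_dl {m : ℕ} {x} (h : F.dl m x = 0) : ∃ y, F.dl (m+1) y = x := by
  apply F.exists_of_e
  apply F.k_inj m
  rw [map_zero]; exact h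

end Res

theorem fs_lift {J α β : Type*} [Zero α] [Zero β] (F : α → β) (h0 : F 0 = 0) (y : J → β)
    (s : Finset J) (hs : ∀ t ∉ s, y t = 0) (h : ∀ t, ∃ x, F x = y t) :
    ∃ x : J →₀ α, ∀ t, F (x t) = y t := by
  classical
  choose f hf using h
  refine ⟨Finsupp.onFinset s (fun t => if t ∈ s then f t else 0) (fun t ht => by
    by_contra h; exact ht (if_neg h)), fun t => ?_⟩
  rw [Finsupp.onFinset_apply]
  split_ifs with ht
  · exact hf t
  · rw [h0, hs t ht]

def RelAt (D : XD A) (i : ℤ) {k m : ℕ} (B : Matrix (Fin k) (Fin m) A) : Prop :=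
  ∃ (h : Fin k → D.C i) (β : Fin m → D.C (i-1)), (∀ l, D.dd i (i+1) (h l) = 0) ∧
    (∀ x, D.dd i (i+1) x = 0 → ∃ (c : Fin k → A) (y : D.C (i-1)),
      x = ∑ l, D.r (c l) (h l) + D.dd (i-1) i y) ∧
    (∀ c, ∑ l, D.r (B l c) (h l) = D.dd (i-1) i (β c)) ∧
    ∀ y : Fin k → A, (∃ w, ∑ l, D.r (y l) (h l) = D.dd (i-1) i w) → ∃ t, y = act B t

theorem exists_RelAt {D : XD A} {a b : ℤ} (hA : IsNoetherianRing Aᵐᵒᵖ) (hD : IsDz D a b) (i : ℤ) :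
    ∃ (k m : ℕ) (B : Matrix (Fin k) (Fin m) A), RelAt D i B := by
  obtain ⟨k, h, h1, h2⟩ := hD.finR i
  let S : Submodule Aᵐᵒᵖ (Fin k → A) :=
    { carrier := {y | ∃ w, ∑ l, D.r (y l) (h l) = D.dd (i-1) i w}
      zero_mem' := ⟨0, by simp [XD.r_zero]⟩
      add_mem' := by
        rintro y y' ⟨w, hw⟩ ⟨w', hw'⟩
        exact ⟨w + w', by simp [XD.r_add, Finset.sum_add_distrib, hw, hw']⟩
      smul_mem' := by
        rintro c y ⟨w, hw⟩
        refine ⟨D.r c.unop w, ?_⟩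
        rw [← XD.r_d, ← hw, map_sum]
        refine Finset.sum_congr rfl fun l _ => ?_
        rw [← XD.r_mul]; rfl }
  obtain ⟨m, B, hB1, hB2⟩ := span_fin_op hA S
  choose β hβ using hB1
  exact ⟨k, m, B, h, β, h1, h2, hβ, fun y hy => hB2 y hy⟩

namespace XD
variable {D : XD A} {a b : ℤ}

theorem r_sum {ι : Type*} (s : Finset ι) (f : ι → A) {i : ℤ} (x : D.C i) :
    D.r (∑ j ∈ s, f j) x = ∑ j ∈ s, D.r (f j) x :=
  map_sum (AddMonoidHom.mk' (fun c => D.r c x) (fun c c' => D.r_add c c' x)) f s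

theorem mu_sum {J : Type u} {ι : Type*} (s : Finset ι) (f : ι → (J →₀ A)) {i : ℤ} (x : D.C i) :
    D.mu (∑ j ∈ s, f j) x = ∑ j ∈ s, D.mu (f j) x :=
  map_sum (AddMonoidHom.mk' (fun c => D.mu c x) (fun c c' => D.mu_add c c' x)) f s

theorem lemE (F : Res A) (i : ℤ) {k n : ℕ} {B : Matrix (Fin k) (Fin n) A} (hB : RelAt D i B) (m : ℕ)
    (hV : V0 B (F.W m)) (y : F.J (m+1) →₀ D.C i) (hy : D.md i (i+1) y = 0)
    (y' : F.J m →₀ D.C (i-1)) (hy' : D.ex (F.dl m) y = D.md (i-1) i y') :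
    ∃ (x : F.J (m+2) →₀ D.C i) (w : F.J (m+1) →₀ D.C (i-1)), D.md i (i+1) x = 0 ∧
      y = D.ex (F.dl (m+1)) x + D.md (i-1) i w := by
  classical
  obtain ⟨h, β, h1, h2, h3, h4⟩ := hB
  obtain ⟨s, hs⟩ := fs_lift (fun p : (Fin k → A) × D.C (i-1) =>
    ∑ l, D.r (p.1 l) (h l) + D.dd (i-1) i p.2) (by simp [r_zero]) y y.support
    (fun t ht => Finsupp.notMem_support_iff.1 ht) (fun t => by
      obtain ⟨c, z, hz⟩ := h2 (y t) (by rw [← md_apply, hy]; rfl)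
      exact ⟨(c, z), hz.symm⟩)
  let u : Fin k → (F.J (m+1) →₀ A) := fun l => s.mapRange (fun p => p.1 l) rfl
  let w0 : F.J (m+1) →₀ D.C (i-1) := s.mapRange (fun p => p.2) rfl
  have hyu : y = ∑ l, D.mu (u l) (h l) + D.md (i-1) i w0 := by
    ext t
    rw [← hs t, Finsupp.add_apply, Finsupp.finsetSum_apply]
    rfl
  -- second step
  have hr : ∀ t, ∃ w, ∑ l, D.r (F.dl m (u l) t) (h l) = D.dd (i-1) i w := by
    intro t
    rw [hyu, map_add, map_sum] at hy'
    simp only [ex_mu, ← md_ex] at hy'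
    have := DFunLike.congr_fun hy' t
    rw [Finsupp.add_apply, Finsupp.finsetSum_apply, md_apply, md_apply] at this
    refine ⟨y' t - D.ex (F.dl m) w0 t, ?_⟩
    rw [map_sub, ← this]
    simp only [mu_apply]
    abel
  obtain ⟨vv, hvv⟩ := fs_lift (fun p : Fin n → A => act B p) (map_zero _)
    (fun t l => F.dl m (u l) t)
    (Finset.univ.biUnion fun l => (F.dl m (u l)).support) (fun t ht => by
      ext l
      by_contra hne
      exact ht (Finset.mem_biUnion.2 ⟨l, Finset.mem_univ _, Finsupp.mem_support_iff.2 hne⟩))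
    (fun t => by
      obtain ⟨p, hp⟩ := h4 _ (hr t)
      exact ⟨p, hp.symm⟩)
  let v : Fin n → (F.J m →₀ A) := fun c => vv.mapRange (fun p => p c) rfl
  have hv : act B v = fun l => F.dl m (u l) := by
    ext l t
    rw [act_apply, Finsupp.finsetSum_apply]
    exact congrFun (hvv t) l
  obtain ⟨N, C, z, hBC, hz⟩ := hV (fun c => F.e m (v c)) (by
    rw [act_map, hv]
    ext l
    exact F.e_dl m _)
  choose ζ hζ using fun c => F.e_surj m (z c)
  have hev : ∀ c, F.e m (v c - act C ζ c) = 0 := by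
    intro c
    rw [map_sub]
    have e1 : F.e m (v c) = act C z c := congrFun hz c
    have e2 : act C z c = F.e m (act C ζ c) := by
      have := congrFun (act_map C ζ (F.e m)) c
      rw [← this]
      have e5 : z = fun j => F.e m (ζ j) := funext fun j => (hζ j).symm
      rw [e5]
    rw [e1, e2, sub_self]
  choose u' hu' using fun c => F.exists_of_e (hev c)
  have hdu : ∀ l, F.dl m (u l) = F.dl m (act B u' l) := by
    intro l
    have e1 : F.dl m (act B u' l) = act B (fun c => F.dl m (u' c)) l :=
      (congrFun (act_map B u' (F.dl m)) l).symm
    have e2 : (fun c => F.dl m (u' c)) = v - act C ζ := by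
      ext1 c; exact hu' c
    rw [e1, e2, map_sub, mul_zero_act hBC, sub_zero, hv]
  choose x' hx' using fun l => F.exists_of_dl (m := m) (x := u l - act B u' l)
    (by rw [map_sub, hdu, sub_self])
  refine ⟨∑ l, D.mu (x' l) (h l), ∑ c, D.mu (u' c) (β c) + w0, ?_, ?_⟩
  · rw [map_sum]
    refine Finset.sum_eq_zero fun l _ => ?_
    rw [md_mu, h1, map_zero]
  · rw [map_sum, map_add, map_sum]
    simp only [ex_mu, md_mu, hx']
    have e3 : ∑ c, D.mu (u' c) (D.dd (i-1) i (β c)) = ∑ l, D.mu (act B u' l) (h l) := by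
      simp only [← h3, map_sum, act_apply, mu_sum, mu_smul]
      exact Finset.sum_comm
    have e4 : ∀ l, D.mu (u l) (h l) = D.mu (u l - act B u' l) (h l) + D.mu (act B u' l) (h l) := by
      intro l
      rw [← mu_add, sub_add_cancel]
    rw [hyu, e3, ← add_assoc, ← Finset.sum_add_distrib]
    congr 1
    exact Finset.sum_congr rfl fun l _ => e4 l

end XD
end P9
end FPDaux

namespace FPDaux
section P10
open CochainComplex.HomComplex
variable {A}
namespace XD
variable (D : XD A) (F : Res A)

abbrev SI (q : ℤ) : Type := {p : ℕ × ℤ // p.2 = q + p.1}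

abbrev Sc {q : ℤ} (p : SI q) : Type u := F.J p.1.1 →₀ D.C p.1.2

abbrev S (q : ℤ) : Type u := ∀ p : SI q, D.Sc F p

noncomputable def SD {q q' : ℤ} (h : q + 1 = q') : D.S F q →ₗ[A] D.S F q' :=
  LinearMap.pi fun p =>
    ((-1 : ℤ) ^ p.1.1) • (D.md (J := F.J p.1.1) (p.1.2 - 1) p.1.2 ∘ₗ
      LinearMap.proj (φ := fun p : SI q => D.Sc F p)
        (⟨(p.1.1, p.1.2 - 1), by have := p.2; simp only; omega⟩ : SI q)) +
    D.ex (F.dl p.1.1) ∘ₗ LinearMap.proj (φ := fun p : SI q => D.Sc F p)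
        (⟨(p.1.1 + 1, p.1.2), by have := p.2; push_cast; omega⟩ : SI q)

theorem SD_apply {q q' : ℤ} (h : q + 1 = q') (s : D.S F q) (m : ℕ) (i : ℤ) (hp : i = q' + m)
    (h1 : i - 1 = q + m) (h2 : i = q + (m + 1 : ℕ)) :
    D.SD F h s ⟨(m, i), hp⟩ = ((-1 : ℤ) ^ m) • D.md (i-1) i (s ⟨(m, i-1), h1⟩) +
      D.ex (F.dl m) (s ⟨(m+1, i), h2⟩) := rfl

theorem SD_SD {q q' q'' : ℤ} (h : q + 1 = q') (h' : q' + 1 = q'') (s : D.S F q) :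
    D.SD F h' (D.SD F h s) = 0 := by
  funext p
  obtain ⟨⟨m, i⟩, hp⟩ := p
  simp only at hp
  rw [SD_apply D F h' _ m i hp (by omega) (by push_cast; omega),
    SD_apply D F h _ m (i-1) _ (by omega) (by push_cast; omega),
    SD_apply D F h _ (m+1) i _ (by push_cast; omega) (by push_cast; omega)]
  rw [map_add, map_add, map_zsmul, map_zsmul, md_md, ex_ex, md_ex]
  have : F.dl m ∘ₗ F.dl (m+1) = 0 := LinearMap.ext fun x => F.dl_dl m x
  rw [this, ex_zero, pow_succ]
  simp

/-- The total complex. -/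
noncomputable def SX : Cplx A where
  X q := ModuleCat.of A (D.S F q)
  d q q' := if h : q + 1 = q' then ModuleCat.ofHom (D.SD F h) else 0
  shape q q' h := by
    rw [dif_neg]; simpa using h
  d_comp_d' q q' q'' h h' := by
    have h : q + 1 = q' := h
    have h' : q' + 1 = q'' := h'
    rw [dif_pos h, dif_pos h']
    exact ModuleCat.hom_ext (LinearMap.ext fun s => D.SD_SD F h h' s)

theorem SX_d {q q' : ℤ} (h : q + 1 = q') : (D.SX F).d q q' = ModuleCat.ofHom (D.SD F h) :=
  dif_pos h

open Classical in
noncomputable def sg {q : ℤ} (m : ℕ) (i : ℤ) (h : i = q + m) : (F.J m →₀ D.C i) →ₗ[A] D.S F q :=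
  LinearMap.single A (fun p : SI q => D.Sc F p) ⟨(m, i), h⟩

theorem sg_same {q : ℤ} {m : ℕ} {i : ℤ} (h : i = q + m) (h' : i = q + m) (y) :
    D.sg F m i h y ⟨(m, i), h'⟩ = y := by
  simp [sg]

theorem sg_ne {q : ℤ} {m m' : ℕ} {i i' : ℤ} (h : i = q + m) (h' : i' = q + m') (hm : m' ≠ m) (y) :
    D.sg F m i h y ⟨(m', i'), h'⟩ = 0 := by
  simp only [sg, LinearMap.coe_single]
  exact Pi.single_eq_of_ne (fun hh => hm (congrArg (fun p => p.1.1) hh)) _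

theorem S_add_apply {q : ℤ} (s t : D.S F q) (p : SI q) : (s + t) p = s p + t p := rfl

variable {D F}

theorem S_exact {a b : ℤ} (hD : IsDz D a b)
    (hV : ∀ i, a ≤ i → i ≤ b → ∃ (k n : ℕ) (B : Matrix (Fin k) (Fin n) A), RelAt D i B ∧
      ∀ m, V0 B (F.W m)) {q' q q'' : ℤ} (h' : q' + 1 = q) (h'' : q + 1 = q'') (hq : q < a)
    (s : D.S F q) (hs : D.SD F h'' s = 0) : ∃ t, D.SD F h' t = s := by
  have key : ∀ N : ℕ, ∀ s : D.S F q, D.SD F h'' s = 0 →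
      (∀ m i h, N ≤ m → s ⟨(m, i), h⟩ = 0) → ∃ t, D.SD F h' t = s := by
    intro N
    induction N with
    | zero =>
      intro s _ h0
      refine ⟨0, ?_⟩
      rw [map_zero]
      funext p
      exact (h0 p.1.1 p.1.2 p.2 (Nat.zero_le _)).symm
    | succ N ih =>
      intro s hs h0
      by_cases hi : q + N < a ∨ b < q + N
      · refine ih s hs fun m i h hm => ?_
        by_cases hmN : m = N
        · subst hmN
          have : Subsingleton (D.C i) := by
            rcases hi with hi | hi
            · exact hD.lo i (by omega)
            · exact hD.hi i (by omega)
          exact Finsupp.ext fun t => Subsingleton.elim _ _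
        · exact h0 m i h (by omega)
      · push Not at hi
        obtain ⟨N, rfl⟩ : ∃ N', N = N' + 1 := ⟨N - 1, by omega⟩
        obtain ⟨k, n, B, hB, hBV⟩ := hV _ hi.1 hi.2
        obtain ⟨i, hi0⟩ : ∃ i, i = q + (N + 1 : ℕ) := ⟨_, rfl⟩
        rw [← hi0] at hB
        have e1 := congrFun hs ⟨(N + 1, i + 1), by push_cast at hi0 ⊢; omega⟩
        rw [SD_apply D F h'' s (N+1) (i+1) _ (by push_cast at hi0 ⊢; omega)
          (by push_cast at hi0 ⊢; omega), h0 (N+1+1) _ _ (by omega), map_zero, add_zero] at e1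
        have e2 := congrFun hs ⟨(N, i), by push_cast at hi0 ⊢; omega⟩
        rw [SD_apply D F h'' s N i _ (by push_cast at hi0 ⊢; omega)
          (by push_cast at hi0 ⊢; omega)] at e2
        have e1' : D.md i (i+1) (s ⟨(N+1, i), hi0⟩) = 0 := by
          have gen : ∀ (j : ℤ) (hj : j = i) (hj' : j = q + (N+1 : ℕ)),
              D.md j (i+1) (s ⟨(N+1, j), hj'⟩) = 0 → D.md i (i+1) (s ⟨(N+1, i), hi0⟩) = 0 := by
            rintro j rfl hj' h; exact h
          refine gen (i+1-1) (by omega) (by omega) ?_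
          have e3 := congrArg (fun x => ((-1 : ℤ) ^ (N+1)) • x) e1
          simp only [smul_smul, ← mul_pow] at e3
          simpa using e3
        obtain ⟨x, w, hx, hw⟩ := lemE F i hB N (hBV N) (s ⟨(N+1, i), hi0⟩) e1'
          (-((-1 : ℤ) ^ N) • (s ⟨(N, i-1), by push_cast at hi0 ⊢; omega⟩)) (by
            rw [map_zsmul, neg_smul]
            exact eq_neg_of_add_eq_zero_right e2)
        obtain ⟨t, ht⟩ : ∃ t : D.S F q', t = D.sg F (N+2) i (by push_cast at hi0 ⊢; omega) x +
          D.sg F (N+1) (i-1) (by push_cast at hi0 ⊢; omega) (((-1 : ℤ) ^ (N+1)) • w) := ⟨_, rfl⟩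
        obtain ⟨t', ht'⟩ := ih (s - D.SD F h' t) (by rw [map_sub, hs, SD_SD, sub_zero]) (by
          intro m j h hm
          change s ⟨(m, j), h⟩ - D.SD F h' t ⟨(m, j), h⟩ = 0
          rw [SD_apply D F h' t m j h (by omega) (by push_cast; omega), ht, S_add_apply,
            S_add_apply]
          by_cases h1 : m = N + 1
          · subst h1
            obtain rfl : j = i := by omega
            rw [sg_same, sg_same, sg_ne D F _ _ (by omega), sg_ne D F _ _ (by omega), zero_add,
              add_zero, map_zsmul, smul_smul, ← mul_pow]
            simp only [mul_neg, mul_one, neg_neg, one_pow, one_smul]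
            rw [hw]
            abel
          · rw [h0 m j h (by omega)]
            by_cases h2 : m = N + 2
            · subst h2
              obtain rfl : i = j - 1 := by push_cast at hi0 h; omega
              rw [sg_same, sg_ne D F _ _ (by omega), sg_ne D F _ _ (by omega),
                sg_ne D F _ _ (by omega), add_zero, add_zero]
              have : D.md (j-1) j x = 0 := by
                have gen : ∀ (j' : ℤ), j' = j - 1 + 1 → D.md (j-1) j' x = 0 := by
                  rintro _ rfl; exact hx
                exact gen j (by omega)
              rw [this]
              simp
            · rw [sg_ne D F _ _ (by omega), sg_ne D F _ _ (by omega),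
                sg_ne D F _ _ (by omega), sg_ne D F _ _ (by omega)]
              simp)
        exact ⟨t' + t, by rw [map_add, ht']; abel⟩
  refine key (b - q + 1).toNat s hs fun m i h hm => ?_
  have := hD.hi i (by omega)
  exact Finsupp.ext fun t => Subsingleton.elim _ _

theorem SD_sg_succ {q q' : ℤ} (h : q + 1 = q') (m : ℕ) (k k' : ℤ) (hk : k + 1 = k')
    (h1 : k = q + (m+1 : ℕ)) (h2 : k = q' + m) (h3 : k' = q' + (m+1 : ℕ)) (y) :
    D.SD F h (D.sg F (m+1) k h1 y) = D.sg F m k h2 (D.ex (F.dl m) y) +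
      D.sg F (m+1) k' h3 (((-1 : ℤ) ^ (m+1)) • D.md k k' y) := by
  funext p
  obtain ⟨⟨m', i⟩, hp⟩ := p
  simp only at hp
  rw [SD_apply D F h _ m' i hp (by omega) (by push_cast; omega), S_add_apply]
  by_cases hm : m' = m
  · subst hm
    obtain rfl : i = k := by omega
    rw [sg_same, sg_same, sg_ne D F _ _ (by omega), sg_ne D F _ _ (by omega)]
    simp
  · by_cases hm : m' = m + 1
    · subst hm
      obtain rfl : i = k' := by omega
      obtain rfl : k = i - 1 := by omega
      rw [sg_same, sg_same, sg_ne D F _ _ (by omega), sg_ne D F _ _ (by omega)]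
      simp
    · rw [sg_ne D F _ _ (by omega), sg_ne D F _ _ (by omega),
        sg_ne D F _ _ (by omega), sg_ne D F _ _ (by omega)]
      simp

theorem SD_sg_zero {q q' : ℤ} (h : q + 1 = q') (k k' : ℤ) (hk : k + 1 = k')
    (h1 : k = q + (0 : ℕ)) (h3 : k' = q' + (0 : ℕ)) (y) :
    D.SD F h (D.sg F 0 k h1 y) = D.sg F 0 k' h3 (D.md k k' y) := by
  funext p
  obtain ⟨⟨m', i⟩, hp⟩ := p
  simp only at hp
  rw [SD_apply D F h _ m' i hp (by omega) (by push_cast; omega)]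
  by_cases hm : m' = 0
  · subst hm
    obtain rfl : i = k' := by omega
    obtain rfl : k = i - 1 := by omega
    rw [sg_same, sg_same, sg_ne D F _ _ (by omega)]
    simp
  · rw [sg_ne D F _ _ (by omega), sg_ne D F _ _ (by omega), sg_ne D F _ _ (by omega)]
    simp

variable (D F)

noncomputable def io (m : ℕ) (p : F.J m →₀ A) (n : ℤ) (hn : n = -m) : Cochain D.X (D.SX F) n :=
  Cochain.mk fun k q h => ModuleCat.ofHom (D.sg F (q := q) m k (by omega) ∘ₗ D.mu p)

theorem io_v (m : ℕ) (p : F.J m →₀ A) (n : ℤ) (hn : n = -m) (k q h) (x : D.C k) :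
    (D.io F m p n hn).v k q h x = D.sg F (q := q) m k (by omega) (D.mu p x) := rfl

theorem δ_io_succ (m : ℕ) (p : F.J (m+1) →₀ A) (n n' : ℤ) (hn : n = -(m+1 : ℕ)) (hn' : n' = -m) :
    δ n n' (D.io F (m+1) p n hn) = D.io F m (F.dl m p) n' hn' := by
  ext1 k q h
  rw [δ_v n n' (by push_cast at hn; omega) _ k q h (q-1) (k+1) rfl rfl,
    SX_d D F (show q - 1 + 1 = q by omega)]
  refine ModuleCat.hom_ext (LinearMap.ext fun x => ?_)
  have : n'.negOnePow = (-1) ^ m := by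
    rw [hn', Int.negOnePow_neg]; rfl
  rw [this]
  have hq : q - 1 + 1 = q := by omega
  have a1 : k = q - 1 + (m+1 : ℕ) := by push_cast; omega
  have a2 : k + 1 = q + (m+1 : ℕ) := by push_cast; omega
  have a3 : k = q + m := by omega
  change D.SD F hq (D.sg F (m+1) k a1 (D.mu p x)) +
    (((-1) ^ m : ℤˣ) : ℤ) • (D.sg F (m+1) (k+1) a2 (D.mu p (D.dd k (k+1) x))) =
    D.sg F m k a3 (D.mu (F.dl m p) x)
  rw [SD_sg_succ _ m k (k+1) rfl _ a3 a2, ex_mu, md_mu, map_zsmul,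
    add_assoc, ← add_smul]
  have : (-1 : ℤ) ^ (m+1) + (((-1) ^ m : ℤˣ) : ℤ) = 0 := by
    push_cast; ring
  rw [this, zero_smul, add_zero]

theorem δ_io_zero (p : F.J 0 →₀ A) (n n' : ℤ) (hn : n = -(0 : ℕ)) (hn' : n' = 1) :
    δ n n' (D.io F 0 p n hn) = 0 := by
  ext1 k q h
  rw [δ_v n n' (by push_cast at hn; omega) _ k q h (q-1) (k+1) rfl rfl,
    SX_d D F (show q - 1 + 1 = q by omega)]
  refine ModuleCat.hom_ext (LinearMap.ext fun x => ?_)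
  have : n'.negOnePow = -1 := by
    rw [hn']; rfl
  rw [this]
  have hq : q - 1 + 1 = q := by omega
  have a1 : k = q - 1 + (0 : ℕ) := by push_cast; omega
  have a2 : k + 1 = q + (0 : ℕ) := by push_cast; omega
  change D.SD F hq (D.sg F 0 k a1 (D.mu p x)) +
    ((-1 : ℤˣ) : ℤ) • (D.sg F 0 (k+1) a2 (D.mu p (D.dd k (k+1) x))) = 0
  rw [SD_sg_zero _ k (k+1) rfl _ a2, md_mu]
  simp

variable {D F}
variable {J : Type u} {G : Submodule A (J →₀ A)}

noncomputable def z0 (n : ℕ) (f : (F.J n →₀ A) →ₗ[A] (J →₀ A)) (hf : ∀ x, f x ∈ G) :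
    Cochain (D.SX F) (D.Y G) n :=
  Cochain.mk fun q k h => ModuleCat.ofHom (LinearMap.codRestrict (D.Ysub G k)
    (D.ex f ∘ₗ LinearMap.proj (φ := fun p : SI q => D.Sc F p) (⟨(n, k), h.symm⟩ : SI q))
    (fun _ => D.ex_mem G hf _))

theorem z0_v (n : ℕ) (f : (F.J n →₀ A) →ₗ[A] (J →₀ A)) (hf : ∀ x, f x ∈ G) (q k h) (s : D.S F q) :
    ((z0 (D := D) n f hf).v q k h s : D.Ysub G k).1 = D.ex f (s ⟨(n, k), h.symm⟩) := rfl

theorem δ_z0 (n : ℕ) (f : (F.J n →₀ A) →ₗ[A] (J →₀ A)) (hf : ∀ x, f x ∈ G)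
    (hfd : ∀ x, f (F.dl n x) = 0) : δ (n : ℤ) (n+1) (z0 (D := D) n f hf) = 0 := by
  ext1 q k h
  rw [δ_v (n:ℤ) (n+1) rfl _ q k h (k-1) (q+1) rfl rfl, SX_d D F rfl]
  refine ModuleCat.hom_ext (LinearMap.ext fun s => Subtype.ext ?_)
  have : ((n : ℤ)+1).negOnePow = (-1) ^ (n+1) := rfl
  rw [this]
  have a1 : k - 1 = q + n := by omega
  have a2 : k = q + 1 + n := by omega
  change D.md (k-1) k (D.ex f (s ⟨(n, k-1), a1⟩)) +
    (((-1) ^ (n+1) : ℤˣ) : ℤ) • D.ex f (D.SD F (q' := q + 1) rfl s ⟨(n, k), a2⟩) = 0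
  have hfd' : f ∘ₗ F.dl n = 0 := LinearMap.ext hfd
  rw [SD_apply D F _ s n k _ a1 (by push_cast; omega), map_add, map_zsmul, ex_ex, hfd',
    ex_zero, add_zero, smul_smul, md_ex]
  have : (((-1) ^ (n+1) : ℤˣ) : ℤ) * (-1) ^ n = -1 := by
    push_cast
    rw [← pow_add, Odd.neg_one_pow ⟨n, by ring⟩]
  rw [this]
  simp

theorem io_z0 {m n : ℕ} (f : (F.J n →₀ A) →ₗ[A] (J →₀ A)) (hf : ∀ x, f x ∈ G) (p : F.J m →₀ A)
    (n1 n2 : ℤ) (hn1 : n1 = -m) (h : n1 + n = n2) (hmn : n ≠ m) :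
    (D.io F m p n1 hn1).comp (z0 (D := D) n f hf) h = 0 := by
  ext1 k q hk
  rw [Cochain.comp_v _ _ h k (k+n1) q rfl (by omega)]
  refine ModuleCat.hom_ext (LinearMap.ext fun x => Subtype.ext ?_)
  have a1 : k = k + n1 + m := by omega
  have a2 : q = k + n1 + n := by omega
  change D.ex f (D.sg F m k a1 (D.mu p x) ⟨(n, q), a2⟩) = 0
  rw [sg_ne D F _ _ hmn, map_zero]

theorem io_z0_same {n : ℕ} (f : (F.J n →₀ A) →ₗ[A] (J →₀ A)) (hf : ∀ x, f x ∈ G) (p : F.J n →₀ A)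
    (n1 : ℤ) (hn1 : n1 = -n) (h : n1 + n = 0) :
    (D.io F n p n1 hn1).comp (z0 (D := D) n f hf) h = Cochain.ofHom (D.muY G (hf p)) := by
  ext1 k
  rw [Cochain.comp_v _ _ h k (k+n1) k rfl (by omega), Cochain.ofHom_v]
  refine ModuleCat.hom_ext (LinearMap.ext fun x => Subtype.ext ?_)
  have a1 : k = k + n1 + n := by omega
  change D.ex f (D.sg F n k a1 (D.mu p x) ⟨(n, k), a1⟩) = D.mu (f p) x
  rw [sg_same, ex_mu]

theorem exists_w [IsNoetherianRing A] {a b : ℤ} (hD : IsDz D a b) (hG : LR G)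
    (hV : ∀ i, a ≤ i → i ≤ b → ∃ (k n : ℕ) (B : Matrix (Fin k) (Fin n) A), RelAt D i B ∧
      ∀ m, V0 B (F.W m)) (n : ℕ) (hn : b - a < n) (f : (F.J n →₀ A) →ₗ[A] (J →₀ A))
    (hf : ∀ x, f x ∈ G) (hfd : ∀ x, f (F.dl n x) = 0) :
    ∃ w : Cochain (D.SX F) (D.Y G) (n - 1), δ ((n : ℤ) - 1) n w = z0 (D := D) n f hf := by
  refine homotopy_lemma b (Y_inj' hD hG) (fun k hk => Ysub_ss (hD.hi k hk)) a
    (fun k hk => Ysub_ss (hD.lo k hk)) ?_ _ (δ_z0 n f hf hfd)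
  intro q hq s hs
  rw [SX_d D F rfl] at hs
  rw [SX_d D F (show q - 1 + 1 = q by omega)]
  exact S_exact hD hV (q' := q - 1) (by omega) rfl (by omega) s hs

end XD
end P10
end FPDaux

namespace FPDaux
section P11
open CochainComplex.HomComplex
variable {A}

theorem proj_lift {P M N : Type u} [AddCommGroup P] [Module A P] [AddCommGroup M] [Module A M]
    [AddCommGroup N] [Module A N] (hP : Module.Projective A P) (g : M →ₗ[A] N) (c : P →ₗ[A] N)
    (h : ∀ p, ∃ y, g y = c p) : ∃ η : P →ₗ[A] M, ∀ p, g (η p) = c p := by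
  obtain ⟨η, hη⟩ := Module.projective_lifting_property g.rangeRestrict
    (c.codRestrict (LinearMap.range g) (fun p => h p)) g.surjective_rangeRestrict
  exact ⟨η, fun p => congrArg Subtype.val (LinearMap.congr_fun hη p)⟩

theorem abs_lemma (N : ℕ) (E P : ℕ → Type u) [∀ m, AddCommGroup (E m)] [∀ m, Module A (E m)]
    [∀ m, AddCommGroup (P m)] [∀ m, Module A (P m)] (hP : ∀ m, Module.Projective A (P m))
    (d : ∀ m, E (m+1) →ₗ[A] E m)
    (pd : ∀ m, P (m+1) →ₗ[A] P m) (hpd : ∀ m x, pd m (pd (m+1) x) = 0)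
    (θ : ∀ m, P m →ₗ[A] E (m+1)) (σ : ℤ) (hθ0 : ∀ p, d 0 (θ 0 p) = 0)
    (hθ : ∀ m, m < N → ∀ p, d (m+1) (θ (m+1) p) + σ • θ m (pd m p) = 0)
    {G : Type u} [AddCommGroup G] [Module A G] (γ : G →ₗ[A] E (N+1)) (f : P (N+1) →ₗ[A] G)
    (hθN : ∀ p, d (N+1) (θ (N+1) p) + σ • θ N (pd N p) = γ (f p))
    (hE : ∀ m, m < N → ∀ x, d m x = 0 → ∃ y, d (m+1) y = x)
    (hEN : ∀ x, d N x = 0 → ∃ g y, x = γ g + d (N+1) y)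
    (hγ : ∀ g y, γ g = d (N+1) y → g = 0) :
    ∃ g : P N →ₗ[A] G, ∀ p, f p = g (pd N p) := by
  have key : ∀ m, m ≤ N → ∃ c : P m →ₗ[A] E (m+1), (∀ p, d m (c p) = 0) ∧
      ∀ p, c (pd m p) = θ m (pd m p) := by
    intro m
    induction m with
    | zero => exact fun _ => ⟨θ 0, hθ0, fun _ => rfl⟩
    | succ m ih =>
      intro hm
      obtain ⟨c, h1, h2⟩ := ih (by omega)
      obtain ⟨η, hη⟩ := proj_lift (hP m) (d (m+1)) c (fun p => hE m (by omega) _ (h1 p))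
      refine ⟨θ (m+1) + σ • (η ∘ₗ pd m), fun p => ?_, fun p => ?_⟩
      · rw [LinearMap.add_apply, LinearMap.smul_apply, LinearMap.comp_apply, map_add, map_zsmul, hη,
          h2, hθ m (by omega)]
      · rw [LinearMap.add_apply, LinearMap.smul_apply, LinearMap.comp_apply, hpd, map_zero,
          smul_zero, add_zero]
  obtain ⟨c, h1, h2⟩ := key N le_rfl
  obtain ⟨η, hη⟩ := proj_lift (hP N) (LinearMap.coprod γ (d (N+1))) c (fun p => by
    obtain ⟨g, y, h⟩ := hEN _ (h1 p)
    exact ⟨(g, y), h.symm⟩)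
  refine ⟨σ • (LinearMap.fst A _ _ ∘ₗ η), fun p => ?_⟩
  have h3 := hη (pd N p)
  rw [h2, LinearMap.coprod_apply] at h3
  rw [← sub_eq_zero]
  refine hγ _ (θ (N+1) p + σ • (η (pd N p)).2) ?_
  rw [map_sub, map_add, map_zsmul, ← hθN, ← h3, LinearMap.smul_apply, map_zsmul, smul_add]
  simp only [LinearMap.comp_apply, LinearMap.fst_apply]
  abel

namespace XD
variable (D : XD A)

def CY (Y : Cplx A) (n : ℤ) : Type u := Cochain D.X Y n

variable (Y : Cplx A) (n : ℤ)

instance : AddCommGroup (D.CY Y n) := inferInstanceAs (AddCommGroup (Cochain D.X Y n))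

theorem rho_zero : D.rho 0 = 0 := by
  have := D.rho_add 0 0
  simpa using this

variable {Y n} in
theorem cy1 (z : Cochain D.X Y n) : (Cochain.ofHom (D.rho 1)).comp z (zero_add n) = z := by
  rw [D.rho_one, Cochain.id_comp]

variable {Y n} in
theorem cy2 (a b : A) (z : Cochain D.X Y n) :
    (Cochain.ofHom (D.rho (a * b))).comp z (zero_add n) =
      (Cochain.ofHom (D.rho a)).comp ((Cochain.ofHom (D.rho b)).comp z (zero_add n))
        (zero_add n) := by
  rw [D.rho_mul, Cochain.ofHom_comp, Cochain.comp_assoc_of_first_is_zero_cochain]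

variable {Y n} in
theorem cy3 (z : Cochain D.X Y n) : (Cochain.ofHom (D.rho 0)).comp z (zero_add n) = 0 := by
  rw [rho_zero, Cochain.ofHom_zero, Cochain.zero_comp]

variable {Y n} in
theorem cy4 (a b : A) (z : Cochain D.X Y n) :
    (Cochain.ofHom (D.rho (a + b))).comp z (zero_add n) =
      (Cochain.ofHom (D.rho a)).comp z (zero_add n) +
        (Cochain.ofHom (D.rho b)).comp z (zero_add n) := by
  rw [D.rho_add, Cochain.ofHom_add, Cochain.add_comp]

noncomputable instance : Module A (D.CY Y n) where
  smul a z := (Cochain.ofHom (D.rho a)).comp z (zero_add n)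
  one_smul z := D.cy1 z
  mul_smul a b z := D.cy2 a b z
  smul_zero a := Cochain.comp_zero _ _
  zero_smul z := D.cy3 z
  smul_add a z w := Cochain.comp_add _ _ _ _
  add_smul a b z := D.cy4 a b z

noncomputable def cd (p q : ℤ) : D.CY Y p →ₗ[A] D.CY Y q where
  toFun z := δ p q (F := D.X) (G := Y) z
  map_add' z w := δ_add _ _ _ _
  map_smul' a z := δ_ofHom_comp _ _ _

theorem cd_apply (p q : ℤ) (z : Cochain D.X Y p) : D.cd Y p q z = δ p q z := rfl

variable {J : Type u} (G : Submodule A (J →₀ A))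

noncomputable def gam0 : G →ₗ[A] D.CY (D.Y G) 0 where
  toFun g := Cochain.ofHom (D.muY G g.2)
  map_add' g g' := by
    change Cochain.ofHom (D.muY G (add_mem g.2 g'.2)) = _
    rw [muY_add g.2 g'.2, Cochain.ofHom_add]; rfl
  map_smul' a g := by
    change Cochain.ofHom (D.muY G (G.smul_mem a g.2)) =
      (Cochain.ofHom (D.rho a)).comp (Cochain.ofHom (D.muY G g.2)) (zero_add 0)
    rw [← rho_muY, Cochain.ofHom_comp]

noncomputable def gam (e : ℤ) (he : e = 0) : G →ₗ[A] D.CY (D.Y G) e := he ▸ D.gam0 G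

noncomputable def th (F : Res A) (Y : Cplx A) (n : ℤ) (w : Cochain (D.SX F) Y n) (m : ℕ) (e : ℤ)
    (he : -(m : ℤ) + n = e) : (F.J m →₀ A) →ₗ[A] D.CY Y e where
  toFun p := (D.io F m p (-m) rfl).comp w he
  map_add' p p' := by
    have : D.io F m (p + p') (-m) rfl = D.io F m p (-m) rfl + D.io F m p' (-m) rfl := by
      ext1 k q h
      refine ModuleCat.hom_ext (LinearMap.ext fun x => ?_)
      have a1 : k = q + m := by omega
      change D.sg F m k a1 (D.mu (p + p') x) = D.sg F m k a1 (D.mu p x) + D.sg F m k a1 (D.mu p' x)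
      rw [mu_add, map_add]
    rw [this]
    exact Cochain.add_comp _ _ _ _
  map_smul' a p := by
    have : D.io F m (a • p) (-m) rfl =
        (Cochain.ofHom (D.rho a)).comp (D.io F m p (-m) rfl) (zero_add _) := by
      ext1 k q h
      rw [Cochain.zero_cochain_comp_v, Cochain.ofHom_v]
      refine ModuleCat.hom_ext (LinearMap.ext fun x => ?_)
      have a1 : k = q + m := by omega
      change D.sg F m k a1 (D.mu (a • p) x) = D.sg F m k a1 (D.mu p (D.r a x))
      rw [mu_smul]
    rw [this, Cochain.comp_assoc_of_first_is_zero_cochain]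
    rfl

variable {D G}

theorem main [IsNoetherianRing A] {a b : ℤ} (hD : IsDz D a b) (hG : LR G) {F : Res A}
    (hV : ∀ i, a ≤ i → i ≤ b → ∃ (k n : ℕ) (B : Matrix (Fin k) (Fin n) A), RelAt D i B ∧
      ∀ m, V0 B (F.W m)) (N : ℕ) (hn : b - a < (N + 1 : ℕ))
    (f : (F.J (N+1) →₀ A) →ₗ[A] G)
    (hfd : ∀ x, f (F.dl (N+1) x) = 0) :
    ∃ g : (F.J N →₀ A) →ₗ[A] G, ∀ p, f p = g (F.dl N p) := by
  have hm : ∀ x, (G.subtype ∘ₗ f) x ∈ G := fun x => (f x).2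
  obtain ⟨w, hw⟩ := exists_w hD hG hV (N+1) hn (G.subtype ∘ₗ f) hm
    (fun x => congrArg Subtype.val (hfd x))
  have hdeg : ∀ m : ℕ, -(m : ℤ) + (((N + 1 : ℕ) : ℤ) - 1) = ((N + 1 : ℕ) : ℤ) - (m + 1 : ℕ) := by
    intro m; push_cast; omega
  have hio : ∀ (m : ℕ) (p : F.J m →₀ A) (e : ℤ) (he : -(m:ℤ) + (N + 1 : ℕ) = e) (z),
      δ (-(m:ℤ)) (-(m:ℤ) + 1) (D.io F m p (-m) rfl) = z →
      δ (((N + 1 : ℕ) : ℤ) - (m + 1 : ℕ)) e ((D.io F m p (-m) rfl).comp w (hdeg m)) =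
        (D.io F m p (-m) rfl).comp (z0 (D := D) (N+1) (G.subtype ∘ₗ f) hm) he +
        ((((N + 1 : ℕ) : ℤ) - 1).negOnePow : ℤ) • z.comp w (by omega) := by
    rintro m p e he _ rfl
    rw [δ_comp _ _ _ (-(m:ℤ) + 1) ((N + 1 : ℕ) : ℤ) e (by omega) rfl (by omega), hw]
    rfl
  have hc0 : ∀ (p : F.J 0 →₀ A) (e : ℤ) (he : -((0:ℕ):ℤ) + (N + 1 : ℕ) = e),
      δ (((N + 1 : ℕ) : ℤ) - (0 + 1 : ℕ)) e ((D.io F 0 p (-((0:ℕ):ℤ)) rfl).comp w (hdeg 0)) = 0 := by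
    intro p e he
    rw [hio 0 p e he 0 (D.δ_io_zero F p _ _ _ (by simp)), io_z0 _ _ _ _ _ _ _ (by omega),
      Cochain.zero_comp, smul_zero, add_zero]
  have hcs : ∀ (m : ℕ) (p : F.J (m+1) →₀ A) (e : ℤ) (he : -((m+1:ℕ):ℤ) + (N + 1 : ℕ) = e)
      (h2 : -(m : ℤ) + (((N + 1 : ℕ) : ℤ) - 1) = e),
      δ (((N + 1 : ℕ) : ℤ) - (m + 1 + 1 : ℕ)) e
        ((D.io F (m+1) p (-((m+1:ℕ):ℤ)) rfl).comp w (hdeg (m+1))) =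
        (D.io F (m+1) p (-((m+1:ℕ):ℤ)) rfl).comp (z0 (D := D) (N+1) (G.subtype ∘ₗ f) hm) he +
        ((((N + 1 : ℕ) : ℤ) - 1).negOnePow : ℤ) • (D.io F m (F.dl m p) (-m) rfl).comp w h2 := by
    intro m p e he h2
    have a0 : (-((m+1 : ℕ):ℤ) + 1) = -(m:ℤ) := by push_cast; omega
    rw [hio (m+1) p e he _ (D.δ_io_succ F m p _ _ _ a0)]
    have gen : ∀ (e' : ℤ) (h1 : e' = -m) (h3), (D.io F m (F.dl m p) e' h1).comp w h3 =
        (D.io F m (F.dl m p) (-m) rfl).comp w h2 := by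
      rintro _ rfl _; rfl
    rw [gen]
  refine abs_lemma (G := G) N (fun m => D.CY (D.Y G) (((N + 1 : ℕ) : ℤ) - m)) (fun m => F.J m →₀ A)
    (fun m => inferInstance) (fun m => D.cd _ _ _) F.dl F.dl_dl
    (fun m => D.th F (D.Y G) _ w m _ (hdeg m)) (-((((N + 1 : ℕ) : ℤ) - 1).negOnePow : ℤ)) ?_ ?_
    (D.gam G (((N + 1 : ℕ) : ℤ) - (N + 1 : ℕ)) (sub_self _)) f ?_ ?_ ?_ ?_
  · intro p
    exact hc0 p _ (by push_cast; omega)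
  · intro m hmN p
    rw [neg_smul, ← sub_eq_add_neg, sub_eq_zero]
    have := hcs m p (((N + 1 : ℕ) : ℤ) - (m + 1 : ℕ)) (by push_cast; omega) (hdeg m)
    rw [io_z0 _ hm _ _ _ _ _ (by omega), zero_add] at this
    exact this
  · intro p
    rw [neg_smul, ← sub_eq_add_neg, sub_eq_iff_eq_add]
    have gen : ∀ (e : ℤ) (h1 : e = 0) (h2), (D.io F (N+1) p (-((N+1 : ℕ) : ℤ)) rfl).comp
          (z0 (D := D) (N+1) (G.subtype ∘ₗ f) hm) (n₁₂ := e) h2 =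
          D.gam G e h1 (f p) := by
      rintro _ rfl h2
      exact io_z0_same _ _ _ _ _ _
    have := hcs N p (((N + 1 : ℕ) : ℤ) - (N + 1 : ℕ)) (by push_cast; omega) (hdeg N)
    rw [gen _ (sub_self _)] at this
    exact this
  · intro m hm x hx
    have gen : ∀ (e e1 e' : ℤ) (_ : e + 1 = e1) (_ : e' + 1 = e) (_ : e ≠ 0) (z : D.CY (D.Y G) e),
        D.cd (D.Y G) e e1 z = 0 → ∃ y : D.CY (D.Y G) e', D.cd (D.Y G) e' e y = z := by
      rintro e _ e' rfl h h0 z hz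
      obtain rfl : e' = e - 1 := by omega
      exact K2ne hD hG h0 z hz
    exact gen _ _ _ (by push_cast; omega) (by push_cast; omega) (by push_cast; omega) x hx
  · intro x hx
    have gen : ∀ (e e1 e' : ℤ) (he : e = 0) (_ : e1 = 1) (_ : e' = -1) (z : D.CY (D.Y G) e),
        D.cd (D.Y G) e e1 z = 0 → ∃ (g : G) (y : D.CY (D.Y G) e'),
          z = D.gam G e he g + D.cd (D.Y G) e' e y := by
      rintro _ _ _ rfl rfl rfl z hz
      obtain ⟨g, hg, w, hw⟩ := K2zero hD hG z hz
      exact ⟨⟨g, hg⟩, w, hw⟩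
    exact gen _ _ _ (by push_cast; omega) (by push_cast; omega) (by push_cast; omega) x hx
  · intro g y hy
    have gen : ∀ (e e' : ℤ) (he : e = 0) (_ : e' = -1) (y : D.CY (D.Y G) e'),
        D.gam G e he g = D.cd (D.Y G) e' e y → g = 0 := by
      rintro _ _ rfl rfl y hy
      exact Subtype.ext (K2inj hD g.2 ⟨y, hy⟩)
    exact gen _ _ (by push_cast; omega) (by push_cast; omega) y hy

end XD
end P11
end FPDaux

namespace FPDaux
section P12
variable {A}

theorem main_split [IsNoetherianRing A] {D : XD A} {a b : ℤ} (hD : IsDz D a b) {J : Type u}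
    {G : Submodule A (J →₀ A)} (hG : LR G) {F : Res A}
    (hV : ∀ i, a ≤ i → i ≤ b → ∃ (k n : ℕ) (B : Matrix (Fin k) (Fin n) A), RelAt D i B ∧
      ∀ m, V0 B (F.W m)) (N : ℕ) (hn : b - a < (N + 1 : ℕ))
    (α : F.W (N+1) →ₗ[A] G) (β : G →ₗ[A] F.W (N+1)) (hab : ∀ x, β (α x) = x) :
    Module.Projective A (F.W N) := by
  obtain ⟨g, hg⟩ := XD.main hD hG hV N hn (α ∘ₗ F.e (N+1)) (fun x => by
    change α (F.e (N+1) (F.dl (N+1) x)) = 0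
    rw [F.e_dl, map_zero])
  have h2 : (β ∘ₗ g) ∘ₗ F.k N = LinearMap.id := by
    refine LinearMap.ext fun x => ?_
    obtain ⟨p, rfl⟩ := F.e_surj (N+1) x
    have := congrArg β (hg p)
    change β (α (F.e (N+1) p)) = β (g (F.k N (F.e (N+1) p))) at this
    rw [hab] at this
    exact this.symm
  have t : Function.Injective (F.k N) ∧ ∃ l, F.e N ∘ₗ l = LinearMap.id :=
    ((F.ek N).split_tfae'.out 0 1 rfl rfl).2 ⟨F.e_surj N, _, h2⟩
  obtain ⟨-, l, hl⟩ := t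
  exact Module.Projective.of_split l (F.e N) hl

noncomputable def resOf (M : ModuleCat.{u} A) : ∀ m : ℕ, ModuleCat.{u} A
  | 0 => M
  | m+1 => Om (resOf M m)

theorem resOf_eq (M : ModuleCat.{u} A) : ∀ m, resOf M m = Om^[m] M
  | 0 => rfl
  | m+1 => by rw [Function.iterate_succ_apply', ← resOf_eq M m]; rfl

noncomputable def RS (M : ModuleCat.{u} A) : Res A where
  J m := resOf M m
  W m := resOf M m
  e m := Finsupp.linearCombination A (id : resOf M m → resOf M m)
  k m := (LinearMap.ker (Finsupp.linearCombination A (id : resOf M m → resOf M m))).subtype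
  e_surj m := lc_surj _
  k_inj m := Subtype.val_injective
  ek m := LinearMap.exact_subtype_ker_map _

theorem app1 [IsNoetherianRing A] (hA : IsNoetherianRing Aᵐᵒᵖ) {D : XD A} {a b : ℤ}
    (hD : IsDz D a b) (F : ModuleCat.{u} A) (hF : FlatM A F) : PD (b - a).toNat F := by
  have hfl : ∀ m, FlatM A (resOf F m) := by
    intro m
    induction m with
    | zero => exact hF
    | succ m ih => exact Flat_Om hA ih
  have hp : Module.Projective A ((RS F).W (b - a).toNat) := by
    refine main_split hD (LR_of_flat (hfl (b - a).toNat)) (F := RS F) ?_ _ (by push_cast; omega)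
      LinearMap.id LinearMap.id (fun _ => rfl)
    intro i _ _
    obtain ⟨k, m, B, hB⟩ := exists_RelAt hA hD i
    exact ⟨k, m, B, hB, fun n => hfl n _ _ B⟩
  have : PD (0 + (b - a).toNat) F := by
    rw [PD_Om_iter, ← resOf_eq, ← proj_iff_PD]
    exact hp
  rwa [zero_add] at this

theorem app2 [IsNoetherianRing A] {D : XD A} {a b : ℤ}
    (hD : IsDz D a b) (M : ModuleCat.{u} A)
    (hV : ∀ i, a ≤ i → i ≤ b → ∃ (k n : ℕ) (B : Matrix (Fin k) (Fin n) A), RelAt D i B ∧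
      ∀ m, V0 B (Om^[m] M))
    (hP : Module.Projective A (Om^[(b - a).toNat + 1] M)) :
    Module.Projective A (Om^[(b - a).toNat] M) := by
  rw [← resOf_eq] at hP ⊢
  obtain ⟨s, hs⟩ := Module.projective_lifting_property
    (Finsupp.linearCombination A (id : resOf M ((b-a).toNat + 1) → _)) LinearMap.id (lc_surj _)
  refine main_split hD (LR_top (resOf M ((b-a).toNat + 1))) (F := RS M) ?_ _ (by push_cast; omega)
    (s.codRestrict ⊤ (fun _ => trivial))
    ((Finsupp.linearCombination A (id : resOf M ((b-a).toNat + 1) → _)) ∘ₗ Submodule.subtype _)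
    (fun x => LinearMap.congr_fun hs x)
  intro i h1 h2
  obtain ⟨k, m, B, hB, h⟩ := hV i h1 h2
  refine ⟨k, m, B, hB, fun n => ?_⟩
  have := h n
  rw [← resOf_eq] at this
  exact this

theorem FPD_of_dz [IsNoetherianRing A] (hA : IsNoetherianRing Aᵐᵒᵖ) {D : XD A} {a b : ℤ}
    (hD : IsDz D a b) (h3 : C3 A) : FPDFinite A := by
  choose l m B hB using fun i : {i : ℤ // i ∈ Finset.Icc a b} => exists_RelAt hA hD i.1
  refine FPD_of_apps hA h3 _ (app1 hA hD) (b - a).toNat l m B (fun M hM hP => app2 hD M ?_ hP)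
  intro i h1 h2
  let i' : {i : ℤ // i ∈ Finset.Icc a b} := ⟨i, Finset.mem_Icc.2 ⟨h1, h2⟩⟩
  exact ⟨_, _, B i', hB i', hM i'⟩

end P12
end FPDaux

namespace FPDaux
section P13
open TensorProduct
variable {A}

theorem sc_fin {S : Type u} [Ring S] (T : ShortComplex (ModuleCat.{u} S))
    (hf : Module.Finite S T.homology) : ∃ (k : ℕ) (h : Fin k → T.X₂), (∀ l, T.g (h l) = 0) ∧
    ∀ x : T.X₂, T.g x = 0 → ∃ (c : Fin k → S) (y : T.X₁), x = ∑ l, c l • h l + T.f y := by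
  have e : T.homology ≃ₗ[S] (LinearMap.ker T.g.hom ⧸ LinearMap.range T.moduleCatToCycles) :=
    T.moduleCatHomologyIso.toLinearEquiv
  have hf' : Module.Finite S (LinearMap.ker T.g.hom ⧸ LinearMap.range T.moduleCatToCycles) :=
    Module.Finite.equiv e
  obtain ⟨k, s, hs⟩ := Module.Finite.exists_fin (R := S)
    (M := LinearMap.ker T.g.hom ⧸ LinearMap.range T.moduleCatToCycles)
  choose t ht using fun i => Submodule.Quotient.mk_surjective _ (s i)
  refine ⟨k, fun i => (t i).1, fun i => (t i).2, fun x hx => ?_⟩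
  have hm : (Submodule.Quotient.mk ⟨x, hx⟩ :
      LinearMap.ker T.g.hom ⧸ LinearMap.range T.moduleCatToCycles) ∈
      Submodule.span S (Set.range s) := by rw [hs]; trivial
  obtain ⟨c, hc⟩ := (Submodule.mem_span_range_iff_exists_fun S).1 hm
  have h2 : (Submodule.Quotient.mk ⟨x, hx⟩ :
      LinearMap.ker T.g.hom ⧸ LinearMap.range T.moduleCatToCycles) =
      (LinearMap.range T.moduleCatToCycles).mkQ (∑ i, c i • t i) := by
    rw [map_sum, ← hc]
    refine Finset.sum_congr rfl fun i _ => ?_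
    rw [map_smul, ← ht]
    rfl
  obtain ⟨y, hy⟩ := (Submodule.Quotient.eq _).1 h2
  refine ⟨c, y, ?_⟩
  have h3 := congrArg Subtype.val hy
  rw [AddSubgroupClass.coe_sub, AddSubmonoidClass.coe_finset_sum] at h3
  change T.f y = x - ∑ l, c l • (t l).1 at h3
  rw [h3]; abel

theorem cx_fin {S : Type u} [Ring S] (K : CochainComplex (ModuleCat.{u} S) ℤ) (n : ℤ)
    (hf : Module.Finite S (K.homology n)) : ∃ (k : ℕ) (h : Fin k → K.X n),
    (∀ l, K.d n (n+1) (h l) = 0) ∧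
    ∀ x : K.X n, K.d n (n+1) x = 0 →
      ∃ (c : Fin k → S) (y : K.X (n-1)), x = ∑ l, c l • h l + K.d (n-1) n y := by
  have e := (ShortComplex.homologyMapIso
    (K.isoSc' (n-1) n (n+1) (by simp) (by simp))).toLinearEquiv
  exact sc_fin (K.sc' (n-1) n (n+1)) (@Module.Finite.equiv _ _ _ _ _ _ _ _ hf e)

noncomputable def XDof (R : CochainComplex (ModuleCat.{u} (Env A)) ℤ) : XD A where
  X := (resLC A).obj R
  rho := rmulChain A R
  rho_add a b := by
    refine HomologicalComplex.hom_ext _ _ fun i => ModuleCat.hom_ext (LinearMap.ext fun x => ?_)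
    change ((1 : A) ⊗ₜ[ℤ] MulOpposite.op (a + b) : Env A) • (id x : R.X i) =
      ((1 : A) ⊗ₜ[ℤ] MulOpposite.op a : Env A) • (id x : R.X i) +
      ((1 : A) ⊗ₜ[ℤ] MulOpposite.op b : Env A) • (id x : R.X i)
    rw [MulOpposite.op_add, TensorProduct.tmul_add, add_smul]
  rho_mul a b := by
    refine HomologicalComplex.hom_ext _ _ fun i => ModuleCat.hom_ext (LinearMap.ext fun x => ?_)
    change ((1 : A) ⊗ₜ[ℤ] MulOpposite.op (a * b) : Env A) • (id x : R.X i) =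
      ((1 : A) ⊗ₜ[ℤ] MulOpposite.op b : Env A) •
      ((1 : A) ⊗ₜ[ℤ] MulOpposite.op a : Env A) • (id x : R.X i)
    rw [smul_smul, Algebra.TensorProduct.tmul_mul_tmul, MulOpposite.op_mul, one_mul]
  rho_one := by
    refine HomologicalComplex.hom_ext _ _ fun i => ModuleCat.hom_ext (LinearMap.ext fun x => ?_)
    change (1 : Env A) • (id x : R.X i) = x
    rw [one_smul]; rfl

theorem exists_dz (h : HasDualizingComplex A) : ∃ (D : XD A) (a b : ℤ), IsDz D a b := by
  obtain ⟨R, ⟨a, b, hab⟩, hi, -, hfl, hfr, ⟨q1, q2, q3⟩, -⟩ := h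
  refine ⟨XDof R, a, b, ?_, ?_, hi, ?_, ?_, q1, q2, q3⟩
  · intro k hk
    exact (ModuleCat.subsingleton_of_isZero (hab k (Or.inl hk)) : Subsingleton (R.X k))
  · intro k hk
    exact (ModuleCat.subsingleton_of_isZero (hab k (Or.inr hk)) : Subsingleton (R.X k))
  · intro i
    exact cx_fin _ i (hfl i)
  · intro i
    obtain ⟨k, h, h1, h2⟩ := cx_fin _ i (hfr i)
    refine ⟨k, h, h1, fun x hx => ?_⟩
    obtain ⟨c, y, hy⟩ := h2 x hx
    exact ⟨fun l => (c l).unop, y, hy⟩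

end P13
end FPDaux

/-- For any ring `A`, (1) `FPD(A) < ∞` implies (2) every
bounded below GP-acyclic complex of Gorenstein-projectives is contractible,
which implies (3) every bounded below acyclic complex of projectives is
contractible; and if `A` is left and right noetherian and admits a dualizing
complex, then (1), (2) and (3) are equivalent. -/
theorem fpd_iff_contractibility :
    ((FPDFinite A →
        ∀ X : Cplx A, BoundedBelow A X → GPAcyclic A X →
          (∀ n : ℤ, IsGorensteinProjective A (X.X n)) → Contractible A X) ∧
      ((∀ X : Cplx A, BoundedBelow A X → GPAcyclic A X →
          (∀ n : ℤ, IsGorensteinProjective A (X.X n)) → Contractible A X) →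
        ∀ X : Cplx A, BoundedBelow A X → IsAcyclicComplex A X →
          (∀ n : ℤ, Module.Projective A (X.X n)) → Contractible A X)) ∧
    (IsNoetherianRing A → IsNoetherianRing Aᵐᵒᵖ → HasDualizingComplex A →
      ((FPDFinite A ↔
        ∀ X : Cplx A, BoundedBelow A X → GPAcyclic A X →
          (∀ n : ℤ, IsGorensteinProjective A (X.X n)) → Contractible A X) ∧
       (FPDFinite A ↔
        ∀ X : Cplx A, BoundedBelow A X → IsAcyclicComplex A X →
          (∀ n : ℤ, Module.Projective A (X.X n)) → Contractible A X))) := by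
  have h12 := fun h : FPDFinite A => FPDaux.two_of_C3 (FPDaux.FPD_to_C3 h)
  have h23 := FPDaux.three_of_two (A := A)
  refine ⟨⟨h12, h23⟩, fun hl hr hdz => ?_⟩
  obtain ⟨D, a, b, hD⟩ := FPDaux.exists_dz hdz
  have h31 := fun h => FPDaux.FPD_of_dz hr hD (FPDaux.c3_of_3 (A := A) h)
  exact ⟨⟨h12, fun h => h31 (h23 h)⟩, ⟨fun h => h23 (h12 h), h31⟩⟩
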